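/- arXiv:math/0309022 — 2 statements merged into one kernel-verified Lean document; each statement's English description precedes it below -/
import Mathlib

section
/- For every ζ ∈ ∂𝔻, the impression I(ζ) contains at most two points at which K is locally connected; that is, the set {z ∈ I(ζ) : K is locally connected at z} has at most two elements. -/
open Filter Topology Metric Set OnePoint

noncomputable section

local notation "ℂ∞" => OnePoint ℂ

/-- A set `K` is locally connected (connected im kleinen) at a point `z`:
every neighborhood of `z` in `K` contains a connected neighborhood of `z` in `K`. -/
def LocallyConnectedAt {X : Type*} [TopologicalSpace X] (K : Set X) (z : X) : Prop :=
  ∀ V ∈ 𝓝[K] z, ∃ N ∈ 𝓝[K] z, N ⊆ K ∩ V ∧ IsConnected N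

/-- `φ : ℂ → ℂ∞` is holomorphic, as a map into the Riemann sphere, on `D`:
near every point of `D` it is either given by an analytic `ℂ`-valued function, or by the
reciprocal of one. -/
def HolomorphicIntoSphereOn (φ : ℂ → ℂ∞) (D : Set ℂ) : Prop :=
  ∀ z ∈ D,
    (∃ g : ℂ → ℂ, AnalyticAt ℂ g z ∧ ∀ᶠ w in 𝓝 z, φ w = ((g w : ℂ) : ℂ∞)) ∨
    (∃ g : ℂ → ℂ, AnalyticAt ℂ g z ∧
      ∀ᶠ w in 𝓝 z, φ w = if g w = 0 then (∞ : ℂ∞) else (((g w)⁻¹ : ℂ) : ℂ∞))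

/-- The impression of the prime end `ζ ∈ ∂𝔻` (cluster set of `φ` at `ζ`). -/
def impression (φ : ℂ → ℂ∞) (ζ : ℂ) : Set ℂ∞ :=
  {z | ∃ w : ℕ → ℂ, (∀ j, w j ∈ ball (0 : ℂ) 1) ∧ Tendsto w atTop (𝓝 ζ) ∧
    Tendsto (fun j => φ (w j)) atTop (𝓝 z)}

/-- The set of principal points of the prime end `ζ` (radial cluster set of `φ` at `ζ`). -/
def principalPoints (φ : ℂ → ℂ∞) (ζ : ℂ) : Set ℂ∞ :=
  {z | ∃ t : ℕ → ℝ, (∀ j, t j ∈ Ico (0 : ℝ) 1) ∧ Tendsto t atTop (𝓝 1) ∧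
    Tendsto (fun j => φ ((t j : ℂ) * ζ)) atTop (𝓝 z)}

/-- The accumulation set of a curve `Γ : [0,∞) → ℂ∞`: all limits of sequences `Γ (t j)`
with `t j → ∞`. -/
def accSet (Γ : ℝ → ℂ∞) : Set ℂ∞ :=
  {z | ∃ t : ℕ → ℝ, Tendsto t atTop atTop ∧ Tendsto (fun j => Γ (t j)) atTop (𝓝 z)}

/-- `Γ` is a (continuous) curve `[0,∞) → U`. -/
def IsCurveIn (U : Set ℂ∞) (Γ : ℝ → ℂ∞) : Prop :=
  ContinuousOn Γ (Ici 0) ∧ MapsTo Γ (Ici 0) U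

/-- The curve `Γ : [0,∞) → U` converges to the prime end `ζ`: `φ⁻¹(Γ(t)) = ψ(Γ(t)) → ζ`. -/
def ConvergesToPrimeEnd (U : Set ℂ∞) (ψ : ℂ∞ → ℂ) (Γ : ℝ → ℂ∞) (ζ : ℂ) : Prop :=
  IsCurveIn U Γ ∧ Tendsto (fun t => ψ (Γ t)) atTop (𝓝 ζ)

/-- `Γ` converges to the prime end `ζ` from the left. -/
def ConvergesFromLeft (U : Set ℂ∞) (ψ : ℂ∞ → ℂ) (Γ : ℝ → ℂ∞) (ζ : ℂ) : Prop :=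
  ConvergesToPrimeEnd U ψ Γ ζ ∧ ∀ᶠ t in atTop, 0 ≤ (ψ (Γ t) / ζ).im

/-- `Γ` converges to the prime end `ζ` from the right. -/
def ConvergesFromRight (U : Set ℂ∞) (ψ : ℂ∞ → ℂ) (Γ : ℝ → ℂ∞) (ζ : ℂ) : Prop :=
  ConvergesToPrimeEnd U ψ Γ ζ ∧ ∀ᶠ t in atTop, (ψ (Γ t) / ζ).im ≤ 0

/-- The left wing `I⁺(ζ)` of the prime end `ζ`. -/
def leftWing (U : Set ℂ∞) (ψ : ℂ∞ → ℂ) (ζ : ℂ) : Set ℂ∞ :=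
  {z | ∃ Γ : ℝ → ℂ∞, ConvergesFromLeft U ψ Γ ζ ∧ z ∈ accSet Γ}

/-- The right wing `I⁻(ζ)` of the prime end `ζ`. -/
def rightWing (U : Set ℂ∞) (ψ : ℂ∞ → ℂ) (ζ : ℂ) : Set ℂ∞ :=
  {z | ∃ Γ : ℝ → ℂ∞, ConvergesFromRight U ψ Γ ζ ∧ z ∈ accSet Γ}

/-- `z` has priority over `w` in the left wing of `ζ`. -/
def PriorityLeft (U : Set ℂ∞) (ψ : ℂ∞ → ℂ) (ζ : ℂ) (z w : ℂ∞) : Prop :=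
  ∀ Γ : ℝ → ℂ∞, ConvergesFromLeft U ψ Γ ζ → w ∈ accSet Γ → z ∈ accSet Γ

/-- `z` has priority over `w` in the right wing of `ζ`. -/
def PriorityRight (U : Set ℂ∞) (ψ : ℂ∞ → ℂ) (ζ : ℂ) (z w : ℂ∞) : Prop :=
  ∀ Γ : ℝ → ℂ∞, ConvergesFromRight U ψ Γ ζ → w ∈ accSet Γ → z ∈ accSet Γ

/-- The sequence `w` accumulates at `z` (some subsequence converges to `z`). -/
def SeqAccumAt (w : ℕ → ℂ∞) (z : ℂ∞) : Prop :=
  ∃ n : ℕ → ℕ, StrictMono n ∧ Tendsto (fun j => w (n j)) atTop (𝓝 z)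

/-- `z₀` is strongly minimal in the prime end `ζ`: every sequence in `U` converging to the
prime end `ζ` and not accumulating at `z₀` lies on a curve converging to `ζ` whose
accumulation set misses `z₀`. -/
def StronglyMinimal (U : Set ℂ∞) (ψ : ℂ∞ → ℂ) (ζ : ℂ) (z₀ : ℂ∞) : Prop :=
  ∀ w : ℕ → ℂ∞, (∀ j, w j ∈ U) → Tendsto (fun j => ψ (w j)) atTop (𝓝 ζ) →
    ¬ SeqAccumAt w z₀ →
    ∃ Γ : ℝ → ℂ∞, ConvergesToPrimeEnd U ψ Γ ζ ∧ (∀ j, ∃ t, 0 ≤ t ∧ Γ t = w j) ∧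
      z₀ ∉ accSet Γ


section
open Filter Topology Metric Set

lemma pw_const_of_exp {S : Set ℂ} (hS : IsPreconnected S) {g : ℂ → ℂ} (hg : ContinuousOn g S)
    (h1 : ∀ z ∈ S, Complex.exp (g z) = 1) : ∃ c, Complex.exp c = 1 ∧ ∀ z ∈ S, g z = c := by
  rcases S.eq_empty_or_nonempty with rfl | ⟨x, hx⟩
  · exact ⟨0, by simp, by simp⟩
  refine ⟨g x, h1 x hx, fun z hz => ?_⟩
  refine hS.induction₂ (fun x y => g x = g y) ?_ (fun _ _ _ _ _ _ h h' => h.trans h')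
    (fun _ _ _ _ h => h.symm) hz hx
  intro y hy
  have := (Metric.tendsto_nhds.1 (hg y hy)) (2 * Real.pi) (by positivity)
  filter_upwards [this, self_mem_nhdsWithin] with w hw hwS
  have e : Complex.exp (g w - g y) = 1 := by rw [Complex.exp_sub, h1 _ hwS, h1 _ hy]; simp
  obtain ⟨n, hn⟩ := Complex.exp_eq_one_iff.1 e
  rw [dist_eq_norm, hn] at hw
  simp [abs_of_pos Real.pi_pos] at hw
  have : |(n : ℝ)| < 1 := by
    by_contra h
    push Not at h
    nlinarith [Real.pi_pos]
  have h0 : n = 0 := by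
    have : |n| < 1 := by exact_mod_cast this
    exact Int.abs_lt_one_iff.1 this
  rw [h0] at hn
  simp at hn
  exact (sub_eq_zero.1 hn).symm

lemma pw_preconn_outside {c : ℂ} {R : ℝ} (hR : 0 < R) : IsPreconnected {z : ℂ | R < dist z c} := by
  have : {z : ℂ | R < dist z c} = (fun z => c + Complex.exp z) '' {z | Real.log R < z.re} := by
    ext z
    constructor
    · intro hz
      have hz' : R < ‖z - c‖ := by simpa [dist_eq_norm] using hz
      refine ⟨Complex.log (z - c), ?_, ?_⟩
      · simp only [mem_ofPred_eq, Complex.log_re]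
        exact Real.log_lt_log hR hz'
      · have : z - c ≠ 0 := by rw [← norm_pos_iff]; linarith
        simp [Complex.exp_log this]
    · rintro ⟨w, hw, rfl⟩
      simp only [mem_ofPred_eq, dist_eq_norm, add_sub_cancel_left, Complex.norm_exp] at hw ⊢
      rw [← Real.log_lt_iff_lt_exp hR]; exact hw
  rw [this]
  exact ((convex_halfSpace_re_gt _).isPreconnected).image _ (by fun_prop)

def PwHasLog (X : Set ℂ) (a b : ℂ) : Prop :=
  ∃ L : ℂ → ℂ, ContinuousOn L X ∧ ∀ z ∈ X, Complex.exp (L z) * (z - b) = z - a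

lemma PwHasLog.symm {X : Set ℂ} {a b : ℂ} (h : PwHasLog X a b) : PwHasLog X b a := by
  obtain ⟨L, hL, h⟩ := h
  refine ⟨fun z => - L z, hL.neg, fun z hz => ?_⟩
  rw [← h z hz, ← mul_assoc, ← Complex.exp_add]; simp

lemma PwHasLog.trans {X : Set ℂ} {a b c : ℂ} (h : PwHasLog X a b) (h' : PwHasLog X b c) :
    PwHasLog X a c := by
  obtain ⟨L, hL, h⟩ := h
  obtain ⟨L', hL', h'⟩ := h'
  refine ⟨fun z => L z + L' z, hL.add hL', fun z hz => ?_⟩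
  rw [Complex.exp_add, mul_assoc, h' z hz, h z hz]

lemma pw_hasLog_of_preconn {X S : Set ℂ} (hX : IsClosed X) (hS : IsPreconnected S)
    (hSX : Disjoint S X) {a b : ℂ} (ha : a ∈ S) (hb : b ∈ S) : PwHasLog X a b := by
  refine hS.induction₂ (fun x y => PwHasLog X x y) ?_ (fun _ _ _ _ _ _ h h' => h.trans h')
    (fun _ _ _ _ h => h.symm) ha hb
  intro x hx
  have hxX : x ∉ X := fun h => hSX.le_bot ⟨hx, h⟩
  obtain ⟨r, hr, hball⟩ := Metric.isOpen_iff.1 hX.isOpen_compl x hxX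
  filter_upwards [mem_nhdsWithin_of_mem_nhds (Metric.ball_mem_nhds x hr)] with y hy
  have hy' : ‖y - x‖ < r := by simpa [dist_eq_norm] using hy
  have key : ∀ z ∈ X, z - x ≠ 0 ∧ 1 - (y - x) / (z - x) ∈ Complex.slitPlane := by
    intro z hz
    have h1 : r ≤ ‖z - x‖ := by
      by_contra h
      exact hball (by simpa [dist_eq_norm] using h) hz
    have h0 : z - x ≠ 0 := by rw [← norm_pos_iff]; linarith
    refine ⟨h0, ?_⟩
    left
    have : ‖(y - x) / (z - x)‖ < 1 := by
      rw [norm_div, div_lt_one (by linarith)]; linarith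
    have := (Complex.re_le_norm _).trans_lt this
    simp only [Complex.sub_re, Complex.one_re]; linarith
  refine ⟨fun z => - Complex.log (1 - (y - x) / (z - x)), ?_, ?_⟩
  · refine ContinuousOn.neg (ContinuousOn.clog ?_ fun z hz => (key z hz).2)
    exact continuousOn_const.sub (continuousOn_const.div (by fun_prop) fun z hz => (key z hz).1)
  · intro z hz
    obtain ⟨h0, h1⟩ := key z hz
    have h2 := Complex.slitPlane_ne_zero h1
    rw [Complex.exp_neg, Complex.exp_log h2]
    rw [inv_mul_eq_div, div_eq_iff h2]
    field_simp
    ring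

lemma PwHasLog.union {A B : Set ℂ} (hA : IsClosed A) (hB : IsClosed B)
    (hAB : IsPreconnected (A ∩ B)) {a b : ℂ} (hbA : b ∉ A)
    (h : PwHasLog A a b) (h' : PwHasLog B a b) (haA : a ∉ A) : PwHasLog (A ∪ B) a b := by
  classical
  obtain ⟨L, hL, h⟩ := h
  obtain ⟨L', hL', h'⟩ := h'
  obtain ⟨c, hc, hcc⟩ := pw_const_of_exp (g := fun z => L z - L' z) hAB
    ((hL.mono inter_subset_left).sub (hL'.mono inter_subset_right)) (by
      rintro z ⟨hz, hz'⟩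
      have hzb : z - b ≠ 0 := fun e => hbA (by rwa [← sub_eq_zero.1 e])
      have : Complex.exp (L z) = Complex.exp (L' z) :=
        mul_right_cancel₀ hzb ((h z hz).trans (h' z hz').symm)
      simp [Complex.exp_sub, this])
  let F : ℂ → ℂ := fun z => if z ∈ A then L z else L' z + c
  have e1 : EqOn F L A := fun z hz => by simp [F, hz]
  have e2 : EqOn F (fun z => L' z + c) B := fun z hz => by
    by_cases hzA : z ∈ A
    · have := hcc z ⟨hzA, hz⟩
      simp only [F, hzA, if_true]
      rw [← this]; ring
    · simp [F, hzA]
  refine ⟨F, ?_, ?_⟩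
  · exact (hL.congr e1).union_of_isClosed ((hL'.add continuousOn_const).congr e2) hA hB
  · rintro z (hz | hz)
    · rw [e1 hz, h z hz]
    · rw [e2 hz, Complex.exp_add, hc, mul_one, h' z hz]

lemma pw_no_log {X Ω : Set ℂ} (hX : IsClosed X) (hΩb : Bornology.IsBounded Ω)
    (hfr : frontier Ω ⊆ X) {a b : ℂ} (ha : a ∈ Ω) (haX : a ∉ X) (hb : b ∉ Ω)
    (h : PwHasLog X a b) : False := by
  classical
  obtain ⟨L, hL, h⟩ := h
  obtain ⟨g, hg⟩ := ContinuousMap.exists_restrict_eq hX ⟨X.domRestrict L, hL.domRestrict⟩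
  have hgL : ∀ z ∈ X, g z = L z := fun z hz => by
    have := congrArg (fun k => k ⟨z, hz⟩) hg
    exact this
  let F : ℂ → ℂ := fun z => if z ∈ Ω then Complex.exp (g z) * (z - b) else z - a
  have hF : Continuous F := by
    refine Continuous.if ?_ (by fun_prop) (by fun_prop)
    intro z hz
    have hz := hfr hz
    rw [hgL z hz, h z hz]
  have hF0 : ∀ z, F z ≠ 0 := by
    intro z
    by_cases hz : z ∈ Ω
    · simp only [F, hz, if_true]
      refine mul_ne_zero (Complex.exp_ne_zero _) (sub_ne_zero.2 ?_)
      rintro rfl; exact hb hz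
    · simp only [F, hz, if_false]
      refine sub_ne_zero.2 ?_
      rintro rfl; exact hz ha
  obtain ⟨E, hE, hEF⟩ := Complex.exists_continuousOn_eqOn_exp_comp (X := ℂ) (U := univ)
    (by
      have : ContractibleSpace (univ : Set ℂ) := convex_univ.contractibleSpace ⟨0, mem_univ _⟩
      exact (inferInstance : SimplyConnectedSpace (univ : Set ℂ))) isOpen_univ (g := F) hF.continuousOn (by
      rintro ⟨z, -, hz⟩; exact hF0 z hz)
  rw [continuousOn_univ] at hE
  obtain ⟨R, hR⟩ := hΩb.subset_ball a
  have hR0 : 0 < R := by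
    have := hR ha
    simpa using this
  have hout : ∀ θ : ℝ, Complex.exp (E (a + R * Complex.exp (θ * Complex.I))) =
      R * Complex.exp (θ * Complex.I) := by
    intro θ
    have h1 : a + R * Complex.exp (θ * Complex.I) ∉ Ω := by
      intro hh
      have := hR hh
      simp [dist_eq_norm, Complex.norm_exp_ofReal_mul_I, abs_of_pos hR0] at this
    have := hEF (mem_univ (a + R * Complex.exp (θ * Complex.I)))
    simp only [Function.comp_apply, F, h1, if_false] at this
    rw [this]; ring
  obtain ⟨c, -, hc⟩ := pw_const_of_exp (S := Complex.re ⁻¹' univ)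
    (g := fun w => E (a + R * Complex.exp ((w.re : ℂ) * Complex.I)) - (w.re : ℂ) * Complex.I
      - Real.log R) (by simpa using isPreconnected_univ) (by fun_prop) (by
        intro z _
        rw [Complex.exp_sub, Complex.exp_sub, hout, ← Complex.ofReal_exp, Real.exp_log hR0]
        have : (R : ℂ) ≠ 0 := by exact_mod_cast hR0.ne'
        field_simp [Complex.exp_ne_zero])
  have h1 := hc 0 (by simp)
  have h2 := hc ((2 * Real.pi : ℝ) : ℂ) (by simp)
  rw [← h2] at h1
  simp [Complex.exp_two_pi_mul_I] at h1
  have h3 : (2 * (Real.pi : ℂ) * Complex.I) = 0 := by linear_combination h1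
  simp [Real.pi_ne_zero] at h3

lemma pw_hard {X : Set ℂ} (hX : IsCompact X) {a b : ℂ} (ha : a ∉ X) (hb : b ∉ X)
    (h : PwHasLog X a b) : JoinedIn Xᶜ a b := by
  have hop : IsOpen Xᶜ := hX.isClosed.isOpen_compl
  have fr : ∀ c, frontier (connectedComponentIn Xᶜ c) ⊆ X := by
    intro c z hz
    by_contra hzX
    have hO := hop.connectedComponentIn (x := z)
    rw [(hop.connectedComponentIn (x := c)).frontier_eq] at hz
    obtain ⟨w, hw1, hw2⟩ := mem_closure_iff.1 hz.1 _ hO (mem_connectedComponentIn hzX)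
    have e1 := connectedComponentIn_eq hw1
    have e2 := connectedComponentIn_eq hw2
    exact hz.2 (by rw [e2, ← e1]; exact mem_connectedComponentIn hzX)
  have key : b ∈ connectedComponentIn Xᶜ a := by
    by_contra hab
    have hba : a ∉ connectedComponentIn Xᶜ b := fun h' => hab (by
      rw [← connectedComponentIn_eq h']; exact mem_connectedComponentIn hb)
    by_cases hbd : Bornology.IsBounded (connectedComponentIn Xᶜ a)
    · exact pw_no_log hX.isClosed hbd (fr a) (mem_connectedComponentIn ha) ha hab h
    by_cases hbd' : Bornology.IsBounded (connectedComponentIn Xᶜ b)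
    · exact pw_no_log hX.isClosed hbd' (fr b) (mem_connectedComponentIn hb) hb hba h.symm
    obtain ⟨R, hR0, hR⟩ := hX.isBounded.subset_closedBall_lt 0 0
    have hS := pw_preconn_outside (c := 0) hR0
    have hSX : {z : ℂ | R < dist z 0} ⊆ Xᶜ := fun z hz hzX => by
      have := hR hzX
      simp only [mem_closedBall, mem_ofPred_eq] at this hz; linarith
    have far : ∀ c, ¬ Bornology.IsBounded (connectedComponentIn Xᶜ c) →
        ∃ z, z ∈ connectedComponentIn Xᶜ c ∧ R < dist z 0 := by
      intro c hc
      by_contra hh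
      push Not at hh
      exact hc ((Metric.isBounded_closedBall (x := (0 : ℂ)) (r := R)).subset fun z hz => hh z hz)
    obtain ⟨z, hz, hzR⟩ := far a hbd
    obtain ⟨z', hz', hzR'⟩ := far b hbd'
    have := hS.subset_connectedComponentIn hzR hSX hzR'
    rw [← connectedComponentIn_eq hz] at this
    rw [connectedComponentIn_eq this, ← connectedComponentIn_eq hz'] at hab
    exact hab (mem_connectedComponentIn hb)
  have hpc : IsPathConnected (connectedComponentIn Xᶜ a) :=
    (hop.connectedComponentIn).isConnected_iff_isPathConnected.1
      (isConnected_connectedComponentIn_iff.2 ha)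
  exact (hpc.joinedIn a (mem_connectedComponentIn ha) b key).mono (connectedComponentIn_subset _ _)

theorem pw_janiszewski {A B S T : Set ℂ} (hA : IsCompact A) (hB : IsCompact B)
    (hAB : IsPreconnected (A ∩ B)) (hS : IsPreconnected S) (hT : IsPreconnected T)
    (hSA : Disjoint S A) (hTB : Disjoint T B) {a b : ℂ} (haS : a ∈ S) (hbS : b ∈ S)
    (haT : a ∈ T) (hbT : b ∈ T) : JoinedIn (A ∪ B)ᶜ a b := by
  have h1 := pw_hasLog_of_preconn hA.isClosed hS hSA haS hbS
  have h2 := pw_hasLog_of_preconn hB.isClosed hT hTB haT hbT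
  have a1 : a ∉ A := fun h => hSA.le_bot ⟨haS, h⟩
  have a2 : a ∉ B := fun h => hTB.le_bot ⟨haT, h⟩
  have b1 : b ∉ A := fun h => hSA.le_bot ⟨hbS, h⟩
  have b2 : b ∉ B := fun h => hTB.le_bot ⟨hbT, h⟩
  exact pw_hard (hA.union hB) (by simp [a1, a2]) (by simp [b1, b2])
    (h1.union hA.isClosed hB.isClosed hAB b1 h2 a1)

end

section
open Filter Topology Metric Set

def pwRec (a b c d : ℝ) : Set ℂ := {s | (a ≤ s.re ∧ s.re ≤ b) ∧ (c ≤ s.im ∧ s.im ≤ d)}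

lemma pwRec_eq (a b c d : ℝ) : pwRec a b c d = Icc a b ×ℂ Icc c d := by
  ext s; simp [pwRec, Complex.mem_reProdIm]

lemma pwRec_compact (a b c d : ℝ) : IsCompact (pwRec a b c d) := by
  rw [pwRec_eq]; exact isCompact_Icc.reProdIm isCompact_Icc

lemma pwRec_preconn (a b c d : ℝ) : IsPreconnected (pwRec a b c d) := by
  have : Convex ℝ (pwRec a b c d) :=
    ((convex_halfSpace_re_ge a).inter (convex_halfSpace_re_le b)).inter
      ((convex_halfSpace_im_ge c).inter (convex_halfSpace_im_le d))
  exact this.isPreconnected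

lemma pw_cross {a1 b1 a2 b2 a3 b3 κ η : ℝ} {τ1 τ3 C : Set ℂ} {v v' : ℂ}
    (h12 : b1 ≤ a2) (h23 : b2 ≤ a3) (hκ0 : 0 < κ) (_ : κ < η)
    (c1 : IsCompact τ1) (c3 : IsCompact τ3) (p1 : IsPreconnected τ1) (p3 : IsPreconnected τ3)
    (r1 : ∀ s ∈ τ1, a1 < s.re ∧ s.re < b1 ∧ 0 < s.im)
    (r3 : ∀ s ∈ τ3, a3 < s.re ∧ s.re < b3 ∧ 0 < s.im)
    (e1 : ∃ s ∈ τ1, s.im = η) (e1' : ∃ s ∈ τ1, s.im = κ)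
    (e3 : ∃ s ∈ τ3, s.im = η) (e3' : ∃ s ∈ τ3, s.im = κ)
    (hv : a2 < v.re ∧ v.re < b2 ∧ κ < v.im ∧ v.im < η)
    (hv' : b3 < v'.re) (hv0 : 0 < v'.im)
    (hC : IsPreconnected C) (hvC : v ∈ C) (hvC' : v' ∈ C)
    (d1 : Disjoint C τ1) (d3 : Disjoint C τ3) (dH : Disjoint C (pwRec a1 b3 η η))
    (dL : Disjoint C (pwRec a1 b3 κ κ)) : False := by
  obtain ⟨s1, hs1, hs1i⟩ := e1
  obtain ⟨s1', hs1', hs1i'⟩ := e1'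
  obtain ⟨s3, hs3, hs3i⟩ := e3
  obtain ⟨s3', hs3', hs3i'⟩ := e3'
  have q1 := r1 _ hs1
  have q1' := r1 _ hs1'
  have q3 := r3 _ hs3
  have q3' := r3 _ hs3'
  obtain ⟨hv1, hv2, hv3, hv4⟩ := hv
  let H := pwRec a1 b3 η η
  let B0 := H ∪ τ1 ∪ τ3 ∪ pwRec a1 a2 κ κ ∪ pwRec b2 b3 κ κ
  let Y := H ∪ τ1 ∪ τ3 ∪ pwRec a1 b3 κ κ
  let Y1 := B0 ∪ pwRec a1 a1 κ η ∪ pwRec b3 b3 κ η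
  have hB0 : IsPreconnected B0 := by
    have hH : IsPreconnected H := pwRec_preconn _ _ _ _
    have g1 : IsPreconnected (H ∪ τ1) := hH.union s1
      ⟨⟨by linarith, by linarith⟩, by linarith, by linarith⟩ hs1 p1
    have g2 : IsPreconnected (H ∪ τ1 ∪ τ3) := g1.union s3
      (Or.inl ⟨⟨by linarith, by linarith⟩, by linarith, by linarith⟩) hs3 p3
    have g3 : IsPreconnected (H ∪ τ1 ∪ τ3 ∪ pwRec a1 a2 κ κ) := g2.union s1'
      (Or.inl (Or.inr hs1')) ⟨⟨by linarith, by linarith⟩, by linarith, by linarith⟩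
      (pwRec_preconn _ _ _ _)
    exact g3.union s3' (Or.inl (Or.inr hs3'))
      ⟨⟨by linarith, by linarith⟩, by linarith, by linarith⟩ (pwRec_preconn _ _ _ _)
  have hYY : Y ∩ Y1 = B0 := by
    ext s
    constructor
    · rintro ⟨hY, (hY1 | hY1) | hY1⟩
      · exact hY1
      · rcases hY with ((h | h) | h) | h
        · exact Or.inl (Or.inl (Or.inl (Or.inl h)))
        · have := r1 s h; have := hY1.1; exfalso; linarith
        · have := r3 s h; have := hY1.1; exfalso; linarith
        · refine Or.inl (Or.inr ⟨⟨?_, ?_⟩, h.2⟩)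
          · linarith [h.1]
          · linarith [hY1.1]
      · rcases hY with ((h | h) | h) | h
        · exact Or.inl (Or.inl (Or.inl (Or.inl h)))
        · have := r1 s h; have := hY1.1; exfalso; linarith
        · have := r3 s h; have := hY1.1; exfalso; linarith
        · refine (Or.inr ⟨⟨?_, ?_⟩, h.2⟩)
          · linarith [hY1.1]
          · linarith [h.1]
    · intro h
      refine ⟨?_, Or.inl (Or.inl h)⟩
      rcases h with (((h | h) | h) | h) | h
      · exact Or.inl (Or.inl (Or.inl h))
      · exact Or.inl (Or.inl (Or.inr h))
      · exact Or.inl (Or.inr h)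
      · exact Or.inr ⟨⟨h.1.1, by linarith [h.1]⟩, h.2⟩
      · exact Or.inr ⟨⟨by linarith [h.1], h.1.2⟩, h.2⟩
  have cB0 : IsCompact B0 := ((((pwRec_compact _ _ _ _).union c1).union c3).union
    (pwRec_compact _ _ _ _)).union (pwRec_compact _ _ _ _)
  have cY : IsCompact Y := (((pwRec_compact _ _ _ _).union c1).union c3).union
    (pwRec_compact _ _ _ _)
  have cY1 : IsCompact Y1 := (cB0.union (pwRec_compact _ _ _ _)).union (pwRec_compact _ _ _ _)
  let T := pwRec v.re v.re (-1) v.im ∪ pwRec v.re v'.re (-1) (-1) ∪ pwRec v'.re v'.re (-1) v'.im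
  have hT : IsPreconnected T := by
    have g1 : IsPreconnected (pwRec v.re v.re (-1) v.im ∪ pwRec v.re v'.re (-1) (-1)) :=
      (pwRec_preconn v.re v.re (-1) v.im).union (⟨v.re, -1⟩ : ℂ)
      ⟨⟨le_rfl, le_rfl⟩, le_rfl, by simp; linarith⟩
      (⟨⟨le_rfl, by simp; linarith⟩, le_rfl, le_rfl⟩) (pwRec_preconn v.re v'.re (-1) (-1))
    exact g1.union (⟨v'.re, -1⟩ : ℂ)
      (Or.inr ⟨⟨by simp; linarith, le_rfl⟩, le_rfl, le_rfl⟩)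
      ⟨⟨le_rfl, le_rfl⟩, le_rfl, by simp; linarith⟩ (pwRec_preconn v'.re v'.re (-1) v'.im)
  have hCY : Disjoint C Y := by
    simp only [Y, disjoint_union_right]
    exact ⟨⟨⟨dH, d1⟩, d3⟩, dL⟩
  have hTY1 : Disjoint T Y1 := by
    rw [Set.disjoint_left]
    have low : ∀ s ∈ Y1, 0 < s.im := by
      rintro s ((((((h | h) | h) | h) | h) | h) | h)
      · linarith [h.2]
      · linarith [r1 s h]
      · linarith [r3 s h]
      · linarith [h.2]
      · linarith [h.2]
      · linarith [h.2]
      · linarith [h.2]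
    have rt : ∀ s ∈ Y1, s.re ≤ b3 := by
      rintro s ((((((h | h) | h) | h) | h) | h) | h)
      · linarith [h.1]
      · linarith [r1 s h]
      · linarith [r3 s h]
      · linarith [h.1]
      · linarith [h.1]
      · linarith [h.1]
      · linarith [h.1]
    rintro s ((h | h) | h) hs
    · obtain ⟨⟨h1, h2⟩, h3, h4⟩ := h
      rcases hs with (((((h | h) | h) | h) | h) | h) | h
      · linarith [h.2]
      · linarith [r1 s h]
      · linarith [r3 s h]
      · linarith [h.1]
      · linarith [h.1]
      · linarith [h.1]
      · linarith [h.1]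
    · linarith [low s hs, h.2]
    · linarith [rt s hs, h.1]
  have hJ := pw_janiszewski cY cY1 (by rw [hYY]; exact hB0) hC hT hCY hTY1 hvC hvC'
    (Or.inl (Or.inl ⟨⟨le_rfl, le_rfl⟩, by linarith, le_rfl⟩))
    (Or.inr ⟨⟨le_rfl, le_rfl⟩, by linarith, le_rfl⟩)
  obtain ⟨γ, hγ⟩ := hJ
  have hpre : IsPreconnected (range γ) := isPreconnected_range γ.continuous
  have hu : IsOpen {s : ℂ | a1 < s.re ∧ s.re < b3 ∧ κ < s.im ∧ s.im < η} :=
    (isOpen_lt continuous_const Complex.continuous_re).inter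
    ((isOpen_lt Complex.continuous_re continuous_const).inter
    ((isOpen_lt continuous_const Complex.continuous_im).inter
    (isOpen_lt Complex.continuous_im continuous_const)))
  obtain ⟨s, -, hs1, hs2⟩ := hpre _ _ hu (pwRec_compact a1 b3 κ η).isClosed.isOpen_compl (by
    rintro _ ⟨t, rfl⟩
    by_contra hn
    simp only [mem_union, mem_compl_iff, not_or, not_not] at hn
    obtain ⟨hn1, ⟨h1, h2⟩, h3, h4⟩ := hn
    apply hγ t
    by_cases g1 : (γ t).re = a1
    · exact Or.inr (Or.inl (Or.inr ⟨⟨g1.ge, g1.le⟩, h3, h4⟩))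
    by_cases g2 : (γ t).re = b3
    · exact Or.inr (Or.inr ⟨⟨g2.ge, g2.le⟩, h3, h4⟩)
    by_cases g3 : (γ t).im = κ
    · exact Or.inl (Or.inr ⟨⟨h1, h2⟩, g3.ge, g3.le⟩)
    by_cases g4 : (γ t).im = η
    · exact Or.inl (Or.inl (Or.inl (Or.inl ⟨⟨h1, h2⟩, g4.ge, g4.le⟩)))
    exact absurd ⟨lt_of_le_of_ne h1 (Ne.symm g1), lt_of_le_of_ne h2 g2,
      lt_of_le_of_ne h3 (Ne.symm g3), lt_of_le_of_ne h4 g4⟩ hn1)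
    ⟨v, ⟨0, by simp⟩, by linarith, by linarith, hv3, hv4⟩
    ⟨v', ⟨1, by simp⟩, fun h => by linarith [h.1]⟩
  exact hs2 ⟨⟨hs1.1.le, hs1.2.1.le⟩, hs1.2.2.1.le, hs1.2.2.2.le⟩

end

section
open Filter Topology Metric Set

structure PwStrip (K : Set ℂ) (f Ψ : ℂ → ℂ) (M : ℝ) : Prop where
  cK : IsCompact K
  fcont : ContinuousOn f {s | M < s.re ∧ 0 < s.im ∧ s.im < Real.pi}
  Ψcont : ContinuousOn Ψ Kᶜ
  Ψmem : ∀ z ∉ K, 0 < (Ψ z).im ∧ (Ψ z).im < Real.pi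
  fK : ∀ s : ℂ, M < s.re → 0 < s.im → s.im < Real.pi → f s ∉ K
  Ψf : ∀ s : ℂ, M < s.re → 0 < s.im → s.im < Real.pi → Ψ (f s) = s
  fΨ : ∀ z ∉ K, M < (Ψ z).re → f (Ψ z) = z

structure PwSpike (K N : Set ℂ) (Ψ : ℂ → ℂ) (a b : ℝ) (σ : ℝ → ℂ) : Prop where
  cont : ContinuousOn σ (Icc 0 1)
  end_mem : σ 1 ∈ N
  nK : ∀ t, 0 ≤ t → t < 1 → σ t ∉ K
  re : ∀ t, 0 ≤ t → t < 1 → a < (Ψ (σ t)).re ∧ (Ψ (σ t)).re < b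

def PwBottom (Ψ : ℂ → ℂ) (σ : ℝ → ℂ) : Prop :=
  ∀ η > 0, ∃ t0, 0 ≤ t0 ∧ t0 < 1 ∧ ∀ t, t0 ≤ t → t < 1 → (Ψ (σ t)).im < η

/-- trimmed spike -/
lemma PwSpike.trim {K N : Set ℂ} {Ψ : ℂ → ℂ} {a b : ℝ} {σ : ℝ → ℂ} (h : PwSpike K N Ψ a b σ)
    (hΨ : ContinuousOn Ψ Kᶜ) (hmem : ∀ z ∉ K, 0 < (Ψ z).im ∧ (Ψ z).im < Real.pi)
    (hb : PwBottom Ψ σ) {κ η : ℝ} (hκ : 0 < κ) (hκη : κ < η)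
    (hη : η < (Ψ (σ 0)).im) : ∃ τ : Set ℂ, IsCompact τ ∧ IsPreconnected τ ∧
      (∀ s ∈ τ, a < s.re ∧ s.re < b ∧ 0 < s.im) ∧ (∃ s ∈ τ, s.im = η) ∧ (∃ s ∈ τ, s.im = κ) ∧
      ∀ s ∈ τ, ∃ t, 0 ≤ t ∧ t < 1 ∧ Ψ (σ t) = s := by
  obtain ⟨t0, h0, h1, ht0⟩ := hb κ hκ
  have hc : ContinuousOn (fun t => Ψ (σ t)) (Icc 0 t0) :=
    hΨ.comp (h.cont.mono (Icc_subset_Icc_right h1.le)) fun t ht => h.nK t ht.1 (ht.2.trans_lt h1)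
  have hci : ContinuousOn (fun t => (Ψ (σ t)).im) (Icc 0 t0) :=
    Complex.continuous_im.comp_continuousOn hc
  have iv := intermediate_value_Icc' h0 hci
  have hlow := ht0 t0 le_rfl h1
  refine ⟨(fun t => Ψ (σ t)) '' Icc 0 t0, isCompact_Icc.image_of_continuousOn hc,
    isPreconnected_Icc.image _ hc, ?_, ?_, ?_, ?_⟩
  · rintro _ ⟨t, ht, rfl⟩
    have := h.re t ht.1 (ht.2.trans_lt h1)
    exact ⟨this.1, this.2, (hmem _ (h.nK t ht.1 (ht.2.trans_lt h1))).1⟩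
  · obtain ⟨t, ht, e⟩ := iv ⟨by linarith, hη.le⟩
    exact ⟨_, ⟨t, ht, rfl⟩, e⟩
  · obtain ⟨t, ht, e⟩ := iv (show κ ∈ _ from ⟨by linarith, by linarith⟩)
    exact ⟨_, ⟨t, ht, rfl⟩, e⟩
  · rintro _ ⟨t, ht, rfl⟩
    exact ⟨t, ht.1, ht.2.trans_lt h1, rfl⟩

lemma pw_four {K N1 N2 : Set ℂ} {f Ψ : ℂ → ℂ} {M : ℝ} (S : PwStrip K f Ψ M)
    (hN1K : N1 ⊆ K) (hN2K : N2 ⊆ K) (hN1c : IsClosed N1)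
    (hN1 : IsPreconnected N1) (hN2 : IsPreconnected N2) (hN12 : Disjoint N1 N2)
    {a1 b1 a2 b2 a3 b3 a4 b4 : ℝ} {σ1 σ2 σ3 σ4 : ℝ → ℂ}
    (hM : M < a1) (h12 : b1 ≤ a2) (h23 : b2 ≤ a3) (h34 : b3 ≤ a4)
    (s1 : PwSpike K N1 Ψ a1 b1 σ1) (s2 : PwSpike K N2 Ψ a2 b2 σ2)
    (s3 : PwSpike K N1 Ψ a3 b3 σ3) (s4 : PwSpike K N2 Ψ a4 b4 σ4)
    (B1 : PwBottom Ψ σ1) (B2 : PwBottom Ψ σ2) (B3 : PwBottom Ψ σ3) : False := by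
  have z1 := s1.nK 0 le_rfl one_pos
  have z3 := s3.nK 0 le_rfl one_pos
  have z4 := s4.nK 0 le_rfl one_pos
  have i1 := S.Ψmem _ z1
  have i3 := S.Ψmem _ z3
  have i4 := S.Ψmem _ z4
  have q1 := s1.re 0 le_rfl one_pos
  have q2 := s2.re 0 le_rfl one_pos
  have q3 := s3.re 0 le_rfl one_pos
  have q4 := s4.re 0 le_rfl one_pos
  obtain ⟨η, hη0, hη⟩ : ∃ η, 0 < η ∧ η < min (Ψ (σ1 0)).im (Ψ (σ3 0)).im :=
    exists_between (lt_min i1.1 i3.1)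
  have hη1 := hη.trans_le (min_le_left _ _)
  have hη3 := hη.trans_le (min_le_right _ _)
  have hηπ : η < Real.pi := hη1.trans i1.2
  obtain ⟨t2, ht20, ht21, ht2⟩ := B2 η hη0
  let H := pwRec a1 b3 η η
  have hHP : ∀ s ∈ H, M < s.re ∧ 0 < s.im ∧ s.im < Real.pi := fun s hs =>
    ⟨by linarith [hs.1], by linarith [hs.2], by linarith [hs.2]⟩
  have ΨfH : ∀ s ∈ H, Ψ (f s) = s := fun s hs =>
    S.Ψf s (hHP s hs).1 (hHP s hs).2.1 (hHP s hs).2.2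
  have fHK : ∀ s ∈ H, f s ∉ K := fun s hs =>
    S.fK s (hHP s hs).1 (hHP s hs).2.1 (hHP s hs).2.2
  let X := f '' H ∪ σ1 '' Icc 0 1 ∪ σ3 '' Icc 0 1 ∪ N1
  have cX : IsCompact X := by
    refine ((((pwRec_compact _ _ _ _).image_of_continuousOn (S.fcont.mono hHP)).union
      (isCompact_Icc.image_of_continuousOn s1.cont)).union
      (isCompact_Icc.image_of_continuousOn s3.cont)).union (S.cK.of_isClosed_subset hN1c hN1K)
  -- classification of points of X
  have Xcl : ∀ z ∈ X, z ∈ N1 ∨ (z ∉ K ∧ ((Ψ z ∈ H) ∨ (a1 < (Ψ z).re ∧ (Ψ z).re < b1) ∨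
      (a3 < (Ψ z).re ∧ (Ψ z).re < b3))) := by
    rintro z (((⟨s, hs, rfl⟩ | ⟨t, ht, rfl⟩) | ⟨t, ht, rfl⟩) | h)
    · exact Or.inr ⟨fHK s hs, Or.inl (by rw [ΨfH s hs]; exact hs)⟩
    · rcases ht.2.eq_or_lt with rfl | h
      · exact Or.inl s1.end_mem
      · exact Or.inr ⟨s1.nK t ht.1 h, Or.inr (Or.inl (s1.re t ht.1 h))⟩
    · rcases ht.2.eq_or_lt with rfl | h
      · exact Or.inl s3.end_mem
      · exact Or.inr ⟨s3.nK t ht.1 h, Or.inr (Or.inr (s3.re t ht.1 h))⟩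
    · exact Or.inl h
  have hXK : X ∩ K = N1 := by
    ext z
    constructor
    · rintro ⟨h, hK⟩
      rcases Xcl z h with h | h
      · exact h
      · exact absurd hK h.1
    · exact fun h => ⟨Or.inr h, hN1K h⟩
  let T := N2 ∪ σ2 '' Icc t2 1 ∪ σ4 '' Icc 0 1
  have hT : IsPreconnected T := by
    have g1 : IsPreconnected (N2 ∪ σ2 '' Icc t2 1) := hN2.union (σ2 1) s2.end_mem
      ⟨1, ⟨ht21.le, le_rfl⟩, rfl⟩ (isPreconnected_Icc.image _
        (s2.cont.mono (Icc_subset_Icc_left ht20)))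
    exact g1.union (σ4 1) (Or.inl s4.end_mem) ⟨1, ⟨zero_le_one, le_rfl⟩, rfl⟩
      (isPreconnected_Icc.image _ s4.cont)
  have hTX : Disjoint T X := by
    rw [Set.disjoint_left]
    have n2 : ∀ z ∈ N2, z ∉ X := by
      intro z hz hX
      rcases Xcl z hX with h | h
      · exact hN12.le_bot ⟨h, hz⟩
      · exact h.1 (hN2K hz)
    rintro z ((h | ⟨t, ht, rfl⟩) | ⟨t, ht, rfl⟩) hX
    · exact n2 z h hX
    · rcases ht.2.eq_or_lt with rfl | h
      · exact n2 _ s2.end_mem hX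
      · have ht0 := ht20.trans ht.1
        have hnK := s2.nK t ht0 h
        have hre := s2.re t ht0 h
        have him := ht2 t ht.1 h
        rcases Xcl _ hX with h | ⟨-, h | h | h⟩
        · exact hnK (hN1K h)
        · linarith [h.2]
        · linarith
        · linarith
    · rcases ht.2.eq_or_lt with rfl | h
      · exact n2 _ s4.end_mem hX
      · have hnK := s4.nK t ht.1 h
        have hre := s4.re t ht.1 h
        rcases Xcl _ hX with h | ⟨-, h | h | h⟩
        · exact hnK (hN1K h)
        · linarith [h.1]
        · linarith
        · linarith
  -- connecting set off K
  let P := {s : ℂ | M < s.re ∧ 0 < s.im ∧ s.im < Real.pi}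
  have hP : IsPreconnected P := by
    have : Convex ℝ P := (convex_halfSpace_re_gt M).inter
      ((convex_halfSpace_im_gt 0).inter (convex_halfSpace_im_lt Real.pi))
    exact this.isPreconnected
  have hfP : IsPreconnected (f '' P) := hP.image _ S.fcont
  have hfPK : Disjoint (f '' P) K := by
    rw [Set.disjoint_left]
    rintro _ ⟨s, hs, rfl⟩
    exact S.fK s hs.1 hs.2.1 hs.2.2
  have inP : ∀ z ∉ K, M < (Ψ z).re → z ∈ f '' P := fun z hz h =>
    ⟨Ψ z, ⟨h, S.Ψmem z hz⟩, S.fΨ z hz h⟩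
  have z2 := s2.nK t2 ht20 ht21
  have q2' := s2.re t2 ht20 ht21
  have i2 := S.Ψmem _ z2
  obtain ⟨γ, hγ⟩ := pw_janiszewski (a := σ2 t2) (b := σ4 0) cX S.cK (by rw [hXK]; exact hN1)
    hT hfP hTX hfPK
    (Or.inl (Or.inr ⟨t2, ⟨le_rfl, ht21.le⟩, rfl⟩)) (Or.inr ⟨0, ⟨le_rfl, zero_le_one⟩, rfl⟩)
    (inP _ z2 (by linarith)) (inP _ z4 (by linarith))
  have hγK : ∀ t, γ t ∉ K := fun t h => hγ t (Or.inr h)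
  have hγX : ∀ t, γ t ∉ X := fun t h => hγ t (Or.inl h)
  have hΨγ : Continuous (fun t => Ψ (γ t)) := S.Ψcont.comp_continuous γ.continuous hγK
  obtain ⟨tm, -, htm⟩ := isCompact_univ.exists_isMinOn (f := fun t => (Ψ (γ t)).im)
    ⟨0, mem_univ _⟩ (Complex.continuous_im.comp hΨγ).continuousOn
  have hmin : ∀ t, (Ψ (γ tm)).im ≤ (Ψ (γ t)).im := fun t => htm (mem_univ t)
  obtain ⟨κ, hκ0, hκ⟩ : ∃ κ, 0 < κ ∧ κ < (Ψ (γ tm)).im :=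
    exists_between (S.Ψmem _ (hγK tm)).1
  have hκ2 : κ < (Ψ (σ2 t2)).im := by have := hmin 0; simp at this; linarith
  have hη2 := ht2 t2 le_rfl ht21
  have hκη : κ < η := hκ2.trans hη2
  obtain ⟨τ1, k1, k2, k3, k4, k5, k6⟩ := s1.trim S.Ψcont S.Ψmem B1 hκ0 hκη hη1
  obtain ⟨τ3, l1, l2, l3, l4, l5, l6⟩ := s3.trim S.Ψcont S.Ψmem B3 hκ0 hκη hη3
  have inj : ∀ t, ∀ z, z ∉ K → M < (Ψ z).re → Ψ z = Ψ (γ t) → z ∈ X → False := by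
    intro t z hz hM' he hX
    have e1 := S.fΨ z hz hM'
    rw [he] at hM' e1
    rw [S.fΨ _ (hγK t) hM'] at e1
    exact hγX t (e1 ▸ hX)
  refine pw_cross (C := range fun t => Ψ (γ t)) (v := Ψ (σ2 t2)) (v' := Ψ (σ4 0)) h12 h23 hκ0 hκη
    k1 l1 k2 l2 k3 l3 k4 k5 l4 l5 ⟨q2'.1, q2'.2, hκ2, hη2⟩ (by linarith) i4.1
    (isPreconnected_range hΨγ) ⟨0, by simp⟩ ⟨1, by simp⟩ ?_ ?_ ?_ ?_
  · rw [Set.disjoint_left]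
    rintro _ ⟨t, rfl⟩ hs
    obtain ⟨u, hu0, hu1, he⟩ := k6 _ hs
    exact inj t (σ1 u) (s1.nK u hu0 hu1) (by linarith [s1.re u hu0 hu1]) he
      (Or.inl (Or.inl (Or.inr ⟨u, ⟨hu0, hu1.le⟩, rfl⟩)))
  · rw [Set.disjoint_left]
    rintro _ ⟨t, rfl⟩ hs
    obtain ⟨u, hu0, hu1, he⟩ := l6 _ hs
    exact inj t (σ3 u) (s3.nK u hu0 hu1) (by linarith [s3.re u hu0 hu1]) he
      (Or.inl (Or.inr ⟨u, ⟨hu0, hu1.le⟩, rfl⟩))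
  · rw [Set.disjoint_left]
    rintro _ ⟨t, rfl⟩ hs
    exact inj t (f (Ψ (γ t))) (fHK _ hs) (by rw [ΨfH _ hs]; exact (hHP _ hs).1) (ΨfH _ hs)
      (Or.inl (Or.inl (Or.inl ⟨_, hs, rfl⟩)))
  · rw [Set.disjoint_left]
    rintro _ ⟨t, rfl⟩ hs
    linarith [hs.2, hmin t]

end

section
open Filter Topology Metric Set

def PwLC (K : Set ℂ) (z : ℂ) : Prop :=
  ∀ ε > 0, ∃ N ⊆ K, IsClosed N ∧ IsPreconnected N ∧ N ⊆ closedBall z ε ∧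
    ∃ δ > 0, K ∩ ball z δ ⊆ N

def PwPrin (f : ℂ → ℂ) (p : ℂ) : Prop :=
  ∀ ε > 0, ∀ x0 : ℝ, ∃ x > x0, ∀ s : ℂ, s.re = x → 0 < s.im → s.im < Real.pi → dist (f s) p ≤ ε

def PwCl (f : ℂ → ℂ) (z : ℂ) : Prop :=
  ∀ ε > 0, ∀ x0 : ℝ, ∃ s : ℂ, x0 < s.re ∧ 0 < s.im ∧ s.im < Real.pi ∧ dist (f s) z < ε

noncomputable def pwRefl (s : ℂ) : ℂ := ⟨s.re, Real.pi - s.im⟩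

lemma pwRefl_cont : Continuous pwRefl := by
  have : pwRefl = fun s => (s.re : ℂ) + ((Real.pi - s.im : ℝ) : ℂ) * Complex.I := by
    ext s; apply Complex.ext <;> simp [pwRefl]
  rw [this]; fun_prop

lemma pwRefl_refl (s : ℂ) : pwRefl (pwRefl s) = s := by
  apply Complex.ext <;> simp [pwRefl]

lemma PwStrip.refl {K : Set ℂ} {f Ψ : ℂ → ℂ} {M : ℝ} (S : PwStrip K f Ψ M) :
    PwStrip K (fun s => f (pwRefl s)) (fun z => pwRefl (Ψ z)) M where
  cK := S.cK
  fcont := S.fcont.comp pwRefl_cont.continuousOn fun s hs =>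
    ⟨hs.1, by simpa [pwRefl] using hs.2.2, by simpa [pwRefl] using hs.2.1⟩
  Ψcont := pwRefl_cont.comp_continuousOn S.Ψcont
  Ψmem z hz := ⟨by simpa [pwRefl] using (S.Ψmem z hz).2, by simpa [pwRefl] using (S.Ψmem z hz).1⟩
  fK s h1 h2 h3 := S.fK (pwRefl s) h1 (by simpa [pwRefl] using h3) (by simpa [pwRefl] using h2)
  Ψf s h1 h2 h3 := by
    show pwRefl (Ψ (f (pwRefl s))) = s
    rw [S.Ψf (pwRefl s) h1 (by simpa [pwRefl] using h3) (by simpa [pwRefl] using h2), pwRefl_refl]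
  fΨ z hz h := by
    show f (pwRefl (pwRefl (Ψ z))) = z
    rw [pwRefl_refl]; exact S.fΨ z hz h

lemma pw_spike {K N : Set ℂ} {f Ψ : ℂ → ℂ} {M : ℝ} (S : PwStrip K f Ψ M) {p z : ℂ}
    (hp : PwPrin f p) (hz : z ∈ K) (hcl : PwCl f z) {δ : ℝ} (hδ : 0 < δ)
    (hδp : δ + δ < dist z p) (hN : K ∩ ball z δ ⊆ N) (x0 : ℝ) :
    ∃ a b σ, x0 < a ∧ a < b ∧ PwSpike K N Ψ a b σ ∧ (PwBottom Ψ σ ∨ PwBottom (fun z => pwRefl (Ψ z)) σ) := by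
  obtain ⟨a, ha, hpa⟩ := hp δ hδ (max x0 M)
  have hax := (le_max_left _ _).trans_lt ha
  have haM := (le_max_right _ _).trans_lt ha
  obtain ⟨s, hsa, hs0, hsπ, hsz⟩ := hcl δ hδ a
  obtain ⟨b, hb, hpb⟩ := hp δ hδ s.re
  have hsM : M < s.re := haM.trans hsa
  have huK := S.fK s hsM hs0 hsπ
  have hΨu := S.Ψf s hsM hs0 hsπ
  generalize f s = u at *
  let ℓ : ℝ → ℂ := fun t => u + t * (z - u)
  have hℓ : Continuous ℓ := by fun_prop
  let E := Icc (0 : ℝ) 1 ∩ ℓ ⁻¹' K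
  have hE : IsCompact E := isCompact_Icc.inter_right (S.cK.isClosed.preimage hℓ)
  have hEne : E.Nonempty := ⟨1, ⟨zero_le_one, le_rfl⟩, by simpa [ℓ] using hz⟩
  obtain ⟨T, hT⟩ := hE.exists_isLeast hEne
  have hT1 : T ≤ 1 := hT.1.1.2
  have hTK : ℓ T ∈ K := hT.1.2
  have hT0 : 0 < T := lt_of_le_of_ne hT.1.1.1 (by
    rintro rfl; apply huK; simpa [ℓ] using hTK)
  let σ : ℝ → ℂ := fun t => ℓ (t * T)
  have hσ : Continuous σ := hℓ.comp (by fun_prop)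
  have hσz : ∀ t, 0 ≤ t → t ≤ 1 → dist (σ t) z < δ := by
    intro t h0 h1
    have : σ t - z = ((1 - t * T : ℝ) : ℂ) * (u - z) := by simp [σ, ℓ]; ring
    rw [dist_eq_norm, this, norm_mul, Complex.norm_real, Real.norm_eq_abs,
      abs_of_nonneg (by nlinarith)]
    rw [dist_eq_norm] at hsz
    nlinarith [norm_nonneg (u - z), mul_nonneg h0 hT0.le]
  have hσK : ∀ t, 0 ≤ t → t < 1 → σ t ∉ K := by
    intro t h0 h1 hK
    have : T ≤ t * T := hT.2 ⟨⟨by positivity, by nlinarith⟩, hK⟩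
    nlinarith
  have hσ1 : σ 1 ∈ K := by simpa [σ] using hTK
  have hσ0 : Ψ (σ 0) = s := by simpa [σ, ℓ] using hΨu
  have hΨσ : ContinuousOn (fun t => Ψ (σ t)) (Ico 0 1) :=
    S.Ψcont.comp hσ.continuousOn fun t ht => hσK t ht.1 ht.2
  have hav : ∀ t, 0 ≤ t → t < 1 → (Ψ (σ t)).re ≠ a ∧ (Ψ (σ t)).re ≠ b := by
    intro t h0 h1
    have hm := S.Ψmem _ (hσK t h0 h1)
    have h3 := hσz t h0 h1.le
    have tri := dist_triangle_left z p (σ t)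
    constructor
    · intro e
      have h4 := hpa _ e hm.1 hm.2
      rw [S.fΨ _ (hσK t h0 h1) (by linarith)] at h4
      linarith
    · intro e
      have h4 := hpb _ e hm.1 hm.2
      rw [S.fΨ _ (hσK t h0 h1) (by linarith)] at h4
      linarith
  have hre : ∀ t, 0 ≤ t → t < 1 → a < (Ψ (σ t)).re ∧ (Ψ (σ t)).re < b := by
    intro t h0 h1
    have hc : ContinuousOn (fun t => (Ψ (σ t)).re) (Icc 0 t) :=
      Complex.continuous_re.comp_continuousOn (hΨσ.mono fun r hr => ⟨hr.1, hr.2.trans_lt h1⟩)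
    constructor
    · by_contra hh
      push Not at hh
      obtain ⟨r, hr, e⟩ := intermediate_value_Icc' h0 hc ⟨hh, by simp only [hσ0]; exact hsa.le⟩
      exact (hav r hr.1 (hr.2.trans_lt h1)).1 e
    · by_contra hh
      push Not at hh
      obtain ⟨r, hr, e⟩ := intermediate_value_Icc h0 hc ⟨by simp only [hσ0]; exact le_of_lt hb, hh⟩
      exact (hav r hr.1 (hr.2.trans_lt h1)).2 e
  have hπ := Real.pi_pos
  have hend : ∀ η, 0 < η → ∃ t0, 0 ≤ t0 ∧ t0 < 1 ∧ ∀ t, t0 ≤ t → t < 1 →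
      (Ψ (σ t)).im < η ∨ Real.pi - η < (Ψ (σ t)).im := by
    intro η hη
    have hQ : ∀ w ∈ pwRec a b η (Real.pi - η), M < w.re ∧ 0 < w.im ∧ w.im < Real.pi :=
      fun w hw => ⟨by linarith [hw.1], by linarith [hw.2], by linarith [hw.2]⟩
    have hfQ : IsCompact (f '' pwRec a b η (Real.pi - η)) :=
      (pwRec_compact _ _ _ _).image_of_continuousOn (S.fcont.mono hQ)
    have hnot : σ 1 ∈ (f '' pwRec a b η (Real.pi - η))ᶜ := by
      rintro ⟨w, hw, e⟩
      have := hQ w hw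
      exact S.fK w this.1 this.2.1 this.2.2 (e ▸ hσ1)
    have hnb := hσ.continuousAt.preimage_mem_nhds (hfQ.isClosed.isOpen_compl.mem_nhds hnot)
    obtain ⟨r, hr, hball⟩ := Metric.mem_nhds_iff.1 hnb
    refine ⟨max 0 (1 - r / 2), le_max_left _ _, max_lt one_pos (by linarith), fun t ht ht1 => ?_⟩
    have ht0 := (le_max_left _ _).trans ht
    have htr := (le_max_right _ _).trans ht
    have h1 : σ t ∉ f '' pwRec a b η (Real.pi - η) := hball (by
      rw [mem_ball, Real.dist_eq, abs_sub_lt_iff]; constructor <;> linarith)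
    by_contra hh
    push Not at hh
    have hr' := hre t ht0 ht1
    exact h1 ⟨Ψ (σ t), ⟨⟨hr'.1.le, hr'.2.le⟩, hh.1, hh.2⟩, S.fΨ _ (hσK t ht0 ht1) (by linarith)⟩
  refine ⟨a, b, σ, hax, hsa.trans hb, ⟨hσ.continuousOn, hN ⟨hσ1, hσz 1 zero_le_one le_rfl⟩, hσK, hre⟩, ?_⟩
  obtain ⟨t0, ht00, ht01, ht0⟩ := hend (Real.pi / 4) (by positivity)
  have hcI : ∀ t, t0 ≤ t → t < 1 → ContinuousOn (fun t => (Ψ (σ t)).im) (Icc t0 t) :=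
    fun t h h1 => Complex.continuous_im.comp_continuousOn (hΨσ.mono fun r hr =>
      ⟨ht00.trans hr.1, hr.2.trans_lt h1⟩)
  rcases ht0 t0 le_rfl ht01 with h | h
  · left
    have side : ∀ t, t0 ≤ t → t < 1 → (Ψ (σ t)).im < Real.pi / 2 := by
      intro t h0 h1
      by_contra hh
      push Not at hh
      obtain ⟨r, hr, e⟩ := intermediate_value_Icc h0 (hcI t h0 h1) ⟨by linarith, hh⟩
      simp only at e
      rcases ht0 r hr.1 (hr.2.trans_lt h1) with h' | h' <;> linarith
    intro η hη
    obtain ⟨t1, h10, h11, h1⟩ := hend (min η (Real.pi / 4)) (by positivity)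
    refine ⟨max t0 t1, ht00.trans (le_max_left _ _), max_lt ht01 h11, fun t ht ht' => ?_⟩
    have g1 := side t ((le_max_left _ _).trans ht) ht'
    have g2 := min_le_left η (Real.pi / 4)
    have g3 := min_le_right η (Real.pi / 4)
    rcases h1 t ((le_max_right _ _).trans ht) ht' with h' | h' <;> linarith
  · right
    have side : ∀ t, t0 ≤ t → t < 1 → Real.pi / 2 < (Ψ (σ t)).im := by
      intro t h0 h1
      by_contra hh
      push Not at hh
      obtain ⟨r, hr, e⟩ := intermediate_value_Icc' h0 (hcI t h0 h1) ⟨hh, by linarith⟩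
      simp only at e
      rcases ht0 r hr.1 (hr.2.trans_lt h1) with h' | h' <;> linarith
    intro η hη
    obtain ⟨t1, h10, h11, h1⟩ := hend (min η (Real.pi / 4)) (by positivity)
    refine ⟨max t0 t1, ht00.trans (le_max_left _ _), max_lt ht01 h11, fun t ht ht' => ?_⟩
    have g1 := side t ((le_max_left _ _).trans ht) ht'
    have g2 := min_le_left η (Real.pi / 4)
    have g3 := min_le_right η (Real.pi / 4)
    simp only [pwRefl]
    rcases h1 t ((le_max_right _ _).trans ht) ht' with h' | h' <;> linarith

lemma pw_case1 {K : Set ℂ} {f Ψ : ℂ → ℂ} {M : ℝ} (S : PwStrip K f Ψ M) {p z : ℂ}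
    (hp : PwPrin f p) (hlc : PwLC K p) (hcl : PwCl f z) : z = p := by
  by_contra hzp
  have hπ := Real.pi_pos
  obtain ⟨s0, hs0M, hs00, hs0π, hs0p⟩ : ∃ s0 : ℂ, M < s0.re ∧ 0 < s0.im ∧ s0.im < Real.pi ∧
      f s0 ≠ p := by
    by_contra hh
    push Not at hh
    have e1 := hh ⟨M + 1, Real.pi / 2⟩ (by simp) (by simp; linarith) (by simp; linarith)
    have e2 := hh ⟨M + 2, Real.pi / 2⟩ (by simp) (by simp; linarith) (by simp; linarith)
    have e3 := S.Ψf ⟨M + 1, Real.pi / 2⟩ (by simp) (by simp; linarith) (by simp; linarith)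
    have e4 := S.Ψf ⟨M + 2, Real.pi / 2⟩ (by simp) (by simp; linarith) (by simp; linarith)
    rw [e1] at e3
    rw [e2, e3] at e4
    have := congrArg Complex.re e4
    simp at this
  obtain ⟨ε, hε0, hε⟩ : ∃ ε, 0 < ε ∧ ε < min (dist (f s0) p) (dist z p / 2) :=
    exists_between (lt_min (dist_pos.2 hs0p) (half_pos (dist_pos.2 hzp)))
  have hε1 := hε.trans_le (min_le_left _ _)
  have hε2 := hε.trans_le (min_le_right _ _)
  obtain ⟨N, hNK, hNc, hNp, hNε, δ, hδ, hKN⟩ := hlc ε hε0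
  obtain ⟨x, hx, hxp⟩ := hp (min ε (δ / 2)) (by positivity) s0.re
  have hx : s0.re < x := hx
  obtain ⟨s', hs'x, hs'0, hs'π, hs'z⟩ := hcl ε hε0 x
  have hs'p : ε < dist (f s') p := by
    have := dist_triangle_left z p (f s')
    linarith
  let G := {s : ℂ | s.re = x ∧ 0 < s.im ∧ s.im < Real.pi}
  have hGcl : closure (f '' G) ⊆ closedBall p (min ε (δ / 2)) :=
    closure_minimal (by rintro _ ⟨s, hs, rfl⟩; exact hxp s hs.1 hs.2.1 hs.2.2) isClosed_closedBall
  let A := f '' G ∪ N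
  have hAcl : IsClosed A := by
    rw [← closure_subset_iff_isClosed]
    simp only [A, closure_union, hNc.closure_eq]
    refine union_subset (fun w hw => ?_) subset_union_right
    by_cases hwK : w ∈ K
    · right
      refine hKN ⟨hwK, ?_⟩
      have := hGcl hw
      rw [mem_closedBall] at this
      rw [mem_ball]
      linarith [min_le_right ε (δ / 2)]
    · left
      have hc : ContinuousAt Ψ w := S.Ψcont.continuousAt (S.cK.isClosed.isOpen_compl.mem_nhds hwK)
      have h1 : Ψ w ∈ closure (Ψ '' (f '' G)) := mem_closure_image hc hw
      have h2 : closure (Ψ '' (f '' G)) ⊆ {s | s.re = x} := by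
        refine closure_minimal ?_ (isClosed_eq Complex.continuous_re continuous_const)
        rintro _ ⟨_, ⟨s, hs, rfl⟩, rfl⟩
        have hs1 : s.re = x := hs.1
        rw [S.Ψf s (by linarith) hs.2.1 hs.2.2]
        exact hs.1
      have h3 : (Ψ w).re = x := h2 h1
      exact ⟨Ψ w, ⟨h3, S.Ψmem w hwK⟩, S.fΨ w hwK (by linarith)⟩
  have hAsub : A ⊆ closedBall p ε := union_subset
    (subset_closure.trans (hGcl.trans (closedBall_subset_closedBall (min_le_left _ _)))) hNε
  have hAc : IsCompact A := (isCompact_closedBall p ε).of_isClosed_subset hAcl hAsub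
  have hAK : A ∩ K = N := by
    ext w
    constructor
    · rintro ⟨⟨s, hs, rfl⟩ | h, hK⟩
      · have hs1 : s.re = x := hs.1
        exact absurd hK (S.fK s (by linarith) hs.2.1 hs.2.2)
      · exact h
    · exact fun h => ⟨Or.inr h, hNK h⟩
  let P := {s : ℂ | M < s.re ∧ 0 < s.im ∧ s.im < Real.pi}
  have hP : IsPreconnected P := by
    have : Convex ℝ P := (convex_halfSpace_re_gt M).inter
      ((convex_halfSpace_im_gt 0).inter (convex_halfSpace_im_lt Real.pi))
    exact this.isPreconnected
  have hfP : IsPreconnected (f '' P) := hP.image _ S.fcont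
  have hfPK : Disjoint (f '' P) K := by
    rw [Set.disjoint_left]
    rintro _ ⟨s, hs, rfl⟩
    exact S.fK s hs.1 hs.2.1 hs.2.2
  obtain ⟨γ, hγ⟩ := pw_janiszewski (a := f s0) (b := f s') hAc S.cK (by rw [hAK]; exact hNp)
    (pw_preconn_outside (c := p) hε0) hfP (by
      rw [Set.disjoint_left]
      intro w hw hwA
      have := hAsub hwA
      rw [mem_closedBall] at this
      exact absurd hw (not_lt.2 this)) hfPK hε1 hs'p
    ⟨s0, ⟨hs0M, hs00, hs0π⟩, rfl⟩ ⟨s', ⟨by linarith, hs'0, hs'π⟩, rfl⟩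
  have hγK : ∀ t, γ t ∉ K := fun t h => hγ t (Or.inr h)
  have hΨγ : Continuous (fun t => (Ψ (γ t)).re) :=
    Complex.continuous_re.comp (S.Ψcont.comp_continuous γ.continuous hγK)
  obtain ⟨t, ht⟩ := mem_range_of_exists_le_of_exists_ge (c := x) hΨγ
    ⟨0, by simp [S.Ψf s0 hs0M hs00 hs0π, hx.le]⟩
    ⟨1, by simp [S.Ψf s' (by linarith) hs'0 hs'π, hs'x.le]⟩
  have ht : (Ψ (γ t)).re = x := ht
  exact hγ t (Or.inl (Or.inl ⟨Ψ (γ t), ⟨ht, S.Ψmem _ (hγK t)⟩, S.fΨ _ (hγK t) (by linarith)⟩))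

def PwR (K N : Set ℂ) (Ψ : ℂ → ℂ) : Prop :=
  ∀ x0 : ℝ, ∃ a b σ, x0 < a ∧ a < b ∧ PwSpike K N Ψ a b σ ∧ PwBottom Ψ σ

lemma pw_pair {K N1 N2 : Set ℂ} {f Ψ : ℂ → ℂ} {M : ℝ} (S : PwStrip K f Ψ M)
    (hN1K : N1 ⊆ K) (hN2K : N2 ⊆ K) (hN1c : IsClosed N1)
    (hN1 : IsPreconnected N1) (hN2 : IsPreconnected N2) (hN12 : Disjoint N1 N2)
    (h1 : PwR K N1 Ψ) (h2 : PwR K N2 Ψ) : False := by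
  obtain ⟨a1, b1, σ1, g1, -, s1, B1⟩ := h1 M
  obtain ⟨a2, b2, σ2, g2, -, s2, B2⟩ := h2 b1
  obtain ⟨a3, b3, σ3, g3, -, s3, B3⟩ := h1 b2
  obtain ⟨a4, b4, σ4, g4, -, s4, B4⟩ := h2 b3
  exact pw_four S hN1K hN2K hN1c hN1 hN2 hN12 g1 g2.le g3.le g4.le s1 s2 s3 s4 B1 B2 B3

lemma pw_side {K N : Set ℂ} {f Ψ : ℂ → ℂ} {M : ℝ} (S : PwStrip K f Ψ M) {p z : ℂ}
    (hp : PwPrin f p) (hz : z ∈ K) (hcl : PwCl f z) (hzp : z ≠ p) {δ : ℝ} (hδ : 0 < δ)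
    (hN : K ∩ ball z δ ⊆ N) : PwR K N Ψ ∨ PwR K N (fun z => pwRefl (Ψ z)) := by
  by_contra hh
  simp only [not_or, PwR, not_forall] at hh
  obtain ⟨⟨x, hx⟩, ⟨y, hy⟩⟩ := hh
  have hd := dist_pos.2 hzp
  have hm1 := min_le_left δ (dist z p / 3)
  have hm2 := min_le_right δ (dist z p / 3)
  obtain ⟨a, b, σ, ha, hab, hs, hB | hB⟩ := pw_spike S hp hz hcl (δ := min δ (dist z p / 3))
    (by positivity) (by linarith)
    ((inter_subset_inter_right _ (ball_subset_ball hm1)).trans hN) (max x y)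
  · exact hx ⟨a, b, σ, (le_max_left _ _).trans_lt ha, hab, hs, hB⟩
  · exact hy ⟨a, b, σ, (le_max_right _ _).trans_lt ha, hab, ⟨hs.1, hs.2, hs.3, hs.4⟩, hB⟩

theorem pw_final {K : Set ℂ} {f Ψ : ℂ → ℂ} {M : ℝ} (S : PwStrip K f Ψ M) {p z1 z2 z3 : ℂ}
    (hp : PwPrin f p) (k1 : z1 ∈ K) (k2 : z2 ∈ K) (k3 : z3 ∈ K)
    (c1 : PwCl f z1) (c2 : PwCl f z2) (c3 : PwCl f z3)
    (l1 : PwLC K z1) (l2 : PwLC K z2) (l3 : PwLC K z3)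
    (h12 : z1 ≠ z2) (h13 : z1 ≠ z3) (h23 : z2 ≠ z3) : False := by
  have p1 : z1 ≠ p := by
    rintro rfl; exact h12 (pw_case1 S hp l1 c2).symm
  have p2 : z2 ≠ p := by
    rintro rfl; exact h12 (pw_case1 S hp l2 c1)
  have p3 : z3 ≠ p := by
    rintro rfl; exact h13 (pw_case1 S hp l3 c1)
  obtain ⟨ε, hε0, hε⟩ : ∃ ε, 0 < ε ∧ ε < min (dist z1 z2) (min (dist z1 z3) (dist z2 z3)) / 2 :=
    exists_between (half_pos (lt_min (dist_pos.2 h12) (lt_min (dist_pos.2 h13) (dist_pos.2 h23))))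
  have m1 := min_le_left (dist z1 z2) (min (dist z1 z3) (dist z2 z3))
  have m2 := min_le_right (dist z1 z2) (min (dist z1 z3) (dist z2 z3))
  have m3 := min_le_left (dist z1 z3) (dist z2 z3)
  have m4 := min_le_right (dist z1 z3) (dist z2 z3)
  obtain ⟨N1, n1K, n1c, n1p, n1b, δ1, hδ1, n1⟩ := l1 ε hε0
  obtain ⟨N2, n2K, n2c, n2p, n2b, δ2, hδ2, n2⟩ := l2 ε hε0
  obtain ⟨N3, n3K, n3c, n3p, n3b, δ3, hδ3, n3⟩ := l3 ε hε0
  have d12 : Disjoint N1 N2 := (closedBall_disjoint_closedBall (by linarith)).mono n1b n2b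
  have d13 : Disjoint N1 N3 := (closedBall_disjoint_closedBall (by linarith)).mono n1b n3b
  have d23 : Disjoint N2 N3 := (closedBall_disjoint_closedBall (by linarith)).mono n2b n3b
  rcases pw_side S hp k1 c1 p1 hδ1 n1 with r1 | r1 <;>
  rcases pw_side S hp k2 c2 p2 hδ2 n2 with r2 | r2 <;>
  rcases pw_side S hp k3 c3 p3 hδ3 n3 with r3 | r3
  · exact pw_pair S n1K n2K n1c n1p n2p d12 r1 r2
  · exact pw_pair S n1K n2K n1c n1p n2p d12 r1 r2
  · exact pw_pair S n1K n3K n1c n1p n3p d13 r1 r3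
  · exact pw_pair S.refl n2K n3K n2c n2p n3p d23 r2 r3
  · exact pw_pair S n2K n3K n2c n2p n3p d23 r2 r3
  · exact pw_pair S.refl n1K n3K n1c n1p n3p d13 r1 r3
  · exact pw_pair S.refl n1K n2K n1c n1p n2p d12 r1 r2
  · exact pw_pair S.refl n1K n2K n1c n1p n2p d12 r1 r2

end

section
open Filter Topology Metric Set MeasureTheory
open scoped ENNReal

lemma pw_det (c : ℂ) : |((ContinuousLinearMap.toSpanSingleton ℂ c : ℂ →L[ℂ] ℂ).restrictScalars ℝ).det| = ‖c‖ ^ 2 := by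
  have : ((ContinuousLinearMap.toSpanSingleton ℂ c : ℂ →L[ℂ] ℂ).restrictScalars ℝ).det = ‖c‖ ^ 2 := by
    unfold ContinuousLinearMap.det
    rw [← LinearMap.det_toMatrix Complex.basisOneI, Matrix.det_fin_two]
    simp [LinearMap.toMatrix_apply, Complex.sq_norm, Complex.normSq_apply]
  rw [this]; exact abs_of_nonneg (by positivity)

lemma pw_Popen (M : ℝ) : IsOpen {s : ℂ | M < s.re ∧ 0 < s.im ∧ s.im < Real.pi} := by
  have h : {s : ℂ | M < s.re ∧ 0 < s.im ∧ s.im < Real.pi} =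
      Complex.re ⁻¹' Ioi M ∩ Complex.im ⁻¹' Ioo 0 Real.pi := by ext s; simp
  rw [h]
  exact (isOpen_Ioi.preimage Complex.continuous_re).inter (isOpen_Ioo.preimage Complex.continuous_im)

lemma pw_area {f : ℂ → ℂ} {P : Set ℂ} (hP : IsOpen P) (hd : DifferentiableOn ℂ f P)
    (hi : InjOn f P) (hb : Bornology.IsBounded (f '' P)) :
    ∫⁻ s in P, ‖deriv f s‖ₑ ^ 2 < (⊤ : ENNReal) := by
  have h := lintegral_abs_det_fderiv_eq_addHaar_image (volume : Measure ℂ) hP.measurableSet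
    (f := f) (f' := fun s => (ContinuousLinearMap.toSpanSingleton ℂ (deriv f s)).restrictScalars ℝ)
    (fun s hs => ((hd.differentiableAt (hP.mem_nhds hs)).hasDerivAt.hasFDerivAt.restrictScalars ℝ).hasFDerivWithinAt) hi
  calc _ = volume (f '' P) := by
        rw [← h]; congr 1; ext s
        rw [pw_det, ENNReal.ofReal_pow (norm_nonneg _), ofReal_norm]
    _ < (⊤ : ENNReal) := hb.measure_lt_top

lemma pw_fubini {g : ℂ → ℝ≥0∞} (hg : Measurable g) (M : ℝ) :
    ∫⁻ s in {s : ℂ | M < s.re ∧ 0 < s.im ∧ s.im < Real.pi}, g s =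
      ∫⁻ x in Ioi M, ∫⁻ y in Ioo 0 Real.pi, g ⟨x, y⟩ := by
  rw [← Complex.volume_preserving_equiv_real_prod.symm.setLIntegral_comp_preimage_emb
    Complex.measurableEquivRealProd.symm.measurableEmbedding]
  have : (Complex.measurableEquivRealProd.symm ⁻¹' {s : ℂ | M < s.re ∧ 0 < s.im ∧ s.im < Real.pi}) =
      Ioi M ×ˢ Ioo 0 Real.pi := by
    ext ⟨x, y⟩
    have h : Complex.measurableEquivRealProd.symm (x, y) = ⟨x, y⟩ := rfl
    rw [mem_preimage, h]; simp
  rw [this]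
  exact setLIntegral_prod (μ := volume) (ν := volume) (s := Ioi M) (t := Ioo 0 Real.pi) (fun p : ℝ × ℝ => g (Complex.measurableEquivRealProd.symm p))
    (hg.comp Complex.measurableEquivRealProd.symm.measurable).aemeasurable

lemma pw_small {g : ℂ → ℝ≥0∞} (hg : Measurable g) {M : ℝ}
    (h : ∫⁻ s in {s : ℂ | M < s.re ∧ 0 < s.im ∧ s.im < Real.pi}, g s < (⊤ : ENNReal)) {c : ℝ≥0∞} (hc : c ≠ 0) (x0 : ℝ) :
    ∃ x > x0, M < x ∧ ∫⁻ y in Ioo 0 Real.pi, g ⟨x, y⟩ ≤ c := by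
  by_contra! hx
  rw [pw_fubini hg] at h
  have : ∫⁻ x in Ioi (max x0 M), c ≤ ∫⁻ x in Ioi M, ∫⁻ y in Ioo 0 Real.pi, g ⟨x, y⟩ := by
    refine le_trans ?_ (lintegral_mono_set (Ioi_subset_Ioi (le_max_right x0 M)))
    refine setLIntegral_mono' measurableSet_Ioi fun x hx' => ?_
    have := max_lt_iff.1 (mem_Ioi.1 hx')
    exact (hx x this.1 this.2).le
  rw [setLIntegral_const, Real.volume_Ioi, ENNReal.mul_top hc] at this
  exact absurd (this.trans_lt h) (by simp)

lemma pw_osc1 {f : ℂ → ℂ} {M x : ℝ} (hx : M < x)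
    (hd : DifferentiableOn ℂ f {s : ℂ | M < s.re ∧ 0 < s.im ∧ s.im < Real.pi}) {lam c : ℝ}
    (hl : 0 < lam) (hc : 0 ≤ c)
    (h : ∫⁻ y in Ioo 0 Real.pi, ‖deriv f ⟨x, y⟩‖ₑ ^ 2 ≤ ENNReal.ofReal c) {a b : ℝ}
    (ha : 0 < a) (hab : a ≤ b) (hb : b < Real.pi) :
    dist (f ⟨x, b⟩) (f ⟨x, a⟩) ≤ lam * Real.pi + lam⁻¹ * c := by
  have hP := pw_Popen M
  have hline : ∀ y : ℝ, HasDerivAt (fun y : ℝ => (⟨x, y⟩ : ℂ)) Complex.I y := by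
    intro y
    have h1 : (fun y : ℝ => (⟨x, y⟩ : ℂ)) = fun y : ℝ => (x : ℂ) + (y : ℂ) * Complex.I := by
      ext y; apply Complex.ext <;> simp
    rw [h1]
    have := ((Complex.ofRealCLM.hasDerivAt (x := y)).mul_const Complex.I).const_add (x : ℂ)
    simpa using this
  have hlc : Continuous (fun y : ℝ => (⟨x, y⟩ : ℂ)) :=
    continuous_iff_continuousAt.2 fun y => (hline y).continuousAt
  have hmem : ∀ y ∈ uIcc a b, (⟨x, y⟩ : ℂ) ∈ {s : ℂ | M < s.re ∧ 0 < s.im ∧ s.im < Real.pi} := by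
    intro y hy
    rw [uIcc_of_le hab] at hy
    exact ⟨hx, ha.trans_le hy.1, hy.2.trans_lt hb⟩
  have hF := intervalIntegral.integral_eq_sub_of_hasDerivAt (a := a) (b := b)
    (f := fun y : ℝ => f ⟨x, y⟩) (f' := fun y : ℝ => deriv f ⟨x, y⟩ * Complex.I)
    (fun y hy => ((hd.differentiableAt (hP.mem_nhds (hmem y hy))).hasDerivAt).comp y (hline y))
    (ContinuousOn.intervalIntegrable (((hd.deriv hP).continuousOn.comp hlc.continuousOn hmem).mul
      continuousOn_const))
  rw [dist_eq_norm, ← hF, intervalIntegral.integral_of_le hab]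
  have hpos : 0 ≤ lam * Real.pi + lam⁻¹ * c := by positivity
  rw [← ENNReal.ofReal_le_ofReal_iff hpos, ofReal_norm]
  refine (enorm_integral_le_lintegral_enorm _).trans ?_
  calc _ ≤ ∫⁻ y in Ioo 0 Real.pi, ‖deriv f ⟨x, y⟩ * Complex.I‖ₑ :=
        lintegral_mono_set fun y hy => ⟨ha.trans hy.1, hy.2.trans_lt hb⟩
    _ ≤ ∫⁻ y in Ioo 0 Real.pi, (ENNReal.ofReal lam + ENNReal.ofReal lam⁻¹ * ‖deriv f ⟨x, y⟩‖ₑ ^ 2) := by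
        refine lintegral_mono fun y => ?_
        rw [← ofReal_norm, ← ofReal_norm, ← ENNReal.ofReal_pow (norm_nonneg _),
          ← ENNReal.ofReal_mul (by positivity), ← ENNReal.ofReal_add hl.le (by positivity)]
        apply ENNReal.ofReal_le_ofReal
        rw [norm_mul, Complex.norm_I, mul_one]
        generalize ‖deriv f ⟨x, y⟩‖ = t
        have : lam + lam⁻¹ * t ^ 2 - t = lam⁻¹ * ((t - lam / 2) ^ 2 + 3 / 4 * lam ^ 2) := by
          field_simp; ring
        have h2 : 0 ≤ lam⁻¹ * ((t - lam / 2) ^ 2 + 3 / 4 * lam ^ 2) := by positivity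
        linarith
    _ = ENNReal.ofReal lam * ENNReal.ofReal Real.pi +
          ENNReal.ofReal lam⁻¹ * ∫⁻ y in Ioo 0 Real.pi, ‖deriv f ⟨x, y⟩‖ₑ ^ 2 := by
        rw [lintegral_add_left measurable_const, setLIntegral_const, Real.volume_Ioo, sub_zero,
          lintegral_const_mul']
        simp
    _ ≤ ENNReal.ofReal lam * ENNReal.ofReal Real.pi +
          ENNReal.ofReal lam⁻¹ * ENNReal.ofReal c := by gcongr
    _ = _ := by
        rw [← ENNReal.ofReal_mul hl.le, ← ENNReal.ofReal_mul (by positivity),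
          ← ENNReal.ofReal_add (by positivity) (by positivity)]

lemma pw_osc {f : ℂ → ℂ} {M : ℝ}
    (hd : DifferentiableOn ℂ f {s : ℂ | M < s.re ∧ 0 < s.im ∧ s.im < Real.pi})
    (hi : InjOn f {s : ℂ | M < s.re ∧ 0 < s.im ∧ s.im < Real.pi})
    (hb : Bornology.IsBounded (f '' {s : ℂ | M < s.re ∧ 0 < s.im ∧ s.im < Real.pi}))
    {ε : ℝ} (hε : 0 < ε) (x0 : ℝ) :
    ∃ x > x0, M < x ∧ ∀ a b : ℝ, 0 < a → a < Real.pi → 0 < b → b < Real.pi →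
      dist (f ⟨x, a⟩) (f ⟨x, b⟩) ≤ ε := by
  have hP := pw_Popen M
  have hA := pw_area hP hd hi hb
  have hπ := Real.pi_pos
  have hl : 0 < ε / (2 * Real.pi) := by positivity
  set lam := ε / (2 * Real.pi) with hlam
  have hc : 0 < lam * ε / 2 := by positivity
  obtain ⟨x, hx0, hxM, hx⟩ := pw_small (g := fun s => ‖deriv f s‖ₑ ^ 2)
    ((measurable_deriv f).enorm.pow_const 2) hA
    (c := ENNReal.ofReal (lam * ε / 2)) (by simpa using hc) x0
  have he : lam * Real.pi + lam⁻¹ * (lam * ε / 2) = ε := by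
    have : lam * Real.pi = ε / 2 := by rw [hlam]; field_simp
    rw [this]; field_simp; ring
  refine ⟨x, hx0, hxM, fun a b ha ha' hb0 hb' => ?_⟩
  rcases le_total a b with h | h
  · rw [dist_comm, ← he]; exact pw_osc1 hxM hd hl hc.le hx ha h hb'
  · rw [← he]; exact pw_osc1 hxM hd hl hc.le hx hb0 h ha'

lemma pw_prin {f : ℂ → ℂ} {M : ℝ}
    (hd : DifferentiableOn ℂ f {s : ℂ | M < s.re ∧ 0 < s.im ∧ s.im < Real.pi})
    (hi : InjOn f {s : ℂ | M < s.re ∧ 0 < s.im ∧ s.im < Real.pi})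
    (hb : Bornology.IsBounded (f '' {s : ℂ | M < s.re ∧ 0 < s.im ∧ s.im < Real.pi})) :
    ∃ p, PwPrin f p := by
  have hπ := Real.pi_pos
  have key : ∀ n : ℕ, ∃ x > (n : ℝ), M < x ∧ ∀ a b : ℝ, 0 < a → a < Real.pi → 0 < b → b < Real.pi →
      dist (f ⟨x, a⟩) (f ⟨x, b⟩) ≤ 1 / ((n : ℝ) + 1) := fun n => pw_osc hd hi hb (by positivity) n
  choose x hx hxM hosc using key
  obtain ⟨p, -, k, hk, hkp⟩ := tendsto_subseq_of_bounded hb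
    (x := fun n => f ⟨x n, Real.pi / 2⟩) (fun n => ⟨_, ⟨hxM n, by simpa using hπ, by simpa using hπ⟩, rfl⟩)
  refine ⟨p, fun ε hε x0 => ?_⟩
  have h1 : ∀ᶠ n in atTop, dist (f ⟨x (k n), Real.pi / 2⟩) p < ε / 2 :=
    (Metric.tendsto_nhds.1 hkp) _ (half_pos hε)
  have h2 : ∀ᶠ n in atTop, 1 / (((k n : ℕ) : ℝ) + 1) < ε / 2 :=
    (tendsto_one_div_add_atTop_nhds_zero_nat.comp hk.tendsto_atTop).eventually_lt_const (half_pos hε)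
  have h3 : ∀ᶠ n in atTop, x0 < ((k n : ℕ) : ℝ) :=
    (tendsto_natCast_atTop_atTop.comp hk.tendsto_atTop).eventually_gt_atTop x0
  obtain ⟨n, h1, h2, h3⟩ := (h1.and (h2.and h3)).exists
  refine ⟨x (k n), h3.trans (hx _), fun s hs hs0 hsπ => ?_⟩
  have h4 := hosc (k n) s.im (Real.pi / 2) hs0 hsπ (by linarith) (by linarith)
  have h5 : (⟨x (k n), s.im⟩ : ℂ) = s := Complex.ext hs.symm rfl
  rw [h5] at h4
  linarith [dist_triangle (f s) (f ⟨x (k n), Real.pi / 2⟩) p]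

end

def pwW (ζ s : ℂ) : ℂ := ζ * (Complex.exp s - Complex.I) / (Complex.exp s + Complex.I)

def pwS (ζ w : ℂ) : ℂ := Complex.log (Complex.I * (ζ + w) / (ζ - w))

lemma pw_exp_im {s : ℂ} (h0 : 0 < s.im) (hπ : s.im < Real.pi) : 0 < (Complex.exp s).im := by
  rw [Complex.exp_im]
  exact mul_pos (Real.exp_pos _) (Real.sin_pos_of_pos_of_lt_pi h0 hπ)

lemma pw_addI_ne {e : ℂ} (he : 0 < e.im) : e + Complex.I ≠ 0 := by
  intro h
  have := congrArg Complex.im h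
  simp at this; linarith

lemma pwW_mem {ζ s : ℂ} (hζ : ‖ζ‖ = 1) (h0 : 0 < s.im) (hπ : s.im < Real.pi) :
    pwW ζ s ∈ ball (0 : ℂ) 1 := by
  have he := pw_exp_im h0 hπ
  have hne := pw_addI_ne he
  unfold pwW
  generalize Complex.exp s = e at *
  rw [mem_ball_zero_iff, norm_div, norm_mul, hζ, one_mul, div_lt_one (norm_pos_iff.2 hne)]
  apply lt_of_pow_lt_pow_left₀ 2 (norm_nonneg _)
  rw [Complex.sq_norm, Complex.sq_norm, Complex.normSq_apply, Complex.normSq_apply]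
  simp
  nlinarith

lemma pw_ne {ζ w : ℂ} (hζ : ‖ζ‖ = 1) (hw : w ∈ ball (0 : ℂ) 1) : ζ - w ≠ 0 := by
  intro h
  rw [sub_eq_zero] at h
  rw [mem_ball_zero_iff, ← h, hζ] at hw
  exact lt_irrefl _ hw

lemma pw_eta_im {ζ w : ℂ} (hζ : ‖ζ‖ = 1) (hw : w ∈ ball (0 : ℂ) 1) :
    0 < (Complex.I * (ζ + w) / (ζ - w)).im := by
  have hne := pw_ne hζ hw
  have h1 : ‖w‖ ^ 2 < 1 := by
    rw [mem_ball_zero_iff] at hw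
    have := norm_nonneg w
    nlinarith
  have h2 : ‖ζ‖ ^ 2 = 1 := by rw [hζ]; norm_num
  rw [Complex.sq_norm, Complex.normSq_apply] at h1 h2
  have hn := Complex.normSq_pos.2 hne
  have : (Complex.I * (ζ + w) / (ζ - w)).im =
      (ζ.re * ζ.re + ζ.im * ζ.im - (w.re * w.re + w.im * w.im)) / Complex.normSq (ζ - w) := by
    rw [Complex.div_im]
    simp
    field_simp
    ring
  rw [this]
  apply div_pos _ hn
  linarith

lemma pwS_mem {ζ w : ℂ} (hζ : ‖ζ‖ = 1) (hw : w ∈ ball (0 : ℂ) 1) :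
    0 < (pwS ζ w).im ∧ (pwS ζ w).im < Real.pi := by
  have h := pw_eta_im hζ hw
  unfold pwS
  rw [Complex.log_im]
  refine ⟨?_, ?_⟩
  · refine lt_of_le_of_ne (Complex.arg_nonneg_iff.2 h.le) fun h0 => ?_
    have := (Complex.arg_eq_zero_iff.1 h0.symm).2
    linarith
  · refine lt_of_le_of_ne (Complex.arg_le_pi _) fun h0 => ?_
    have := (Complex.arg_eq_pi_iff.1 h0).2
    linarith

lemma pwW_S {ζ w : ℂ} (hζ : ‖ζ‖ = 1) (hw : w ∈ ball (0 : ℂ) 1) : pwW ζ (pwS ζ w) = w := by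
  have h := pw_eta_im hζ hw
  have hne := pw_ne hζ hw
  have h0 : Complex.I * (ζ + w) / (ζ - w) ≠ 0 := by
    intro h0; rw [h0] at h; simp at h
  have hI := pw_addI_ne h
  have hζ0 : ζ ≠ 0 := by rintro rfl; simp at hζ
  unfold pwW pwS
  rw [Complex.exp_log h0, div_eq_iff hI]
  field_simp
  ring

lemma pwS_W {ζ s : ℂ} (hζ : ‖ζ‖ = 1) (h0 : 0 < s.im) (hπ : s.im < Real.pi) :
    pwS ζ (pwW ζ s) = s := by
  have hne := pw_addI_ne (pw_exp_im h0 hπ)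
  have hζ0 : ζ ≠ 0 := by rintro rfl; simp at hζ
  have hW := pw_ne hζ (pwW_mem hζ h0 hπ)
  have : Complex.I * (ζ + pwW ζ s) / (ζ - pwW ζ s) = Complex.exp s := by
    rw [div_eq_iff hW]
    unfold pwW
    field_simp
    ring_nf
  unfold pwS
  rw [this, Complex.log_exp (by linarith [Real.pi_pos]) hπ.le]

lemma pwS_cont {ζ : ℂ} (hζ : ‖ζ‖ = 1) : ContinuousOn (pwS ζ) (ball (0 : ℂ) 1) := by
  unfold pwS
  refine ContinuousOn.clog (ContinuousOn.div (by fun_prop) (by fun_prop) fun w hw => pw_ne hζ hw)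
    fun w hw => ?_
  exact Or.inr (pw_eta_im hζ hw).ne'

lemma pwW_analytic {ζ s : ℂ} (h0 : 0 < s.im) (hπ : s.im < Real.pi) :
    DifferentiableAt ℂ (pwW ζ) s := by
  unfold pwW
  exact DifferentiableAt.div (by fun_prop) (by fun_prop) (pw_addI_ne (pw_exp_im h0 hπ))

lemma pwS_tendsto {ζ : ℂ} (hζ : ‖ζ‖ = 1) {w : ℕ → ℂ} (hw : ∀ j, w j ∈ ball (0 : ℂ) 1)
    (h : Tendsto w atTop (𝓝 ζ)) : Tendsto (fun j => (pwS ζ (w j)).re) atTop atTop := by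
  have h1 : Tendsto (fun j => ‖ζ - w j‖) atTop (𝓝[>] 0) := by
    refine tendsto_nhdsWithin_iff.2 ⟨?_, Eventually.of_forall fun j => norm_pos_iff.2 (pw_ne hζ (hw j))⟩
    simpa using (tendsto_const_nhds.sub h : Tendsto (fun j => ζ - w j) atTop (𝓝 (ζ - ζ))).norm
  have h2 : Tendsto (fun j => ‖ζ + w j‖) atTop (𝓝 2) := by
    have := (tendsto_const_nhds.add h : Tendsto (fun j => ζ + w j) atTop (𝓝 (ζ + ζ))).norm
    rwa [← two_mul, norm_mul, hζ, Complex.norm_ofNat, mul_one] at this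
  have h3 := Real.tendsto_log_atTop.comp (h2.pos_mul_atTop two_pos (tendsto_inv_nhdsGT_zero.comp h1))
  refine h3.congr fun j => ?_
  simp [pwS, Complex.log_re, div_eq_mul_inv]

def pwC (z : OnePoint ℂ) : ℂ := z.elim 0 id

lemma pwC_coe (z : ℂ) : pwC (z : OnePoint ℂ) = z := rfl

lemma coe_pwC {z : OnePoint ℂ} (hz : z ≠ ∞) : ((pwC z : ℂ) : OnePoint ℂ) = z := by
  obtain ⟨x, rfl⟩ := OnePoint.ne_infty_iff_exists.1 hz
  rfl

lemma pw_diff {φ : ℂ → OnePoint ℂ} {w : ℂ} (hne : φ w ≠ ∞)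
    (h : (∃ g : ℂ → ℂ, AnalyticAt ℂ g w ∧ ∀ᶠ w in 𝓝 w, φ w = ((g w : ℂ) : OnePoint ℂ)) ∨
    (∃ g : ℂ → ℂ, AnalyticAt ℂ g w ∧
      ∀ᶠ w in 𝓝 w, φ w = if g w = 0 then (∞ : OnePoint ℂ) else (((g w)⁻¹ : ℂ) : OnePoint ℂ))) :
    DifferentiableAt ℂ (fun w => pwC (φ w)) w := by
  rcases h with ⟨g, hg, h⟩ | ⟨g, hg, h⟩
  · refine hg.differentiableAt.congr_of_eventuallyEq ?_
    filter_upwards [h] with v hv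
    rw [hv, pwC_coe]
  · have hg0 : g w ≠ 0 := by
      intro h0
      have := h.self_of_nhds
      rw [if_pos h0] at this
      exact hne this
    refine (hg.differentiableAt.inv hg0).congr_of_eventuallyEq ?_
    filter_upwards [h, hg.continuousAt.eventually_ne hg0] with v hv hv0
    rw [hv, if_neg hv0, pwC_coe]; rfl

lemma pw_lc_mem {U : Set (OnePoint ℂ)} (hU : IsOpen U) {z : OnePoint ℂ}
    (h : LocallyConnectedAt Uᶜ z) : z ∈ Uᶜ := by
  intro hz
  have hbot : (∅ : Set (OnePoint ℂ)) ∈ 𝓝[Uᶜ] z := by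
    rw [mem_nhdsWithin]
    exact ⟨U, hU, hz, by simp⟩
  obtain ⟨N, -, hN, hc⟩ := h ∅ hbot
  obtain ⟨x, hx⟩ := hc.nonempty
  exact (hN hx).2

lemma pw_lc {U : Set (OnePoint ℂ)} (hU : IsOpen U) (hinf : ∞ ∈ U) {z : ℂ}
    (h : LocallyConnectedAt Uᶜ (z : OnePoint ℂ)) : PwLC {x : ℂ | (x : OnePoint ℂ) ∈ Uᶜ} z := by
  intro ε hε
  have hoe : IsOpenEmbedding ((↑) : ℂ → OnePoint ℂ) := OnePoint.isOpenEmbedding_coe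
  have hV : ((↑) '' closedBall z ε : Set (OnePoint ℂ)) ∈ 𝓝[Uᶜ] (z : OnePoint ℂ) :=
    mem_nhdsWithin_of_mem_nhds (hoe.isOpenMap.image_mem_nhds (closedBall_mem_nhds z hε))
  obtain ⟨N, hN, hNs, hNc⟩ := h _ hV
  have hK : IsClosed {x : ℂ | (x : OnePoint ℂ) ∈ Uᶜ} := hU.isClosed_compl.preimage hoe.continuous
  have hsub : ((↑) ⁻¹' N : Set ℂ) ⊆ {x : ℂ | (x : OnePoint ℂ) ∈ Uᶜ} := fun x hx => (hNs hx).1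
  have himg : ((↑) '' ((↑) ⁻¹' N : Set ℂ) : Set (OnePoint ℂ)) = N := by
    apply image_preimage_eq_of_subset
    intro x hx
    obtain ⟨y, -, hy⟩ := (hNs hx).2
    exact ⟨y, hy⟩
  refine ⟨closure ((↑) ⁻¹' N), closure_minimal hsub hK, isClosed_closure, ?_, ?_, ?_⟩
  · apply IsPreconnected.closure
    rw [← hoe.isInducing.isPreconnected_image, himg]
    exact hNc.isPreconnected
  · apply closure_minimal _ isClosed_closedBall
    intro x hx
    obtain ⟨y, hy, hyx⟩ := (hNs hx).2
    rwa [← OnePoint.coe_injective hyx]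
  · rw [OnePoint.nhdsWithin_coe, Filter.mem_map, Metric.mem_nhdsWithin_iff] at hN
    obtain ⟨δ, hδ, hs⟩ := hN
    exact ⟨δ, hδ, fun x hx => subset_closure (hs ⟨hx.2, hx.1⟩)⟩

/-- The impression of any prime end contains at most two points at which
`K = ℂ∞ \ U` is locally connected. -/
theorem stmt0
    (U : Set ℂ∞) (hUopen : IsOpen U) (hUconn : IsConnected U)
    (hUsc : SimplyConnectedSpace U) (hinfty : ∞ ∈ U)
    (hKconn : IsConnected Uᶜ) (hKnt : Set.Nontrivial Uᶜ)
    (φ : ℂ → ℂ∞) (ψ : ℂ∞ → ℂ)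
    (hφcont : ContinuousOn φ (ball (0 : ℂ) 1))
    (hφmaps : MapsTo φ (ball (0 : ℂ) 1) U)
    (hφhol : HolomorphicIntoSphereOn φ (ball (0 : ℂ) 1))
    (hψcont : ContinuousOn ψ U)
    (hψmaps : MapsTo ψ U (ball (0 : ℂ) 1))
    (hψφ : ∀ z ∈ ball (0 : ℂ) 1, ψ (φ z) = z)
    (hφψ : ∀ w ∈ U, φ (ψ w) = w)
    (ζ : ℂ) (hζ : ζ ∈ sphere (0 : ℂ) 1) :
    Set.encard {z ∈ impression φ ζ | LocallyConnectedAt Uᶜ z} ≤ 2 := by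
  have hζ1 : ‖ζ‖ = 1 := by simpa using hζ
  have hoe : IsOpenEmbedding ((↑) : ℂ → OnePoint ℂ) := OnePoint.isOpenEmbedding_coe
  set m : ℝ := (pwS ζ (ψ ∞)).re with hm
  set M : ℝ := m + 1 with hM
  set K : Set ℂ := {x : ℂ | (x : OnePoint ℂ) ∈ Uᶜ} with hK
  set f : ℂ → ℂ := fun s => pwC (φ (pwW ζ s)) with hf
  set Ψ : ℂ → ℂ := fun z => pwS ζ (ψ z) with hΨ
  have hWm : ∀ s : ℂ, 0 < s.im → s.im < Real.pi → pwW ζ s ∈ ball (0 : ℂ) 1 :=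
    fun s h0 hπ => pwW_mem hζ1 h0 hπ
  have hne : ∀ s : ℂ, M < s.re → 0 < s.im → s.im < Real.pi → φ (pwW ζ s) ≠ ∞ := by
    intro s h h0 hπ he
    have h1 := hψφ _ (hWm s h0 hπ)
    rw [he] at h1
    have h2 := pwS_W hζ1 h0 hπ
    rw [← h1] at h2
    have h3 : m = s.re := congrArg Complex.re h2
    linarith
  have hcoe : ∀ s : ℂ, M < s.re → 0 < s.im → s.im < Real.pi → ((f s : ℂ) : OnePoint ℂ) = φ (pwW ζ s) :=
    fun s h h0 hπ => coe_pwC (hne s h h0 hπ)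
  have hΨf : ∀ s : ℂ, M < s.re → 0 < s.im → s.im < Real.pi → Ψ (f s) = s := by
    intro s h h0 hπ
    show pwS ζ (ψ ((f s : ℂ) : OnePoint ℂ)) = s
    rw [hcoe s h h0 hπ, hψφ _ (hWm s h0 hπ), pwS_W hζ1 h0 hπ]
  have hd : DifferentiableOn ℂ f {s : ℂ | M < s.re ∧ 0 < s.im ∧ s.im < Real.pi} := by
    rintro s ⟨h, h0, hπ⟩
    have h1 := pw_diff (hne s h h0 hπ) (hφhol _ (hWm s h0 hπ))
    exact (h1.comp s (pwW_analytic h0 hπ)).differentiableWithinAt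
  have hnK : ∀ z ∉ K, (z : OnePoint ℂ) ∈ U := fun z hz => by
    simpa [hK] using hz
  have S : PwStrip K f Ψ M :=
    { cK := ((OnePoint.isOpen_iff_of_mem hinfty).1 hUopen).2
      fcont := hd.continuousOn
      Ψcont := (pwS_cont hζ1).comp (hψcont.comp hoe.continuous.continuousOn hnK)
        fun z hz => hψmaps (hnK z hz)
      Ψmem := fun z hz => pwS_mem hζ1 (hψmaps (hnK z hz))
      fK := fun s h h0 hπ hs => by
        have h1 : ((f s : ℂ) : OnePoint ℂ) ∈ Uᶜ := hs
        rw [hcoe s h h0 hπ] at h1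
        exact h1 (hφmaps (hWm s h0 hπ))
      Ψf := hΨf
      fΨ := fun z hz _ => by
        show pwC (φ (pwW ζ (pwS ζ (ψ z)))) = z
        rw [pwW_S hζ1 (hψmaps (hnK z hz)), hφψ _ (hnK z hz), pwC_coe] }
  have hi : InjOn f {s : ℂ | M < s.re ∧ 0 < s.im ∧ s.im < Real.pi} := by
    rintro s ⟨h, h0, hπ⟩ t ⟨h', h0', hπ'⟩ he
    rw [← hΨf s h h0 hπ, ← hΨf t h' h0' hπ', he]
  have hb : Bornology.IsBounded (f '' {s : ℂ | M < s.re ∧ 0 < s.im ∧ s.im < Real.pi}) := by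
    have hc : ContinuousOn (fun z => (pwS ζ (ψ z)).re) U :=
      Complex.continuous_re.comp_continuousOn ((pwS_cont hζ1).comp hψcont hψmaps)
    have hO : IsOpen (U ∩ (fun z => (pwS ζ (ψ z)).re) ⁻¹' Iio M) :=
      hc.isOpen_inter_preimage hUopen isOpen_Iio
    have hOi : (∞ : OnePoint ℂ) ∈ U ∩ (fun z => (pwS ζ (ψ z)).re) ⁻¹' Iio M :=
      ⟨hinfty, by show m < M; linarith⟩
    refine ((OnePoint.isOpen_iff_of_mem hOi).1 hO).2.isBounded.subset ?_
    rintro _ ⟨s, ⟨h, h0, hπ⟩, rfl⟩ hs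
    have h2 : (pwS ζ (ψ ((f s : ℂ) : OnePoint ℂ))).re < M := hs.2
    have h3 : pwS ζ (ψ ((f s : ℂ) : OnePoint ℂ)) = s := hΨf s h h0 hπ
    rw [h3] at h2
    linarith
  obtain ⟨p, hp⟩ := pw_prin hd hi hb
  have key : ∀ z ∈ {z ∈ impression φ ζ | LocallyConnectedAt Uᶜ z},
      ∃ x : ℂ, (x : OnePoint ℂ) = z ∧ x ∈ K ∧ PwCl f x ∧ PwLC K x := by
    rintro z ⟨⟨w, hw, hwζ, hwz⟩, hlc⟩
    have hzU := pw_lc_mem hUopen hlc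
    obtain ⟨x, rfl⟩ := OnePoint.ne_infty_iff_exists.1 (fun h : z = ∞ => hzU (h ▸ hinfty))
    refine ⟨x, rfl, hzU, ?_, pw_lc hUopen hinfty hlc⟩
    intro ε hε x0
    have h1 : ∀ᶠ j in atTop, φ (w j) ∈ ((↑) '' ball x ε : Set (OnePoint ℂ)) :=
      hwz (hoe.isOpenMap.image_mem_nhds (ball_mem_nhds x hε))
    have h2 := (pwS_tendsto hζ1 hw hwζ).eventually_gt_atTop (max x0 M)
    obtain ⟨j, h1, h2⟩ := (h1.and h2).exists
    obtain ⟨y, hy, hyj⟩ := h1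
    have h3 := pwS_mem hζ1 (hw j)
    refine ⟨pwS ζ (w j), (le_max_left _ _).trans_lt h2, h3.1, h3.2, ?_⟩
    show dist (pwC (φ (pwW ζ (pwS ζ (w j))))) x < ε
    rw [pwW_S hζ1 (hw j), ← hyj, pwC_coe]
    exact hy
  by_contra hcon
  rw [not_le] at hcon
  have h3 : (3 : ℕ∞) ≤ Set.encard {z ∈ impression φ ζ | LocallyConnectedAt Uᶜ z} := by
    have := Order.add_one_le_of_lt hcon
    norm_num at this
    exact this
  obtain ⟨T, hT, hT3⟩ := Set.exists_subset_encard_eq h3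
  obtain ⟨a, b, c, hab, hac, hbc, rfl⟩ := Set.encard_eq_three.1 hT3
  obtain ⟨a, rfl, ha1, ha2, ha3⟩ := key a (hT (by simp))
  obtain ⟨b, rfl, hb1, hb2, hb3⟩ := key b (hT (by simp))
  obtain ⟨c, rfl, hc1, hc2, hc3⟩ := key c (hT (by simp))
  exact pw_final S hp ha1 hb1 hc1 ha2 hb2 hc2 ha3 hb3 hc3 (fun h => hab (by rw [h]))
    (fun h => hac (by rw [h])) (fun h => hbc (by rw [h]))

end
end

section
/- If ζ ∈ ∂𝔻 is a symmetric prime end, i.e. I⁺(ζ) = I⁻(ζ), then the impression I(ζ) contains at most one point at which K is locally connected. -/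
open Filter Topology Metric Set OnePoint

noncomputable section

local notation "ℂ∞" => OnePoint ℂ

/-- logs exist when the two points are joined by a connected set off `X`. -/
lemma logE {S X : Set ℂ} (hS : IsPreconnected S) (hX : IsClosed X) (hd : Disjoint S X)
    {p q : ℂ} (hp : p ∈ S) (hq : q ∈ S) :
    ∃ g : ℂ → ℂ, ContinuousOn g X ∧ ∀ z ∈ X, Complex.exp (g z) = (z - p) / (z - q) := by
  have hne : ∀ s ∈ S, ∀ z ∈ X, z - s ≠ 0 := fun s hs z hz h =>
    disjoint_left.1 hd hs (by rwa [sub_eq_zero.1 h] at hz)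
  refine hS.induction₂ (fun p q => ∃ g : ℂ → ℂ, ContinuousOn g X ∧
    ∀ z ∈ X, Complex.exp (g z) = (z - p) / (z - q)) ?_ ?_ ?_ hp hq
  · intro x hx
    have hxX : Xᶜ ∈ 𝓝 x := hX.isOpen_compl.mem_nhds (disjoint_left.1 hd hx)
    obtain ⟨r, hr, hball⟩ := Metric.mem_nhds_iff.1 hxX
    filter_upwards [mem_nhdsWithin_of_mem_nhds (ball_mem_nhds x hr), self_mem_nhdsWithin] with y hy hyS
    have key : ∀ z ∈ X, (z - y) / (z - x) ∈ Complex.slitPlane := by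
      intro z hz
      have h1 := hne x hx z hz
      have h2 := hne y hyS z hz
      have h3 : r ≤ ‖z - x‖ := by
        by_contra h
        exact hball (by simpa [dist_eq_norm] using h) hz
      have h4 : ‖y - x‖ < r := by simpa [dist_eq_norm] using hy
      have e : (z - y) / (z - x) = 1 + (x - y) / (z - x) := by field_simp; ring
      rw [e]
      apply Complex.mem_slitPlane_of_norm_lt_one
      rw [norm_div, div_lt_one (norm_pos_iff.2 h1), norm_sub_rev x y]
      linarith
    refine ⟨fun z => -Complex.log ((z - y) / (z - x)), ?_, ?_⟩
    · refine (ContinuousOn.clog ?_ key).neg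
      exact (by fun_prop : ContinuousOn (fun z => z - y) X).div (by fun_prop) (hne x hx)
    · intro z hz
      rw [Complex.exp_neg, ← inv_div (z - y) (z - x)]
      congr 1
      exact Complex.exp_log (Complex.slitPlane_ne_zero (key z hz))
  · rintro x y z hx hy hz ⟨g, hg, hg'⟩ ⟨k, hk, hk'⟩
    refine ⟨g + k, hg.add hk, fun w hw => ?_⟩
    have := hne y hy w hw
    have := hne z hz w hw
    simp only [Pi.add_apply]
    rw [Complex.exp_add, hg' w hw, hk' w hw]
    field_simp
  · rintro x y hx hy ⟨g, hg, hg'⟩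
    refine ⟨-g, hg.neg, fun w hw => ?_⟩
    simp only [Pi.neg_apply]
    rw [Complex.exp_neg, hg' w hw, inv_div]

lemma log_unique {X : Set ℂ} (hX : IsPreconnected X) {g₁ g₂ : ℂ → ℂ}
    (h₁ : ContinuousOn g₁ X) (h₂ : ContinuousOn g₂ X)
    (h : ∀ z ∈ X, Complex.exp (g₁ z) = Complex.exp (g₂ z)) {x y : ℂ} (hx : x ∈ X) (hy : y ∈ X) :
    g₁ x - g₂ x = g₁ y - g₂ y := by
  have hc : ContinuousOn (fun z => (g₁ z - g₂ z) / (2 * Real.pi * Complex.I)) X :=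
    (h₁.sub h₂).div_const _
  have hpi : (2 * Real.pi * Complex.I : ℂ) ≠ 0 := Complex.two_pi_I_ne_zero
  have hint : ∀ z ∈ X, ∃ n : ℤ, (g₁ z - g₂ z) / (2 * Real.pi * Complex.I) = n := by
    intro z hz
    obtain ⟨n, hn⟩ := Complex.exp_eq_exp_iff_exists_int.1 (h z hz)
    exact ⟨n, by rw [hn]; field_simp; ring⟩
  have hmaps : MapsTo (fun z => ((g₁ z - g₂ z) / (2 * Real.pi * Complex.I)).re) X
      (range ((↑) : ℤ → ℝ)) := by
    intro z hz
    obtain ⟨n, hn⟩ := hint z hz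
    exact ⟨n, by simp only [hn]; simp⟩
  have hre : ContinuousOn (fun z => ((g₁ z - g₂ z) / (2 * Real.pi * Complex.I)).re) X :=
    Complex.continuous_re.comp_continuousOn hc
  have hdisc : IsDiscrete (range ((↑) : ℤ → ℝ)) :=
    Int.isClosedEmbedding_coe_real.isEmbedding.isDiscrete_range
  have := hX.constant_of_mapsTo (T := range ((↑) : ℤ → ℝ)) hdisc
    hre hmaps hx hy
  obtain ⟨n, hn⟩ := hint x hx
  obtain ⟨m, hm⟩ := hint y hy
  simp only [hn, hm, Complex.intCast_re, Int.cast_inj] at this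
  rw [← this, ← hn] at hm
  exact ((div_left_inj' hpi).1 hm).symm

lemma log_glue {X₁ X₂ : Set ℂ} (c₁ : IsClosed X₁) (c₂ : IsClosed X₂)
    (hX : IsPreconnected (X₁ ∩ X₂)) {g₁ g₂ h : ℂ → ℂ}
    (h₁ : ContinuousOn g₁ X₁) (h₂ : ContinuousOn g₂ X₂)
    (e₁ : ∀ z ∈ X₁, Complex.exp (g₁ z) = h z) (e₂ : ∀ z ∈ X₂, Complex.exp (g₂ z) = h z) :
    ∃ g : ℂ → ℂ, ContinuousOn g (X₁ ∪ X₂) ∧ ∀ z ∈ X₁ ∪ X₂, Complex.exp (g z) = h z := by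
  classical
  obtain ⟨k, hk1, hk⟩ : ∃ k : ℂ, Complex.exp k = 1 ∧ ∀ z ∈ X₁ ∩ X₂, g₁ z = g₂ z + k := by
    rcases (X₁ ∩ X₂).eq_empty_or_nonempty with h0 | ⟨x, hx⟩
    · exact ⟨0, by simp, by simp [h0]⟩
    · refine ⟨g₁ x - g₂ x, ?_, fun z hz => ?_⟩
      · rw [Complex.exp_sub, e₁ x hx.1, e₂ x hx.2]
        exact div_self (by rw [← e₁ x hx.1]; exact Complex.exp_ne_zero _)
      · have := log_unique hX (h₁.mono inter_subset_left) (h₂.mono inter_subset_right)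
          (fun z hz => by rw [e₁ z hz.1, e₂ z hz.2]) hx hz
        rw [this]; ring
  refine ⟨fun z => if z ∈ X₁ then g₁ z else g₂ z + k, ?_, ?_⟩
  · apply ContinuousOn.union_of_isClosed _ _ c₁ c₂
    · exact h₁.congr fun z hz => by simp [hz]
    · refine (h₂.add_const k).congr fun z hz => ?_
      by_cases hz1 : z ∈ X₁
      · simp [hz1, hk z ⟨hz1, hz⟩]
      · simp [hz1]
  · intro z hz
    by_cases hz1 : z ∈ X₁
    · simp [hz1, e₁ z hz1]
    · simp [hz1, Complex.exp_add, hk1, e₂ z (hz.resolve_left hz1)]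

lemma log_extend {Z : Set ℂ} (cZ : IsClosed Z) {p q : ℂ} {g : ℂ → ℂ} (hg : ContinuousOn g Z)
    (e : ∀ z ∈ Z, Complex.exp (g z) = (z - p) / (z - q)) :
    ∃ O : Set ℂ, IsOpen O ∧ Z ⊆ O ∧ ∃ k : ℂ → ℂ, ContinuousOn k O ∧
      ∀ z ∈ O, Complex.exp (k z) = (z - p) / (z - q) := by
  obtain ⟨G, hG⟩ := ContinuousMap.exists_restrict_eq cZ
    ⟨Z.domRestrict g, continuousOn_iff_continuous_domRestrict.1 hg⟩
  have hG' : ∀ z ∈ Z, G z = g z := fun z hz => by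
    have := congrArg (fun k => k ⟨z, hz⟩) hG
    exact this
  set R : ℂ → ℂ := fun z => Complex.exp (-G z) * ((z - p) / (z - q)) with hR
  have hRc : ContinuousOn R {z | z ≠ q} := by
    refine ContinuousOn.mul (by fun_prop) ?_
    exact (by fun_prop : ContinuousOn (fun z => z - p) _).div (by fun_prop) 
      (fun z hz => sub_ne_zero.2 hz)
  have ho : IsOpen {z : ℂ | z ≠ q} := isOpen_ne
  refine ⟨{z | z ≠ q} ∩ R ⁻¹' Complex.slitPlane, 
    hRc.isOpen_inter_preimage ho Complex.isOpen_slitPlane, ?_, 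
    fun z => G z + Complex.log (R z), ?_, ?_⟩
  · intro z hz
    have h0 := Complex.exp_ne_zero (g z)
    refine ⟨?_, ?_⟩
    · rintro rfl
      rw [e z hz] at h0; simp at h0
    · rw [mem_preimage, hR]; simp only
      rw [hG' z hz, ← e z hz, ← Complex.exp_add]; simp
  · refine ContinuousOn.add (by fun_prop) (ContinuousOn.clog (hRc.mono inter_subset_left) 
      fun z hz => hz.2)
  · intro z hz
    rw [Complex.exp_add, Complex.exp_log (Complex.slitPlane_ne_zero hz.2), hR]
    simp only
    rw [← mul_assoc, ← Complex.exp_add]; simp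

/-- the winding lemma -/
lemma winding {X Z : Set ℂ} (hX : IsPreconnected X) (hZ : IsPreconnected Z) {p₁ p₂ c c' u v : ℂ}
    (h1X : p₁ ∈ X) (h2X : p₂ ∈ X) (h1Z : p₁ ∈ Z) (h2Z : p₂ ∈ Z)
    (hXu : ∀ s ∈ X, u * (s - c) ∈ Complex.slitPlane)
    (hZu : ∀ s ∈ Z, -(u * (s - c)) ∈ Complex.slitPlane)
    (hXv : ∀ s ∈ X, v * (s - c') ∈ Complex.slitPlane)
    (hZv : ∀ s ∈ Z, v * (s - c') ∈ Complex.slitPlane)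
    (i1 : 0 < (u * (p₁ - c)).im) (i2 : (u * (p₂ - c)).im < 0)
    {g : ℂ → ℂ} (hg : ContinuousOn g (X ∪ Z))
    (e : ∀ s ∈ X ∪ Z, Complex.exp (g s) = (s - c) / (s - c')) : False := by
  have hu : u ≠ 0 := by rintro rfl; simp at i1
  have hv : v ≠ 0 := by
    rintro rfl; have := hXv p₁ h1X; simp [Complex.mem_slitPlane_iff] at this
  have a1 := log_unique hX (g₁ := g) (g₂ := fun s => Complex.log (u * (s - c)) 
      - Complex.log (v * (s - c')) - Complex.log (u / v))
    (hg.mono subset_union_left)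
    (((ContinuousOn.clog (by fun_prop) hXu).sub (ContinuousOn.clog (by fun_prop) hXv)).sub 
      continuousOn_const)
    (fun s hs => by
      have n1 := Complex.slitPlane_ne_zero (hXu s hs)
      have n2 := Complex.slitPlane_ne_zero (hXv s hs)
      rw [e s (Or.inl hs), Complex.exp_sub, Complex.exp_sub, Complex.exp_log n1, Complex.exp_log n2,
        Complex.exp_log (div_ne_zero hu hv)]
      have := right_ne_zero_of_mul n2
      field_simp) h1X h2X
  have a2 := log_unique hZ (g₁ := g) (g₂ := fun s => Complex.log (-(u * (s - c))) 
      - Complex.log (v * (s - c')) - Complex.log (-(u / v)))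
    (hg.mono subset_union_right)
    (((ContinuousOn.clog (by fun_prop) hZu).sub (ContinuousOn.clog (by fun_prop) hZv)).sub 
      continuousOn_const)
    (fun s hs => by
      have n1 := Complex.slitPlane_ne_zero (hZu s hs)
      have n2 := Complex.slitPlane_ne_zero (hZv s hs)
      rw [e s (Or.inr hs), Complex.exp_sub, Complex.exp_sub, Complex.exp_log n1, Complex.exp_log n2,
        Complex.exp_log (neg_ne_zero.2 (div_ne_zero hu hv))]
      have := right_ne_zero_of_mul n2
      field_simp) h1Z h2Z
  have b1 : Complex.log (-(u * (p₁ - c))) = Complex.log (u * (p₁ - c)) - Real.pi * Complex.I := by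
    rw [Complex.log, Complex.log, norm_neg, Complex.arg_neg_eq_arg_sub_pi_of_im_pos i1]
    push_cast; ring
  have b2 : Complex.log (-(u * (p₂ - c))) = Complex.log (u * (p₂ - c)) + Real.pi * Complex.I := by
    rw [Complex.log, Complex.log, norm_neg, Complex.arg_neg_eq_arg_add_pi_of_im_neg i2]
    push_cast; ring
  simp only [b1, b2] at a1 a2
  have : (2 * Real.pi * Complex.I : ℂ) = 0 := by linear_combination a2 - a1
  exact Complex.two_pi_I_ne_zero this





lemma deriv_ne_zero_inj {f : ℂ → ℂ} {V : Set ℂ} (hV : IsOpen V) (hd : DifferentiableOn ℂ f V)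
    (hi : InjOn f V) {c : ℂ} (hc : c ∈ V) : deriv f c ≠ 0 := by
  have hVc : V ∈ 𝓝 c := hV.mem_nhds hc
  have han : AnalyticAt ℂ (fun s => f s - f c) c := (hd.analyticAt hVc).sub analyticAt_const
  have hne : ¬ ∀ᶠ s in 𝓝 c, f s - f c = 0 := by
    intro h
    have h2 : ∀ᶠ s in 𝓝 c, s = c := by
      filter_upwards [h, hVc] with s hs hsV
      exact hi hsV hc (sub_eq_zero.1 hs)
    haveI := NormedField.nhdsNE_neBot c
    have h4 : ∀ᶠ s in 𝓝[≠] c, False := by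
      filter_upwards [mem_nhdsWithin_of_mem_nhds h2, self_mem_nhdsWithin] with s a b using b a
    exact h4.exists.elim fun _ h => h
  obtain ⟨n, g, hg, hgc, hfg⟩ := (han.exists_eventuallyEq_pow_smul_nonzero_iff).2 hne
  have hn0 : n ≠ 0 := by
    rintro rfl
    have := hfg.self_of_nhds
    simp at this
    exact hgc this.symm
  by_cases hn1 : n = 1
  · subst hn1
    have h1 : HasDerivAt (fun s => (s - c) * g s) (1 * g c + (c - c) * deriv g c) c :=
      ((hasDerivAt_id c).sub_const c).mul hg.differentiableAt.hasDerivAt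
    have h2 : HasDerivAt (fun s => f s - f c) (g c) c := by
      have h0 : (fun s => f s - f c) =ᶠ[𝓝 c] fun s => (s - c) * g s := by
        filter_upwards [hfg] with s hs; simpa using hs
      have := h1.congr_of_eventuallyEq h0
      simpa using this
    have h3 : HasDerivAt f (g c) c := by simpa using h2.add_const (f c)
    rwa [h3.deriv]
  · exfalso
    have hnC : (n : ℂ) ≠ 0 := by exact_mod_cast hn0
    set k : ℂ → ℂ := fun s => (s - c) * Complex.exp (Complex.log (g s / g c) / n) with hk
    have hq : AnalyticAt ℂ (fun s => g s / g c) c := hg.div analyticAt_const hgc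
    have hlog : AnalyticAt ℂ (fun s => Complex.log (g s / g c)) c :=
      hq.clog (by simp [div_self hgc])
    have hm : AnalyticAt ℂ (fun s => Complex.exp (Complex.log (g s / g c) / n)) c :=
      (hlog.div analyticAt_const hnC).cexp
    have hka : AnalyticAt ℂ k c := (analyticAt_id.sub analyticAt_const).mul hm
    have hkd : HasDerivAt k 1 c := by
      have := ((hasDerivAt_id c).sub_const c).mul hm.differentiableAt.hasDerivAt
      have h9 := this.congr_deriv (g' := 1) (by simp [div_self hgc])
      exact h9
    have hks : HasStrictDerivAt k 1 c := by
      have := hka.hasStrictDerivAt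
      rwa [hkd.deriv] at this
    have hmap := hks.map_nhds_eq one_ne_zero
    have hkc : k c = 0 := by simp [hk]
    have hgne : ∀ᶠ s in 𝓝 c, g s ≠ 0 := hg.continuousAt.eventually_ne hgc
    set W : Set ℂ := {s | f s - f c = (s - c) ^ n • g s ∧ g s ≠ 0 ∧ s ∈ V} with hW
    have hWn : W ∈ 𝓝 c := hfg.and (hgne.and hVc)
    have hkn : ∀ s ∈ W, f s - f c = g c * k s ^ n := by
      rintro s ⟨h1, h2, -⟩
      rw [h1, hk]
      simp only
      rw [mul_pow, ← Complex.exp_nat_mul, mul_div_cancel₀ _ hnC, Complex.exp_log (div_ne_zero h2 hgc),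
        smul_eq_mul]
      field_simp
    have him : k '' W ∈ 𝓝 (0 : ℂ) := by
      rw [← hkc, ← hmap]; exact image_mem_map hWn
    set ω : ℂ := Complex.exp (2 * Real.pi * Complex.I / n) with hω
    have hpr : IsPrimitiveRoot ω n := Complex.isPrimitiveRoot_exp n hn0
    have hω1 : ω ≠ 1 := hpr.ne_one (by omega)
    have him2 : ∀ᶠ y in 𝓝 (0 : ℂ), ω * y ∈ k '' W := by
      have : Tendsto (fun y => ω * y) (𝓝 0) (𝓝 0) := by
        have := (continuous_const_mul ω).tendsto (0 : ℂ)
        simpa using this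
      exact this him
    have h5 : ∀ᶠ y in 𝓝[≠] (0 : ℂ), y ∈ k '' W ∧ ω * y ∈ k '' W ∧ y ≠ 0 := by
      filter_upwards [mem_nhdsWithin_of_mem_nhds him, mem_nhdsWithin_of_mem_nhds him2,
        self_mem_nhdsWithin] with y a b c using ⟨a, b, c⟩
    haveI := NormedField.nhdsNE_neBot (0 : ℂ)
    obtain ⟨y, ⟨s₁, hs₁, rfl⟩, ⟨s₂, hs₂, h2⟩, hy0⟩ := h5.exists
    have e : f s₁ = f s₂ := by
      have e1 := hkn s₁ hs₁
      have e2 := hkn s₂ hs₂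
      rw [h2, mul_pow, hpr.pow_eq_one, one_mul, ← e1] at e2
      exact (sub_left_inj.1 e2).symm
    have := hi hs₁.2.2 hs₂.2.2 e
    rw [← this] at h2
    exact hω1 ((mul_eq_right₀ hy0).1 h2.symm)

lemma pullback_log {f : ℂ → ℂ} {V : Set ℂ} (hV : IsOpen V) (hVc : Convex ℝ V)
    (hd : DifferentiableOn ℂ f V) (hi : InjOn f V) {c c' : ℂ} (hc : c ∈ V) (hc' : c' ∈ V)
    {O : Set ℂ} {k : ℂ → ℂ} (hk : ContinuousOn k O)
    (e : ∀ z ∈ O, Complex.exp (k z) = (z - f c) / (z - f c'))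
    {Y : Set ℂ} (hY : Y ⊆ V) (hYO : ∀ s ∈ Y, f s ∈ O) :
    ∃ g : ℂ → ℂ, ContinuousOn g Y ∧ ∀ s ∈ Y, Complex.exp (g s) = (s - c) / (s - c') := by
  have hcont : ∀ c ∈ V, ContinuousOn (dslope f c) V := fun c hc =>
    (continuousOn_dslope (hV.mem_nhds hc)).2 ⟨hd.continuousOn, hd.differentiableAt (hV.mem_nhds hc)⟩
  have hnz : ∀ c ∈ V, ∀ s ∈ V, dslope f c s ≠ 0 := by
    intro c hc s hs
    by_cases h : s = c
    · subst h; rw [dslope_same]; exact deriv_ne_zero_inj hV hd hi hs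
    · rw [dslope_of_ne _ h, slope_def_field]
      exact div_ne_zero (sub_ne_zero.2 fun h' => h (hi hs hc h')) (sub_ne_zero.2 h)
  have hsc : IsSimplyConnected V := by
    have := hVc.contractibleSpace ⟨c, hc⟩
    unfold IsSimplyConnected
    infer_instance
  obtain ⟨l, hl, hl'⟩ := Complex.exists_continuousOn_eqOn_exp_comp hsc hV
    (g := fun s => dslope f c s / dslope f c' s) ((hcont c hc).div (hcont c' hc') (hnz c' hc'))
    (by rintro ⟨s, hs, h0⟩; exact div_ne_zero (hnz c hc s hs) (hnz c' hc' s hs) h0)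
  refine ⟨fun s => k (f s) - l s, ?_, ?_⟩
  · exact (hk.comp (hd.continuousOn.mono hY) hYO).sub (hl.mono hY)
  · intro s hs
    have h1 := e _ (hYO s hs)
    have h0 := Complex.exp_ne_zero (k (f s))
    have h2 : Complex.exp (l s) = dslope f c s / dslope f c' s := hl' (hY hs)
    have n1 : s ≠ c := by rintro rfl; rw [h1] at h0; simp at h0
    have n2 : s ≠ c' := by rintro rfl; rw [h1] at h0; simp at h0
    have m1 : f s - f c ≠ 0 := by intro h; rw [h1, h] at h0; simp at h0
    have m2 : f s - f c' ≠ 0 := by intro h; rw [h1, h] at h0; simp at h0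
    rw [Complex.exp_sub, h1, h2, dslope_of_ne _ n1, dslope_of_ne _ n2, slope_def_field,
      slope_def_field]
    have := sub_ne_zero.2 n1
    have := sub_ne_zero.2 n2
    field_simp





def Str : Set ℂ := {s | |s.im| < Real.pi / 2}
def StrM (M : ℝ) : Set ℂ := {s | M < s.re ∧ |s.im| < Real.pi / 2}

structure Setup (U : Set (OnePoint ℂ)) (F : ℂ → OnePoint ℂ) (G : OnePoint ℂ → ℂ) (M : ℝ)
    (f : ℂ → ℂ) : Prop where
  opn : IsOpen U
  inf : ∞ ∈ U
  Fc : ContinuousOn F Str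
  Fm : MapsTo F Str U
  Gc : ContinuousOn G U
  Gm : MapsTo G U Str
  GF : ∀ s ∈ Str, G (F s) = s
  FG : ∀ z ∈ U, F (G z) = z
  Ff : ∀ s ∈ StrM M, F s = ((f s : ℂ) : OnePoint ℂ)
  fd : DifferentiableOn ℂ f (StrM M)
  fb : Bornology.IsBounded (f '' StrM M)

def KK (U : Set (OnePoint ℂ)) : Set ℂ := {z | ((z : ℂ) : OnePoint ℂ) ∉ U}

lemma StrM_sub (M : ℝ) : StrM M ⊆ Str := fun _ h => h.2

lemma StrM_open (M : ℝ) : IsOpen (StrM M) :=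
  (isOpen_lt continuous_const Complex.continuous_re).inter
    (isOpen_lt Complex.continuous_im.abs continuous_const)

lemma StrM_convex (M : ℝ) : Convex ℝ (StrM M) := by
  have h : StrM M = Complex.re ⁻¹' (Ioi M) ∩ Complex.im ⁻¹' (Ioo (-(Real.pi/2)) (Real.pi/2)) := by
    ext s; simp [StrM, abs_lt]
  rw [h]
  exact ((convex_Ioi M).linear_preimage Complex.reLm).inter
    ((convex_Ioo _ _).linear_preimage Complex.imLm)

namespace Setup
variable {U : Set (OnePoint ℂ)} {F : ℂ → OnePoint ℂ} {G : OnePoint ℂ → ℂ} {M : ℝ} {f : ℂ → ℂ}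

lemma KK_closed (S : Setup U F G M f) : IsClosed (KK U) :=
  (S.opn.preimage OnePoint.continuous_coe).isClosed_compl

lemma fi (S : Setup U F G M f) : InjOn f (StrM M) := by
  intro s hs t ht h
  rw [← S.GF s hs.2, ← S.GF t ht.2, S.Ff s hs, S.Ff t ht, h]

lemma f_notK (S : Setup U F G M f) {s : ℂ} (hs : s ∈ StrM M) : f s ∉ KK U := by
  intro h; apply h; rw [← S.Ff s hs]; exact S.Fm hs.2

lemma core (S : Setup U F G M f) {N B0 S1 P : Set ℂ} (hN : IsPreconnected N) (hNc : IsClosed N)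
    (hNK : N ⊆ KK U) (hB : IsClosed B0) (hKB : KK U ∩ B0 ⊆ N) (hP : IsCompact P)
    (hPM : P ⊆ StrM M) (hS1 : IsPreconnected S1) (d1 : Disjoint S1 N) (d2 : Disjoint S1 B0)
    (d3 : ∀ s ∈ P, f s ∉ S1) {c c' : ℂ} (hc : c ∈ StrM M) (hc' : c' ∈ StrM M)
    (h1 : f c ∈ S1) (h1' : f c' ∈ S1) :
    ∃ κ : Set ℂ, IsCompact κ ∧ κ ⊆ Str ∧ ∀ Y ⊆ StrM M, (∀ s ∈ Y, s ∈ P ∨ f s ∈ B0 ∨ s ∉ κ) →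
      ∃ g : ℂ → ℂ, ContinuousOn g Y ∧ ∀ s ∈ Y, Complex.exp (g s) = (s - c) / (s - c') := by
  have hsub := (StrM_convex M).segment_subset hc hc'
  have hfc := S.fd.continuousOn
  obtain ⟨g₁, hg₁, e₁⟩ := logE (S := f '' segment ℝ c c') (X := KK U) (p := f c) (q := f c')
    ((convex_segment c c').isPreconnected.image _ (hfc.mono hsub)) S.KK_closed
    (by rw [disjoint_left]; rintro _ ⟨s, hs, rfl⟩; exact S.f_notK (hsub hs))
    ⟨c, left_mem_segment _ _ _, rfl⟩ ⟨c', right_mem_segment _ _ _, rfl⟩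
  have hfP : IsClosed (f '' P) := (hP.image_of_continuousOn (hfc.mono hPM)).isClosed
  have hHc : IsClosed (N ∪ B0 ∪ f '' P) := (hNc.union hB).union hfP
  obtain ⟨g₂, hg₂, e₂⟩ := logE (S := S1) (X := N ∪ B0 ∪ f '' P) (p := f c) (q := f c') hS1 hHc
    (by
      rw [disjoint_union_right, disjoint_union_right]
      refine ⟨⟨d1, d2⟩, ?_⟩
      rw [disjoint_right]; rintro _ ⟨s, hs, rfl⟩; exact d3 s hs) h1 h1'
  have hKH : KK U ∩ (N ∪ B0 ∪ f '' P) = N := by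
    ext z; constructor
    · rintro ⟨hz, (h | h) | ⟨s, hs, rfl⟩⟩
      · exact h
      · exact hKB ⟨hz, h⟩
      · exact absurd hz (S.f_notK (hPM hs))
    · intro h; exact ⟨hNK h, Or.inl (Or.inl h)⟩
  obtain ⟨g, hg, e⟩ := log_glue S.KK_closed hHc (by rwa [hKH]) hg₁ hg₂ e₁ e₂
  obtain ⟨O, hO, hZO, k, hk, ek⟩ := log_extend (S.KK_closed.union hHc) hg e
  have hCc : IsClosed (((↑) : ℂ → OnePoint ℂ) '' O)ᶜ :=
    (OnePoint.isOpenEmbedding_coe.isOpenMap O hO).isClosed_compl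
  have hCU : (((↑) : ℂ → OnePoint ℂ) '' O)ᶜ ⊆ U := by
    intro z hz
    by_contra h
    induction z using OnePoint.rec with
    | infty => exact h S.inf
    | coe z => exact hz ⟨z, hZO (Or.inl h), rfl⟩
  refine ⟨G '' (((↑) : ℂ → OnePoint ℂ) '' O)ᶜ, hCc.isCompact.image_of_continuousOn (S.Gc.mono hCU),
    ?_, ?_⟩
  · rintro _ ⟨z, hz, rfl⟩; exact S.Gm (hCU hz)
  · intro Y hY h
    refine pullback_log (StrM_open M) (StrM_convex M) S.fd S.fi hc hc' hk ek hY ?_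
    intro s hs
    rcases h s hs with h | h | h
    · exact hZO (Or.inr (Or.inr ⟨s, h, rfl⟩))
    · exact hZO (Or.inr (Or.inl (Or.inr h)))
    · by_contra h'
      apply h
      refine ⟨F s, ?_, S.GF s (hY hs).2⟩
      rw [S.Ff s (hY hs)]
      rintro ⟨z, hz, h2⟩
      rw [OnePoint.coe_injective h2] at hz
      exact h' hz

end Setup





open MeasureTheory in
lemma pick_pt {h : ℝ → ENNReal} (hm : Measurable h) {a b : ℝ} (hab : a < b) {e e' : ENNReal}
    (hi : ∫⁻ x in Ioo a b, h x ≤ e') (he : e' ≤ e * ENNReal.ofReal (b - a)) :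
    ∃ x ∈ Ioo a b, h x ≤ e := by
  have h0 : ENNReal.ofReal (b - a) ≠ 0 := by simpa using hab
  obtain ⟨x, hx, hx'⟩ := exists_le_setLAverage (μ := volume) (s := Ioo a b) (f := h)
    (by simpa using hab) (by simp) hm.aemeasurable
  refine ⟨x, hx, hx'.trans ?_⟩
  rw [setLAverage_eq, Real.volume_Ioo]
  exact ENNReal.div_le_of_le_mul (hi.trans he)

open MeasureTheory in
lemma area_prod (f : ℂ → ℂ) {s t : Set ℝ} (hs : MeasurableSet s) (ht : MeasurableSet t) :
    ∫⁻ x in s, ∫⁻ y in t, ‖deriv f ⟨x, y⟩‖ₑ ^ 2 = ∫⁻ z in s ×ℂ t, ‖deriv f z‖ₑ ^ 2 := by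
  have hm : Measurable fun z : ℂ => ‖deriv f z‖ₑ ^ 2 := (measurable_deriv f).enorm.pow_const 2
  have hm' : Measurable fun p : ℝ × ℝ => ‖deriv f (Complex.measurableEquivRealProd.symm p)‖ₑ ^ 2 :=
    hm.comp Complex.measurableEquivRealProd.symm.measurable
  have := setLIntegral_prod (μ := volume) (ν := volume) (s := s) (t := t) _ hm'.aemeasurable
  have h2 := Complex.volume_preserving_equiv_real_prod.setLIntegral_comp_preimage (hs.prod ht) hm'
  simp only [MeasurableEquiv.symm_apply_apply] at h2
  exact (h2.trans this).symm

open MeasureTheory in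
lemma area_prod' (f : ℂ → ℂ) {s t : Set ℝ} (hs : MeasurableSet s) (ht : MeasurableSet t) :
    ∫⁻ y in t, ∫⁻ x in s, ‖deriv f ⟨x, y⟩‖ₑ ^ 2 = ∫⁻ z in s ×ℂ t, ‖deriv f z‖ₑ ^ 2 := by
  have hm : Measurable fun z : ℂ => ‖deriv f z‖ₑ ^ 2 := (measurable_deriv f).enorm.pow_const 2
  have hm' : Measurable fun p : ℝ × ℝ => ‖deriv f (Complex.measurableEquivRealProd.symm p)‖ₑ ^ 2 :=
    hm.comp Complex.measurableEquivRealProd.symm.measurable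
  rw [← area_prod f hs ht]
  exact lintegral_lintegral_swap (f := fun y x => ‖deriv f ⟨x, y⟩‖ₑ ^ 2)
    (hm'.comp measurable_swap).aemeasurable

open MeasureTheory in
lemma line_est {γ γ' : ℝ → ℂ} {a b η : ℝ} (hab : a ≤ b) (hL : b - a ≤ 4) (hη : 0 < η)
    (hd : ∀ t ∈ Icc a b, HasDerivAt γ (γ' t) t) (hc : ContinuousOn γ' (Icc a b))
    (hi : ∫⁻ t in Ioc a b, ‖γ' t‖ₑ ^ 2 ≤ ENNReal.ofReal (η ^ 2)) : ‖γ b - γ a‖ ≤ 3 * η := by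
  have hu : uIcc a b = Icc a b := uIcc_of_le hab
  have hint : IntervalIntegrable γ' volume a b := (hu ▸ hc).intervalIntegrable
  have hint1 : IntervalIntegrable (fun t => ‖γ' t‖) volume a b := (hu ▸ hc.norm).intervalIntegrable
  have hint2 : IntervalIntegrable (fun t => ‖γ' t‖ ^ 2) volume a b :=
    (hu ▸ hc.norm.pow 2).intervalIntegrable
  rw [← intervalIntegral.integral_eq_sub_of_hasDerivAt (fun t ht => hd t (hu ▸ ht)) hint]
  have h2 : ∫ t in a..b, ‖γ' t‖ ^ 2 ≤ η ^ 2 := by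
    rw [intervalIntegral.integral_of_le hab]
    rw [intervalIntegrable_iff_integrableOn_Ioc_of_le hab] at hint2
    have := ofReal_integral_eq_lintegral_ofReal hint2 (ae_of_all _ fun t => by positivity)
    rw [← ENNReal.ofReal_le_ofReal_iff (by positivity), this]
    refine le_trans (le_of_eq ?_) hi
    refine lintegral_congr fun t => ?_
    rw [ENNReal.ofReal_pow (norm_nonneg _), ofReal_norm]
  calc ‖∫ t in a..b, γ' t‖ ≤ ∫ t in a..b, ‖γ' t‖ := intervalIntegral.norm_integral_le_integral_norm hab
    _ ≤ ∫ t in a..b, (η / 2 + ‖γ' t‖ ^ 2 * (1 / (2 * η))) := by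
      refine intervalIntegral.integral_mono_on hab hint1
        (intervalIntegrable_const.add (hint2.mul_const _)) fun t _ => ?_
      rw [← sub_nonneg]
      have : η / 2 + ‖γ' t‖ ^ 2 * (1 / (2 * η)) - ‖γ' t‖ = (‖γ' t‖ - η) ^ 2 / (2 * η) := by
        field_simp; ring
      rw [this]; positivity
    _ = (b - a) * (η / 2) + (∫ t in a..b, ‖γ' t‖ ^ 2) * (1 / (2 * η)) := by
      rw [intervalIntegral.integral_add intervalIntegrable_const (hint2.mul_const _),
        intervalIntegral.integral_const, intervalIntegral.integral_mul_const, smul_eq_mul]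
    _ ≤ 4 * (η / 2) + η ^ 2 * (1 / (2 * η)) := by gcongr
    _ ≤ 3 * η := by
      have : η ^ 2 * (1 / (2 * η)) = η / 2 := by field_simp
      rw [this]; linarith

lemma det_smulRight (a : ℂ) :
    ((ContinuousLinearMap.toSpanSingleton ℂ a : ℂ →L[ℂ] ℂ).restrictScalars ℝ).det = ‖a‖ ^ 2 := by
  rw [ContinuousLinearMap.det, ← LinearMap.det_toMatrix Complex.basisOneI, Matrix.det_fin_two]
  simp [LinearMap.toMatrix_apply, Complex.sq_norm, Complex.normSq_apply]

namespace Setup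
variable {U : Set (OnePoint ℂ)} {F : ℂ → OnePoint ℂ} {G : OnePoint ℂ → ℂ} {M : ℝ} {f : ℂ → ℂ}

open MeasureTheory

lemma area_eq (S : Setup U F G M f) {A : Set ℂ} (hA : MeasurableSet A) (hAM : A ⊆ StrM M) :
    ∫⁻ z in A, ‖deriv f z‖ₑ ^ 2 = volume (f '' A) := by
  have hd : ∀ z ∈ A, HasFDerivWithinAt f
      ((ContinuousLinearMap.toSpanSingleton ℂ (deriv f z) : ℂ →L[ℂ] ℂ).restrictScalars ℝ) A z := by
    intro z hz
    have h1 := (S.fd.differentiableAt ((StrM_open M).mem_nhds (hAM hz))).hasDerivAt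
    exact (h1.hasFDerivAt.restrictScalars ℝ).hasFDerivWithinAt
  have := lintegral_image_eq_lintegral_abs_det_fderiv_mul volume hA hd (S.fi.mono hAM) (fun _ => 1)
  simp only [lintegral_const, mul_one, one_mul, Measure.restrict_apply, MeasurableSet.univ,
    univ_inter] at this
  rw [this]
  refine lintegral_congr fun z => ?_
  rw [det_smulRight, abs_of_nonneg (by positivity), ENNReal.ofReal_pow (norm_nonneg _), ofReal_norm]

lemma StrM_anti {a b : ℝ} (h : a ≤ b) : StrM b ⊆ StrM a := fun _ hs => ⟨h.trans_lt hs.1, hs.2⟩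

lemma tail (S : Setup U F G M f) {e : ENNReal} (he : 0 < e) :
    ∃ M' ≥ M, ∫⁻ z in StrM M', ‖deriv f z‖ₑ ^ 2 ≤ e := by
  have ho : ∀ a, M ≤ a → IsOpen (f '' StrM a) := by
    intro a ha
    have hsub : StrM a ⊆ StrM M := StrM_anti ha
    rw [isOpen_iff_mem_nhds]
    rintro _ ⟨s, hs, rfl⟩
    have hn := (StrM_open M).mem_nhds (hsub hs)
    have h1 := (S.fd.analyticAt hn).hasStrictDerivAt
    rw [← h1.map_nhds_eq (deriv_ne_zero_inj (StrM_open M) S.fd S.fi (hsub hs))]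
    exact image_mem_map ((StrM_open a).mem_nhds hs)
  have ht := tendsto_measure_iInter_atTop (μ := (volume : Measure ℂ))
    (s := fun n : ℕ => f '' StrM (M + n))
    (fun n => (ho _ (by simp)).measurableSet.nullMeasurableSet)
    (fun m n h => image_mono (StrM_anti (by simpa using h)))
    ⟨0, by simpa using S.fb.measure_lt_top.ne⟩
  have h0 : ⋂ n : ℕ, f '' StrM (M + n) = ∅ := by
    rw [eq_empty_iff_forall_notMem]
    intro z hz
    rw [mem_iInter] at hz
    obtain ⟨s, hs, rfl⟩ := hz 0
    obtain ⟨n, hn⟩ := exists_nat_gt (s.re - M)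
    obtain ⟨t, ht, hts⟩ := hz n
    have := S.fi (StrM_anti (by simp) ht) (StrM_anti (by simp) hs) hts
    have h2 := ht.1
    rw [this] at h2; linarith
  rw [h0, measure_empty] at ht
  obtain ⟨n, hn⟩ := (ht.eventually (gt_mem_nhds he)).exists
  refine ⟨M + n, by simp, ?_⟩
  rw [S.area_eq (StrM_open _).measurableSet (StrM_anti (by simp))]
  exact hn.le

lemma contDeriv (S : Setup U F G M f) : ContinuousOn (deriv f) (StrM M) :=
  (S.fd.deriv (StrM_open M)).continuousOn

/-- vertical line estimate -/
lemma vert (S : Setup U F G M f) {x η : ℝ} (hx : M < x) (hη : 0 < η)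
    (h : ∫⁻ y in Ioo (-(Real.pi/2)) (Real.pi/2), ‖deriv f ⟨x, y⟩‖ₑ ^ 2 ≤ ENNReal.ofReal (η ^ 2))
    {y₁ y₂ : ℝ} (h₁ : |y₁| < Real.pi / 2) (h₂ : |y₂| < Real.pi / 2) :
    ‖f ⟨x, y₁⟩ - f ⟨x, y₂⟩‖ ≤ 3 * η := by
  wlog h12 : y₂ ≤ y₁ generalizing y₁ y₂
  · rw [norm_sub_rev]; exact this h₂ h₁ (le_of_not_ge h12)
  rw [abs_lt] at h₁ h₂
  have hmem : ∀ t ∈ Icc y₂ y₁, (⟨x, t⟩ : ℂ) ∈ StrM M := fun t ht =>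
    ⟨hx, abs_lt.2 ⟨by linarith [ht.1], by simpa using lt_of_le_of_lt ht.2 h₁.2⟩⟩
  have hlin : ∀ t : ℝ, HasDerivAt (fun t : ℝ => (⟨x, t⟩ : ℂ)) Complex.I t := by
    intro t
    have h1 : HasDerivAt (fun t : ℝ => (x : ℂ) + t * Complex.I) (1 * Complex.I) t :=
      ((Complex.ofRealCLM.hasDerivAt (x := t)).mul_const Complex.I).const_add _
    simp only [one_mul] at h1
    convert h1 using 2 with t
    apply Complex.ext <;> simp
  refine line_est (γ := fun t => f ⟨x, t⟩) (γ' := fun t => deriv f ⟨x, t⟩ * Complex.I) h12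
    (by linarith [Real.pi_lt_four]) hη ?_ ?_ ?_
  · intro t ht
    have h1 := (S.fd.differentiableAt ((StrM_open M).mem_nhds (hmem t ht))).hasDerivAt
    exact h1.comp t (hlin t)
  · exact (S.contDeriv.comp (fun t _ => (hlin t).continuousAt.continuousWithinAt) hmem).mul
      continuousOn_const
  · refine le_trans ?_ h
    simp only [enorm_mul]
    have : ‖Complex.I‖ₑ = 1 := by simp [← ofReal_norm]
    simp only [this, mul_one]
    exact lintegral_mono_set fun t ht => ⟨by linarith [ht.1], lt_of_le_of_lt ht.2 h₁.2⟩

lemma horiz (S : Setup U F G M f) {y η a b : ℝ} (hy : |y| < Real.pi / 2) (hη : 0 < η) (ha : M ≤ a)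
    (hab : b - a ≤ 4)
    (h : ∫⁻ x in Ioo a b, ‖deriv f ⟨x, y⟩‖ₑ ^ 2 ≤ ENNReal.ofReal (η ^ 2))
    {x₁ x₂ : ℝ} (h₁ : x₁ ∈ Ioo a b) (h₂ : x₂ ∈ Ioo a b) :
    ‖f ⟨x₁, y⟩ - f ⟨x₂, y⟩‖ ≤ 3 * η := by
  wlog h12 : x₂ ≤ x₁ generalizing x₁ x₂
  · rw [norm_sub_rev]; exact this h₂ h₁ (le_of_not_ge h12)
  have hmem : ∀ t ∈ Icc x₂ x₁, (⟨t, y⟩ : ℂ) ∈ StrM M := fun t ht =>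
    ⟨lt_of_lt_of_le (lt_of_le_of_lt ha h₂.1) ht.1, hy⟩
  have hlin : ∀ t : ℝ, HasDerivAt (fun t : ℝ => (⟨t, y⟩ : ℂ)) 1 t := by
    intro t
    have h1 : HasDerivAt (fun t : ℝ => (t : ℂ) + y * Complex.I) 1 t :=
      ((Complex.ofRealCLM.hasDerivAt (x := t))).add_const _
    convert h1 using 2 with t
    apply Complex.ext <;> simp
  refine line_est (γ := fun t => f ⟨t, y⟩) (γ' := fun t => deriv f ⟨t, y⟩ * 1) h12
    (by linarith [h₁.2, h₂.1]) hη ?_ ?_ ?_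
  · intro t ht
    have h1 := (S.fd.differentiableAt ((StrM_open M).mem_nhds (hmem t ht))).hasDerivAt
    exact h1.comp t (hlin t)
  · exact (S.contDeriv.comp (fun t _ => (hlin t).continuousAt.continuousWithinAt) hmem).mul
      continuousOn_const
  · refine le_trans ?_ h
    simp only [mul_one]
    exact lintegral_mono_set fun t ht => ⟨by linarith [ht.1, h₂.1], by linarith [ht.2, h₁.2]⟩

lemma AN (S : Setup U F G M f) {η : ℝ} (hη : 0 < η) :
    ∃ M' ≥ M, ∀ x > M', ∃ x' ∈ Icc x (x + 1), ∀ y : ℝ, |y| < Real.pi / 2 →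
      ‖f ⟨x', y⟩ - f ⟨x, 0⟩‖ ≤ 12 * η := by
  obtain ⟨M₀, hM₀, hT⟩ := S.tail (e := ENNReal.ofReal (η ^ 2 / 2)) (by simp; positivity)
  refine ⟨M₀ + 1, by linarith, fun x hx => ?_⟩
  have hpi := Real.pi_gt_three
  have hmz : Measurable fun p : ℝ × ℝ => ‖deriv f ⟨p.1, p.2⟩‖ₑ ^ 2 :=
    ((measurable_deriv f).enorm.pow_const 2).comp Complex.measurableEquivRealProd.symm.measurable
  have hmv : Measurable fun x : ℝ =>
      ∫⁻ y in Ioo (-(Real.pi/2)) (Real.pi/2), ‖deriv f ⟨x, y⟩‖ₑ ^ 2 :=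
    Measurable.lintegral_prod_right' (ν := volume.restrict (Ioo (-(Real.pi/2)) (Real.pi/2))) hmz
  have hmh : Measurable fun y : ℝ => ∫⁻ t in Ioo (x - 1) (x + 1), ‖deriv f ⟨t, y⟩‖ₑ ^ 2 :=
    Measurable.lintegral_prod_left' (μ := volume.restrict (Ioo (x - 1) (x + 1))) hmz
  have wall : ∀ a, M₀ ≤ a → ∃ x' ∈ Ioo a (a + 1),
      ∫⁻ y in Ioo (-(Real.pi/2)) (Real.pi/2), ‖deriv f ⟨x', y⟩‖ₑ ^ 2 ≤ ENNReal.ofReal (η ^ 2) := by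
    intro a ha
    refine pick_pt hmv (by linarith) (e' := ENNReal.ofReal (η ^ 2 / 2)) ?_ ?_
    · rw [area_prod f measurableSet_Ioo measurableSet_Ioo]
      refine (lintegral_mono_set ?_).trans hT
      rintro z ⟨h1, h2⟩
      exact ⟨lt_of_le_of_lt ha h1.1, abs_lt.2 h2⟩
    · rw [← ENNReal.ofReal_mul (by positivity)]
      apply ENNReal.ofReal_le_ofReal
      nlinarith [sq_nonneg η]
  have floor : ∀ a b : ℝ, -1 ≤ a → b ≤ 1 → b - a = 1 / 2 → ∃ y ∈ Ioo a b,
      ∫⁻ t in Ioo (x - 1) (x + 1), ‖deriv f ⟨t, y⟩‖ₑ ^ 2 ≤ ENNReal.ofReal (η ^ 2) := by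
    intro a b ha hb hab
    refine pick_pt hmh (by linarith) (e' := ENNReal.ofReal (η ^ 2 / 2)) ?_ ?_
    · rw [area_prod' f measurableSet_Ioo measurableSet_Ioo]
      refine (lintegral_mono_set ?_).trans hT
      rintro z ⟨h1, h2⟩
      exact ⟨by linarith [h1.1], abs_lt.2 ⟨by linarith [h2.1], by linarith [h2.2]⟩⟩
    · rw [hab, ← ENNReal.ofReal_mul (by positivity)]
      apply ENNReal.ofReal_le_ofReal
      linarith
  obtain ⟨x₀, hx₀, w₀⟩ := wall (x - 1) (by linarith)
  obtain ⟨x₁, hx₁, w₁⟩ := wall x (by linarith)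
  obtain ⟨y₁, hy₁, v₁⟩ := floor (1/2) 1 (by norm_num) (by norm_num) (by norm_num)
  obtain ⟨y₂, hy₂, v₂⟩ := floor (-1) (-1/2) (by norm_num) (by norm_num) (by norm_num)
  rw [sub_add_cancel] at hx₀
  have a1 : |y₁| < Real.pi / 2 := abs_lt.2 ⟨by linarith [hy₁.1], by linarith [hy₁.2]⟩
  have a2 : |y₂| < Real.pi / 2 := abs_lt.2 ⟨by linarith [hy₂.1], by linarith [hy₂.2]⟩
  have a0 : |(0:ℝ)| < Real.pi / 2 := by rw [abs_zero]; linarith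
  have m0 : M < x₀ := by linarith [hx₀.1]
  have m1 : M < x₁ := by linarith [hx₁.1]
  have mm : M ≤ x - 1 := by linarith
  have i0 : x₀ ∈ Ioo (x - 1) (x + 1) := ⟨hx₀.1, by linarith [hx₀.2]⟩
  have i1 : x₁ ∈ Ioo (x - 1) (x + 1) := ⟨by linarith [hx₁.1], hx₁.2⟩
  set p := f ⟨x₁, 0⟩ with hp
  have fl : ∀ y, y = y₁ ∨ y = y₂ → ∀ t ∈ Ioo (x - 1) (x + 1), ‖f ⟨t, y⟩ - p‖ ≤ 6 * η := by
    intro y hy t ht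
    have hy' : |y| < Real.pi / 2 := by rcases hy with rfl | rfl <;> assumption
    have hv : ∫⁻ t in Ioo (x - 1) (x + 1), ‖deriv f ⟨t, y⟩‖ₑ ^ 2 ≤ ENNReal.ofReal (η ^ 2) := by
      rcases hy with rfl | rfl <;> assumption
    have b1 := S.horiz hy' hη mm (by linarith) hv ht i1
    have b2 := S.vert m1 hη w₁ hy' a0
    calc _ ≤ ‖f ⟨t, y⟩ - f ⟨x₁, y⟩‖ + ‖f ⟨x₁, y⟩ - p‖ := norm_sub_le_norm_sub_add_norm_sub ..
      _ ≤ _ := by linarith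
  have key : ‖f ⟨x, 0⟩ - p‖ ≤ 9 * η := by
    have hcl : closure (Ioo x₀ x₁ ×ℂ Ioo y₂ y₁) = Icc x₀ x₁ ×ℂ Icc y₂ y₁ := by
      rw [Complex.closure_reProdIm, closure_Ioo (by linarith [hx₀.2, hx₁.1]),
        closure_Ioo (by linarith [hy₁.1, hy₂.2])]
    have hsub : Icc x₀ x₁ ×ℂ Icc y₂ y₁ ⊆ StrM M := by
      rintro z ⟨h1, h2⟩
      exact ⟨lt_of_lt_of_le m0 h1.1, abs_lt.2 ⟨by linarith [h2.1, hy₂.1], by linarith [h2.2, hy₁.2]⟩⟩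
    refine Complex.norm_le_of_forall_mem_frontier_norm_le (f := fun z => f z - p)
      (U := Ioo x₀ x₁ ×ℂ Ioo y₂ y₁) ?_ ?_ ?_ ?_
    · exact (Metric.isBounded_Ioo _ _).reProdIm (Metric.isBounded_Ioo _ _)
    · apply DifferentiableOn.diffContOnCl
      rw [hcl]
      exact (S.fd.mono hsub).sub_const p
    · intro z hz
      rw [Complex.frontier_reProdIm, closure_Ioo (by linarith [hx₀.2, hx₁.1]),
        closure_Ioo (by linarith [hy₁.1, hy₂.2]), frontier_Ioo (by linarith [hy₁.1, hy₂.2]),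
        frontier_Ioo (by linarith [hx₀.2, hx₁.1])] at hz
      rcases hz with ⟨h1, h2⟩ | ⟨h1, h2⟩
      · have := fl z.im (by rcases h2 with h | h; exacts [Or.inr h, Or.inl h]) z.re
          ⟨by linarith [h1.1, hx₀.1], by linarith [h1.2, hx₁.2]⟩
        simp only [Complex.eta] at this
        linarith
      · have hz' : |z.im| < Real.pi / 2 :=
          abs_lt.2 ⟨by linarith [h2.1, hy₂.1], by linarith [h2.2, hy₁.2]⟩
        rcases h1 with h | h
        · have h : z.re = x₀ := h
          have b1 := S.vert m0 hη w₀ hz' a1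
          have b2 := fl y₁ (Or.inl rfl) x₀ i0
          rw [← h, Complex.eta, h] at b1
          calc _ ≤ ‖f z - f ⟨x₀, y₁⟩‖ + ‖f ⟨x₀, y₁⟩ - p‖ := norm_sub_le_norm_sub_add_norm_sub ..
            _ ≤ _ := by linarith
        · have h : z.re = x₁ := h
          have b1 := S.vert m1 hη w₁ hz' a0
          rw [← hp, ← h, Complex.eta] at b1
          linarith
    · rw [hcl]
      exact ⟨⟨hx₀.2.le, hx₁.1.le⟩, ⟨by simp; linarith [hy₂.2], by simp; linarith [hy₁.1]⟩⟩
  refine ⟨x₁, ⟨hx₁.1.le, hx₁.2.le⟩, fun y hy => ?_⟩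
  have b1 := S.vert m1 hη w₁ hy a0
  rw [norm_sub_rev] at key
  calc _ ≤ ‖f ⟨x₁, y⟩ - p‖ + ‖p - f ⟨x, 0⟩‖ := norm_sub_le_norm_sub_add_norm_sub ..
    _ ≤ _ := by linarith

end Setup





lemma kappa_im {κ : Set ℂ} (hκ : IsCompact κ) (h : κ ⊆ Str) :
    ∃ y, 0 ≤ y ∧ y < Real.pi / 2 ∧ ∀ s ∈ κ, |s.im| ≤ y := by
  rcases κ.eq_empty_or_nonempty with rfl | hne
  · exact ⟨0, le_rfl, by positivity, by simp⟩
  · obtain ⟨s, hs, hm⟩ := hκ.exists_isMaxOn hne (f := fun s : ℂ => |s.im|)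
      Complex.continuous_im.abs.continuousOn
    exact ⟨|s.im|, abs_nonneg _, h hs, fun t ht => hm ht⟩

lemma cvxRI {A B : Set ℝ} (hA : Convex ℝ A) (hB : Convex ℝ B) : Convex ℝ (A ×ℂ B) :=
  (hA.linear_preimage Complex.reLm).inter (hB.linear_preimage Complex.imLm)

namespace Setup
variable {U : Set (OnePoint ℂ)} {F : ℂ → OnePoint ℂ} {G : OnePoint ℂ → ℂ} {M : ℝ} {f : ℂ → ℂ}

lemma path (S : Setup U F G M f) {a : ℂ} (ha : a ∈ StrM M) {z : ℂ} (hz : z ∈ KK U) {δ : ℝ}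
    (hd : f a ∈ closedBall z δ) :
    ∃ A ⊆ Str, IsPreconnected A ∧ a ∈ A ∧
      (∀ s ∈ A, ∃ w ∈ closedBall z δ, F s = ((w : ℂ) : OnePoint ℂ)) ∧
      ∀ κ : Set ℂ, IsCompact κ → κ ⊆ Str → ∃ s ∈ A, s ∉ κ := by
  set τ : ℝ → ℂ := fun t => AffineMap.lineMap (f a) z t with hτ
  have hτc : Continuous τ := AffineMap.lineMap_continuous
  have hzB : z ∈ closedBall z δ := mem_closedBall_self (dist_nonneg.trans hd)
  have hτB : ∀ t ∈ Icc (0:ℝ) 1, τ t ∈ closedBall z δ := by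
    intro t ht
    apply (convex_closedBall z δ).segment_subset hd hzB
    rw [segment_eq_image_lineMap]
    exact ⟨t, ht, rfl⟩
  set T : Set ℝ := Icc 0 1 ∩ τ ⁻¹' (KK U)
  have hT : IsCompact T := isCompact_Icc.inter_right (S.KK_closed.preimage hτc)
  obtain ⟨t₀, ht₀, hmin⟩ := hT.exists_isLeast ⟨1, ⟨by norm_num, by norm_num⟩, by simpa [τ] using hz⟩
  have hτ0 : τ 0 = f a := by simp [τ]
  have hpos : 0 < t₀ := by
    rcases ht₀.1.1.eq_or_lt with h | h
    · exfalso
      have := ht₀.2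
      rw [← h, mem_preimage, hτ0] at this
      exact S.f_notK ha this
    · exact h
  have hU : ∀ t ∈ Ico 0 t₀, ((τ t : ℂ) : OnePoint ℂ) ∈ U := by
    intro t ht
    by_contra h
    exact absurd (hmin ⟨⟨ht.1, ht.2.le.trans ht₀.1.2⟩, h⟩) (not_le.2 ht.2)
  refine ⟨(fun t => G ((τ t : ℂ) : OnePoint ℂ)) '' Ico 0 t₀, ?_, ?_, ?_, ?_, ?_⟩
  · rintro _ ⟨t, ht, rfl⟩; exact S.Gm (hU t ht)
  · exact isPreconnected_Ico.image _
      (S.Gc.comp (OnePoint.continuous_coe.comp hτc).continuousOn hU)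
  · refine ⟨0, ⟨le_rfl, hpos⟩, ?_⟩
    simp only [hτ0]
    rw [← S.Ff a ha, S.GF a ha.2]
  · rintro _ ⟨t, ht, rfl⟩
    exact ⟨τ t, hτB t ⟨ht.1, ht.2.le.trans ht₀.1.2⟩, S.FG _ (hU t ht)⟩
  · intro κ hκ hκS
    by_contra! h
    have hFκ : IsClosed (F '' κ) := (hκ.image_of_continuousOn (S.Fc.mono hκS)).isClosed
    have hcl : t₀ ∈ closure (Ico 0 t₀) := by
      rw [closure_Ico hpos.ne]; exact ⟨hpos.le, le_rfl⟩
    have hsub : Ico 0 t₀ ⊆ (fun t => ((τ t : ℂ) : OnePoint ℂ)) ⁻¹' (F '' κ) := by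
      intro t ht
      exact ⟨_, h _ ⟨t, ht, rfl⟩, S.FG _ (hU t ht)⟩
    have := closure_minimal hsub (hFκ.preimage (OnePoint.continuous_coe.comp hτc)) hcl
    obtain ⟨s, hs, hs'⟩ := this
    apply ht₀.2
    show ((τ t₀ : ℂ) : OnePoint ℂ) ∈ U
    have hs'' : F s = ((τ t₀ : ℂ) : OnePoint ℂ) := hs'
    rw [← hs'']; exact S.Fm (hκS hs)

lemma climb (S : Setup U F G M f) {z : ℂ} (hz : z ∈ KK U) {δ x₁ x₂ : ℝ} (hx₁ : M < x₁)
    (w₁ : ∀ s ∈ Str, s.re = x₁ → f s ∉ closedBall z δ)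
    (w₂ : ∀ s ∈ Str, s.re = x₂ → f s ∉ closedBall z δ)
    (ax : ∀ x : ℝ, x₁ ≤ x → f ⟨x, 0⟩ ∉ closedBall z δ)
    {a : ℂ} (haS : a ∈ Str) (ha₁ : x₁ < a.re) (ha₂ : a.re < x₂) (ha0 : 0 ≤ a.im)
    (hfa : f a ∈ closedBall z δ) :
    ∃ A : Set ℂ, IsPreconnected A ∧ a ∈ A ∧
      (∀ s ∈ A, x₁ < s.re ∧ s.re < x₂ ∧ 0 < s.im ∧ s ∈ StrM M) ∧ (∀ s ∈ A, f s ∈ closedBall z δ) ∧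
      ∀ y < Real.pi / 2, ∃ s ∈ A, y < s.im := by
  obtain ⟨A, hAS, hAp, haA, hAB, hAk⟩ := S.path (a := a) ⟨hx₁.trans ha₁, haS⟩ hz hfa
  have hAB' : ∀ s ∈ A, M < s.re → f s ∈ closedBall z δ := by
    intro s hs hM
    obtain ⟨w, hw, h⟩ := hAB s hs
    rw [S.Ff s ⟨hM, hAS hs⟩] at h
    rwa [OnePoint.coe_injective h]
  have hne : ∀ s ∈ A, x₁ ≤ s.re → s.im ≠ 0 := by
    intro s hs h h0
    apply ax s.re h
    have : (⟨s.re, 0⟩ : ℂ) = s := by apply Complex.ext <;> simp [h0]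
    rw [this]; exact hAB' s hs (by linarith)
  have ha0' : 0 < a.im := lt_of_le_of_ne ha0 (Ne.symm (hne a haA ha₁.le))
  have hsub : A ⊆ Ioo x₁ x₂ ×ℂ Ioi 0 := by
    refine hAp.subset_of_closure_inter_subset (isOpen_Ioo.reProdIm isOpen_Ioi)
      ⟨a, haA, ⟨ha₁, ha₂⟩, ha0'⟩ ?_
    rintro s ⟨h, hs⟩
    rw [Complex.closure_reProdIm, closure_Ioo (ha₁.trans ha₂).ne, closure_Ioi] at h
    obtain ⟨⟨h1, h2⟩, h3⟩ := h
    have hM : M < s.re := lt_of_lt_of_le hx₁ h1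
    exact ⟨⟨lt_of_le_of_ne h1 fun e => w₁ s (hAS hs) e.symm (hAB' s hs hM),
      lt_of_le_of_ne h2 fun e => w₂ s (hAS hs) e (hAB' s hs hM)⟩,
      lt_of_le_of_ne h3 (Ne.symm (hne s hs h1))⟩
  have hsub' : ∀ s ∈ A, x₁ < s.re ∧ s.re < x₂ ∧ 0 < s.im ∧ s ∈ StrM M := fun s hs =>
    ⟨(hsub hs).1.1, (hsub hs).1.2, (hsub hs).2, hx₁.trans (hsub hs).1.1, hAS hs⟩
  refine ⟨A, hAp, haA, hsub', fun s hs => hAB' s hs (hsub' s hs).2.2.2.1, fun y hy => ?_⟩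
  obtain ⟨s, hs, hsk⟩ := hAk (Icc x₁ x₂ ×ℂ Icc 0 y) (isCompact_Icc.reProdIm isCompact_Icc) (by
    rintro s ⟨-, h1, h2⟩
    have h1 : 0 ≤ s.im := h1
    have h2 : s.im ≤ y := h2
    show |s.im| < Real.pi / 2
    exact abs_lt.2 ⟨by linarith [Real.pi_pos], by linarith⟩)
  refine ⟨s, hs, ?_⟩
  by_contra h
  obtain ⟨h1, h2, h3, -⟩ := hsub' s hs
  exact hsk ⟨⟨h1.le, h2.le⟩, ⟨h3.le, not_lt.1 h⟩⟩

lemma case1 (S : Setup U F G M f) {z₀ z₁ : ℂ} {δ : ℝ} {N : Set ℂ} (hN : IsPreconnected N)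
    (hNc : IsClosed N) (hNK : N ⊆ KK U) (hKB : KK U ∩ closedBall z₀ δ ⊆ N)
    (d1 : Disjoint (closedBall z₁ δ) N) (d2 : Disjoint (closedBall z₁ δ) (closedBall z₀ δ))
    (hw : ∀ R : ℝ, ∃ x' > R, ∀ s ∈ Str, s.re = x' → f s ∈ closedBall z₀ δ)
    (hc : ∀ R : ℝ, ∃ c ∈ Str, R < c.re ∧ 0 ≤ c.im ∧ f c ∈ closedBall z₁ δ) : False := by
  obtain ⟨c', hc'S, hc'M, -, hc'B⟩ := hc M
  obtain ⟨x', hx', hxw⟩ := hw c'.re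
  obtain ⟨c, hcS, hcx, -, hcB⟩ := hc x'
  have hMx : M < x' := hc'M.trans hx'
  obtain ⟨κ, hκ, hκS, hY⟩ := S.core (P := ∅) hN hNc hNK isClosed_closedBall hKB isCompact_empty
    (empty_subset _) (convex_closedBall z₁ δ).isPreconnected d1 d2 (by simp)
    (c := c) (c' := c') ⟨hMx.trans hcx, hcS⟩ ⟨hc'M, hc'S⟩ hcB hc'B
  obtain ⟨y, hy0, hy, hyκ⟩ := kappa_im hκ hκS
  obtain ⟨R, hR⟩ := hκ.isBounded.subset_closedBall 0
  have hRk : ∀ s ∈ κ, s.re ≤ R := fun s hs =>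
    (Complex.re_le_norm s).trans (by simpa using hR hs)
  have hcS' : |c.im| < Real.pi / 2 := hcS
  obtain ⟨y₀, hy₀, hy₀'⟩ := exists_between (max_lt hy hcS')
  obtain ⟨hyy, hcy⟩ := max_lt_iff.1 hy₀
  set R' := max R c.re + 1 with hR'
  have r1 : R < R' := by have := le_max_left R c.re; linarith
  have r2 : c.re < R' := by have := le_max_right R c.re; linarith
  have hy₀0 : 0 < y₀ := lt_of_le_of_lt hy0 hyy
  set X : Set ℂ := {x'} ×ℂ Icc (-y₀) y₀ with hX
  set Z : Set ℂ := (Icc x' R' ×ℂ {-y₀} ∪ {R'} ×ℂ Icc (-y₀) y₀) ∪ Icc x' R' ×ℂ {y₀} with hZ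
  have hxR : x' ≤ R' := by linarith
  have hXp : IsPreconnected X := (cvxRI (convex_singleton _) (convex_Icc _ _)).isPreconnected
  have hZp : IsPreconnected Z := by
    refine IsPreconnected.union' ⟨⟨R', y₀⟩, ?_, ?_⟩ (IsPreconnected.union' ⟨⟨R', -y₀⟩, ?_, ?_⟩ ?_ ?_) ?_
    · exact Or.inr ⟨rfl, ⟨by simp; linarith, le_rfl⟩⟩
    · exact ⟨⟨hxR, le_rfl⟩, rfl⟩
    · exact ⟨⟨hxR, le_rfl⟩, rfl⟩
    · exact ⟨rfl, ⟨le_rfl, by simp; linarith⟩⟩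
    · exact (cvxRI (convex_Icc _ _) (convex_singleton _)).isPreconnected
    · exact (cvxRI (convex_singleton _) (convex_Icc _ _)).isPreconnected
    · exact (cvxRI (convex_Icc _ _) (convex_singleton _)).isPreconnected
  have hXd : ∀ s ∈ X, s.re = x' ∧ -y₀ ≤ s.im ∧ s.im ≤ y₀ := fun s hs => ⟨hs.1, hs.2.1, hs.2.2⟩
  have hZd : ∀ s ∈ Z, x' ≤ s.re ∧ -y₀ ≤ s.im ∧ s.im ≤ y₀ ∧ (s.im = -y₀ ∨ s.re = R' ∨ s.im = y₀) := by
    rintro s ((⟨h1, h2⟩ | ⟨h1, h2⟩) | ⟨h1, h2⟩)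
    · have h2 : s.im = -y₀ := h2
      exact ⟨h1.1, h2.ge, by linarith, Or.inl h2⟩
    · have h1 : s.re = R' := h1
      exact ⟨by linarith, h2.1, h2.2, Or.inr (Or.inl h1)⟩
    · have h2 : s.im = y₀ := h2
      exact ⟨h1.1, by linarith, h2.le, Or.inr (Or.inr h2)⟩
  have hYM : X ∪ Z ⊆ StrM M := by
    rintro s (hs | hs)
    · obtain ⟨h1, h2, h3⟩ := hXd s hs
      exact ⟨by linarith, abs_lt.2 ⟨by linarith, by linarith⟩⟩
    · obtain ⟨h1, h2, h3, -⟩ := hZd s hs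
      exact ⟨by linarith, abs_lt.2 ⟨by linarith, by linarith⟩⟩
  obtain ⟨g, hg, e⟩ := hY (X ∪ Z) hYM (by
    rintro s (hs | hs)
    · exact Or.inr (Or.inl (hxw s (hYM (Or.inl hs)).2 (hXd s hs).1))
    · refine Or.inr (Or.inr fun hk => ?_)
      have b1 := abs_le.1 (hyκ s hk)
      have b2 := hRk s hk
      rcases (hZd s hs).2.2.2 with h | h | h <;> linarith [b1.1, b1.2])
  have hcy' := abs_lt.1 hcy
  refine winding (p₁ := ⟨x', -y₀⟩) (p₂ := ⟨x', y₀⟩) (u := -1) (v := 1) hXp hZp ?_ ?_ ?_ ?_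
    ?_ ?_ ?_ ?_ ?_ ?_ hg e
  · exact ⟨rfl, ⟨le_rfl, by simp; linarith⟩⟩
  · exact ⟨rfl, ⟨by simp; linarith, le_rfl⟩⟩
  · exact Or.inl (Or.inl ⟨⟨le_rfl, hxR⟩, rfl⟩)
  · exact Or.inr ⟨⟨le_rfl, hxR⟩, rfl⟩
  · intro s hs
    refine Or.inl ?_
    have := (hXd s hs).1
    simp; linarith
  · intro s hs
    rcases (hZd s hs).2.2.2 with h | h | h
    · refine Or.inr ?_
      simp [h]; intro h'; linarith [hcy'.1, hcy'.2]
    · refine Or.inl ?_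
      simp [h]; linarith
    · refine Or.inr ?_
      simp [h]; intro h'; linarith [hcy'.1, hcy'.2]
  · intro s hs
    refine Or.inl ?_
    have := (hXd s hs).1
    simp; linarith
  · intro s hs
    refine Or.inl ?_
    have := (hZd s hs).1
    simp; linarith
  · simp; linarith [hcy'.1]
  · simp; linarith [hcy'.2]

lemma case2 (S : Setup U F G M f) {z₀ z₁ : ℂ} {δ M₁ : ℝ} {N : Set ℂ} (hN : IsPreconnected N)
    (hz₀ : z₀ ∈ KK U) (hz₁ : z₁ ∈ KK U)
    (hNc : IsClosed N) (hNK : N ⊆ KK U) (hKB : KK U ∩ closedBall z₀ δ ⊆ N)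
    (d1 : Disjoint (closedBall z₁ δ) N) (d2 : Disjoint (closedBall z₁ δ) (closedBall z₀ δ))
    (hM₁ : M ≤ M₁) (ax₀ : ∀ x > M₁, f ⟨x, 0⟩ ∉ closedBall z₀ δ)
    (ax₁ : ∀ x > M₁, f ⟨x, 0⟩ ∉ closedBall z₁ δ)
    (hw : ∀ R : ℝ, ∃ x' > R, ∀ s ∈ Str, s.re = x' → f s ∉ closedBall z₀ δ ∧ f s ∉ closedBall z₁ δ)
    (hg : ∀ R : ℝ, ∃ a ∈ Str, R < a.re ∧ 0 ≤ a.im ∧ f a ∈ closedBall z₀ δ ∧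
      ∀ y ∈ Icc 0 a.im, f ⟨a.re, y⟩ ∉ closedBall z₁ δ)
    (hc : ∀ R : ℝ, ∃ c ∈ Str, R < c.re ∧ 0 ≤ c.im ∧ f c ∈ closedBall z₁ δ) : False := by
  obtain ⟨x₁, hx₁, w₁⟩ := hw M₁
  obtain ⟨a, haS, ha, ha0, haB, haP⟩ := hg x₁
  obtain ⟨x₂, hx₂, w₂⟩ := hw a.re
  obtain ⟨b, hbS, hb, hb0, hbB⟩ := hc x₂
  obtain ⟨x₃, hx₃, w₃⟩ := hw b.re
  obtain ⟨a', haS', ha', ha0', haB', haP'⟩ := hg x₃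
  obtain ⟨x₄, hx₄, w₄⟩ := hw a'.re
  obtain ⟨b', hbS', hb', hb0', hbB'⟩ := hc x₄
  obtain ⟨x₅, hx₅, w₅⟩ := hw b'.re
  obtain ⟨A, hAp, haA, hAs, hAB, hAy⟩ := S.climb hz₀ (x₁ := x₁) (x₂ := x₂) (by linarith)
    (fun s h e => (w₁ s h e).1) (fun s h e => (w₂ s h e).1) (fun x h => ax₀ x (by linarith))
    haS ha hx₂ ha0 haB
  obtain ⟨A', hAp', haA', hAs', hAB', hAy'⟩ := S.climb hz₀ (x₁ := x₃) (x₂ := x₄) (by linarith)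
    (fun s h e => (w₃ s h e).1) (fun s h e => (w₄ s h e).1) (fun x h => ax₀ x (by linarith))
    haS' ha' hx₄ ha0' haB'
  obtain ⟨C, -, -, hCs, hCB, hCy⟩ := S.climb hz₁ (x₁ := x₂) (x₂ := x₃) (by linarith)
    (fun s h e => (w₂ s h e).2) (fun s h e => (w₃ s h e).2) (fun x h => ax₁ x (by linarith))
    hbS hb hx₃ hb0 hbB
  obtain ⟨C', -, -, hCs', hCB', hCy'⟩ := S.climb hz₁ (x₁ := x₄) (x₂ := x₅) (by linarith)
    (fun s h e => (w₄ s h e).2) (fun s h e => (w₅ s h e).2) (fun x h => ax₁ x (by linarith))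
    hbS' hb' hx₅ hb0' hbB'
  have pa : a.im < Real.pi / 2 := (le_abs_self _).trans_lt haS
  have pa' : a'.im < Real.pi / 2 := (le_abs_self _).trans_lt haS'
  obtain ⟨c, hcC, hcy⟩ := hCy _ (max_lt pa pa')
  obtain ⟨c', hcC', hcy'⟩ := hCy' _ (max_lt pa pa')
  obtain ⟨hc1, hc2⟩ := max_lt_iff.1 hcy
  obtain ⟨hc1', hc2'⟩ := max_lt_iff.1 hcy'
  obtain ⟨cx, cx', cy, cM⟩ := hCs c hcC
  obtain ⟨dx, dx', dy, dM⟩ := hCs' c' hcC'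
  have pi0 := Real.pi_pos
  have haa : a.re ≤ a'.re := by linarith
  set P : Set ℂ := ({a.re} ×ℂ Icc 0 a.im ∪ Icc a.re a'.re ×ℂ {0}) ∪ {a'.re} ×ℂ Icc 0 a'.im with hP
  have hPc : IsCompact P := ((isCompact_singleton.reProdIm isCompact_Icc).union
    (isCompact_Icc.reProdIm isCompact_singleton)).union
    (isCompact_singleton.reProdIm isCompact_Icc)
  have hPp : IsPreconnected P := by
    refine IsPreconnected.union' ⟨⟨a'.re, 0⟩, ?_, ?_⟩
      (IsPreconnected.union' ⟨⟨a.re, 0⟩, ?_, ?_⟩ ?_ ?_) ?_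
    · exact Or.inr ⟨⟨haa, le_rfl⟩, rfl⟩
    · exact ⟨rfl, ⟨le_rfl, ha0'⟩⟩
    · exact ⟨rfl, ⟨le_rfl, ha0⟩⟩
    · exact ⟨⟨le_rfl, haa⟩, rfl⟩
    · exact (cvxRI (convex_singleton _) (convex_Icc _ _)).isPreconnected
    · exact (cvxRI (convex_Icc _ _) (convex_singleton _)).isPreconnected
    · exact (cvxRI (convex_singleton _) (convex_Icc _ _)).isPreconnected
  have hPd : ∀ s ∈ P, a.re ≤ s.re ∧ s.re ≤ a'.re ∧ 0 ≤ s.im ∧ s.im < c.im ∧ s.im < c'.im ∧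
      s ∈ StrM M ∧ f s ∉ closedBall z₁ δ := by
    rintro s ((⟨h1, h2⟩ | ⟨h1, h2⟩) | ⟨h1, h2⟩)
    · have h1 : s.re = a.re := h1
      refine ⟨h1.ge, by linarith, h2.1, by linarith [h2.2], by linarith [h2.2],
        ⟨by linarith, abs_lt.2 ⟨by linarith [h2.1], by linarith [h2.2]⟩⟩, ?_⟩
      have := haP s.im h2
      rwa [← h1, Complex.eta] at this
    · have h2 : s.im = 0 := h2
      refine ⟨h1.1, h1.2, h2.ge, by linarith, by linarith,
        ⟨by linarith [h1.1], abs_lt.2 ⟨by linarith, by linarith⟩⟩, ?_⟩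
      have := ax₁ s.re (by linarith [h1.1])
      rwa [← h2, Complex.eta] at this
    · have h1 : s.re = a'.re := h1
      refine ⟨by linarith, h1.le, h2.1, by linarith [h2.2], by linarith [h2.2],
        ⟨by linarith, abs_lt.2 ⟨by linarith [h2.1], by linarith [h2.2]⟩⟩, ?_⟩
      have := haP' s.im h2
      rwa [← h1, Complex.eta] at this
  obtain ⟨κ, hκ, hκS, hY⟩ := S.core (P := P) hN hNc hNK isClosed_closedBall hKB hPc
    (fun s hs => (hPd s hs).2.2.2.2.2.1) (convex_closedBall z₁ δ).isPreconnected d1 d2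
    (fun s hs => (hPd s hs).2.2.2.2.2.2)
    (c := c) (c' := c') cM dM (hCB c hcC) (hCB' c' hcC')
  obtain ⟨y, hy0, hy, hyκ⟩ := kappa_im hκ hκS
  have hm : max y c.im < Real.pi / 2 := max_lt hy ((le_abs_self _).trans_lt cM.2)
  obtain ⟨p₂, hp₂, hp₂y⟩ := hAy _ hm
  obtain ⟨p₁, hp₁, hp₁y⟩ := hAy' _ hm
  obtain ⟨q1, q2⟩ := max_lt_iff.1 hp₂y
  obtain ⟨q1', q2'⟩ := max_lt_iff.1 hp₁y
  have hp₁s := hAs' p₁ hp₁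
  have hp₂s := hAs p₂ hp₂
  set Z := segment ℝ p₁ p₂ with hZ
  have hZM : Z ⊆ StrM M := (StrM_convex M).segment_subset hp₁s.2.2.2 hp₂s.2.2.2
  have hZd : ∀ s ∈ Z, s.re < x₄ ∧ max y c.im < s.im := by
    intro s hs
    have hcv : Convex ℝ (Iio x₄ ×ℂ Ioi (max y c.im)) := cvxRI (convex_Iio _) (convex_Ioi _)
    exact hcv.segment_subset (x := p₁) (y := p₂) ⟨hp₁s.2.1, hp₁y⟩
      ⟨show p₂.re < x₄ by linarith [hp₂s.2.1], hp₂y⟩ hs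
  set X := (A ∪ P) ∪ A' with hX
  have hXp : IsPreconnected X := by
    refine IsPreconnected.union' ⟨a', ?_, haA'⟩ (IsPreconnected.union' ⟨a, haA, ?_⟩ hAp hPp) hAp'
    · exact Or.inr (Or.inr ⟨rfl, ⟨ha0', le_rfl⟩⟩)
    · exact Or.inl (Or.inl ⟨rfl, ⟨ha0, le_rfl⟩⟩)
  have hYM : X ∪ Z ⊆ StrM M := by
    rintro s (((hs | hs) | hs) | hs)
    · exact (hAs s hs).2.2.2
    · exact (hPd s hs).2.2.2.2.2.1
    · exact (hAs' s hs).2.2.2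
    · exact hZM hs
  obtain ⟨g, hg, e⟩ := hY (X ∪ Z) hYM (by
    rintro s (((hs | hs) | hs) | hs)
    · exact Or.inr (Or.inl (hAB s hs))
    · exact Or.inl hs
    · exact Or.inr (Or.inl (hAB' s hs))
    · refine Or.inr (Or.inr fun hk => ?_)
      have b1 := abs_le.1 (hyκ s hk)
      have b2 := (hZd s hs).2
      linarith [b1.2, le_max_left y c.im])
  refine winding (p₁ := p₁) (p₂ := p₂) (u := Complex.I) (v := Complex.I) hXp
    (convex_segment p₁ p₂).isPreconnected (Or.inr hp₁) (Or.inl (Or.inl hp₂))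
    (left_mem_segment _ _ _) (right_mem_segment _ _ _)
    ?_ ?_ ?_ ?_ ?_ ?_ hg e
  · rintro s ((hs | hs) | hs)
    · refine Or.inr ?_
      have := (hAs s hs).2.1
      simp; intro h; linarith
    · refine Or.inl ?_
      have := (hPd s hs).2.2.2.1
      simp; linarith
    · refine Or.inr ?_
      have := (hAs' s hs).1
      simp; intro h; linarith
  · intro s hs
    refine Or.inl ?_
    have := (hZd s hs).2
    have := le_max_right y c.im
    simp; linarith
  · rintro s ((hs | hs) | hs)
    · refine Or.inr ?_
      have := (hAs s hs).2.1
      simp; intro h; linarith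
    · refine Or.inl ?_
      have := (hPd s hs).2.2.2.2.1
      simp; linarith
    · refine Or.inr ?_
      have := (hAs' s hs).2.1
      simp; intro h; linarith
  · intro s hs
    refine Or.inr ?_
    have := (hZd s hs).1
    simp; intro h; linarith
  · have := hp₁s.1
    simp; linarith
  · have := hp₂s.2.1
    simp; linarith

end Setup





def LCd (U : Set (OnePoint ℂ)) (z : ℂ) : Prop :=
  ∀ ε > 0, ∃ N : Set ℂ, ∃ δ > 0, IsPreconnected N ∧ IsClosed N ∧ N ⊆ KK U ∧
    KK U ∩ closedBall z δ ⊆ N ∧ N ⊆ closedBall z ε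

def Cof (f : ℂ → ℂ) (z : ℂ) : Prop :=
  ∀ δ > 0, ∀ R : ℝ, ∃ a ∈ Str, R < a.re ∧ 0 ≤ a.im ∧ f a ∈ closedBall z δ

namespace Setup
variable {U : Set (OnePoint ℂ)} {F : ℂ → OnePoint ℂ} {G : OnePoint ℂ → ℂ} {M : ℝ} {f : ℂ → ℂ}

lemma good (S : Setup U F G M f) {B₀ B₁ : Set ℂ} (c₀ : IsClosed B₀) (c₁ : IsClosed B₁)
    (hd : Disjoint B₁ B₀) {a : ℂ} (ha : a ∈ StrM M) (ha0 : 0 ≤ a.im) (haB : f a ∈ B₀) :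
    ∃ a' ∈ Str, a'.re = a.re ∧ 0 ≤ a'.im ∧
      ((f a' ∈ B₀ ∧ ∀ y ∈ Icc 0 a'.im, f ⟨a'.re, y⟩ ∉ B₁) ∨
       (f a' ∈ B₁ ∧ ∀ y ∈ Icc 0 a'.im, f ⟨a'.re, y⟩ ∉ B₀)) := by
  have hm : ∀ y ∈ Icc 0 a.im, (⟨a.re, y⟩ : ℂ) ∈ StrM M := fun y hy =>
    ⟨ha.1, (abs_le_abs hy.2 (by linarith [hy.1])).trans_lt ha.2⟩
  have hcont : ContinuousOn (fun y : ℝ => f ⟨a.re, y⟩) (Icc 0 a.im) := by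
    refine S.fd.continuousOn.comp (Continuous.continuousOn ?_) hm
    have : Complex.mk a.re = fun y : ℝ => (a.re : ℂ) + y * Complex.I := by
      funext y; apply Complex.ext <;> simp
    rw [this]; fun_prop
  have hT : IsCompact (Icc 0 a.im ∩ (fun y : ℝ => f ⟨a.re, y⟩) ⁻¹' (B₀ ∪ B₁)) :=
    isCompact_Icc.of_isClosed_subset
      (hcont.preimage_isClosed_of_isClosed isClosed_Icc (c₀.union c₁)) inter_subset_left
  obtain ⟨y, ⟨hy, hyB⟩, hmin⟩ := hT.exists_isLeast ⟨a.im, ⟨ha0, le_rfl⟩, Or.inl haB⟩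
  have hlt : ∀ t ∈ Icc 0 y, t ≠ y → f ⟨a.re, t⟩ ∉ B₀ ∪ B₁ := by
    intro t ht hne hB
    exact hne (le_antisymm ht.2 (hmin ⟨⟨ht.1, ht.2.trans hy.2⟩, hB⟩))
  refine ⟨⟨a.re, y⟩, (hm y hy).2, rfl, hy.1, ?_⟩
  rcases hyB with h | h
  · refine Or.inl ⟨h, fun t ht hB => ?_⟩
    by_cases e : t = y
    · subst e; exact disjoint_left.1 hd hB h
    · exact hlt t ht e (Or.inr hB)
  · refine Or.inr ⟨h, fun t ht hB => ?_⟩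
    by_cases e : t = y
    · subst e; exact disjoint_left.1 hd h hB
    · exact hlt t ht e (Or.inl hB)

lemma wall_near (S : Setup U F G M f) {z : ℂ} {δ : ℝ} (hδ : 0 < δ)
    (h : ∀ R : ℝ, ∃ x > R, f ⟨x, 0⟩ ∈ closedBall z (δ / 2)) :
    ∀ R : ℝ, ∃ x' > R, ∀ s ∈ Str, s.re = x' → f s ∈ closedBall z δ := by
  intro R
  obtain ⟨M', -, hA⟩ := S.AN (η := δ / 24) (by positivity)
  obtain ⟨x, hx, hxB⟩ := h (max R M')
  obtain ⟨x', hx', hw⟩ := hA x ((le_max_right _ _).trans_lt hx)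
  refine ⟨x', lt_of_lt_of_le ((le_max_left _ _).trans_lt hx) hx'.1, fun s hs e => ?_⟩
  have h1 := hw s.im hs
  rw [← e, Complex.eta] at h1
  rw [mem_closedBall, dist_eq_norm] at hxB ⊢
  calc _ ≤ ‖f s - f ⟨x, 0⟩‖ + ‖f ⟨x, 0⟩ - z‖ := norm_sub_le_norm_sub_add_norm_sub ..
    _ ≤ δ := by linarith

theorem strip_main (S : Setup U F G M f) {z₀ z₁ : ℂ} (hne : z₀ ≠ z₁) (hz₀ : z₀ ∈ KK U)
    (hz₁ : z₁ ∈ KK U) (l₀ : LCd U z₀) (l₁ : LCd U z₁) (c₀ : Cof f z₀) (c₁ : Cof f z₁) : False := by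
  have hdp : 0 < dist z₀ z₁ := dist_pos.2 hne
  set d := dist z₀ z₁ with hd
  obtain ⟨N₀, δ₀, hδ₀, hN₀, hN₀c, hN₀K, hN₀B, hN₀s⟩ := l₀ (d / 3) (by positivity)
  obtain ⟨N₁, δ₁, hδ₁, hN₁, hN₁c, hN₁K, hN₁B, hN₁s⟩ := l₁ (d / 3) (by positivity)
  have hdis : Disjoint (closedBall z₁ (d / 3)) (closedBall z₀ (d / 3)) :=
    closedBall_disjoint_closedBall (by rw [dist_comm, ← hd]; linarith)
  obtain ⟨δ, hδ, e0, e1, e2⟩ : ∃ δ > 0, δ ≤ δ₀ ∧ δ ≤ δ₁ ∧ δ ≤ d / 3 :=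
    ⟨min δ₀ (min δ₁ (d / 3)), by positivity, min_le_left _ _,
      (min_le_right _ _).trans (min_le_left _ _), (min_le_right _ _).trans (min_le_right _ _)⟩
  have dis : ∀ r ≤ δ, Disjoint (closedBall z₁ r) (closedBall z₀ r) := fun r hr =>
    hdis.mono (closedBall_subset_closedBall (hr.trans e2)) (closedBall_subset_closedBall (hr.trans e2))
  have dN₀ : ∀ r ≤ δ, Disjoint (closedBall z₁ r) N₀ := fun r hr =>
    hdis.mono (closedBall_subset_closedBall (hr.trans e2)) hN₀s
  have dN₁ : ∀ r ≤ δ, Disjoint (closedBall z₀ r) N₁ := fun r hr =>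
    hdis.symm.mono (closedBall_subset_closedBall (hr.trans e2)) hN₁s
  have B₀ : ∀ r ≤ δ, KK U ∩ closedBall z₀ r ⊆ N₀ := fun r hr =>
    (inter_subset_inter_right _ (closedBall_subset_closedBall (hr.trans e0))).trans hN₀B
  have B₁ : ∀ r ≤ δ, KK U ∩ closedBall z₁ r ⊆ N₁ := fun r hr =>
    (inter_subset_inter_right _ (closedBall_subset_closedBall (hr.trans e1))).trans hN₁B
  by_cases h0 : ∀ R : ℝ, ∃ x > R, f ⟨x, 0⟩ ∈ closedBall z₀ (δ / 2)
  · exact S.case1 hN₀ hN₀c hN₀K (B₀ δ le_rfl) (dN₀ δ le_rfl) (dis δ le_rfl) (S.wall_near hδ h0)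
      (c₁ δ hδ)
  by_cases h1 : ∀ R : ℝ, ∃ x > R, f ⟨x, 0⟩ ∈ closedBall z₁ (δ / 2)
  · exact S.case1 hN₁ hN₁c hN₁K (B₁ δ le_rfl) (dN₁ δ le_rfl) (dis δ le_rfl).symm
      (S.wall_near hδ h1) (c₀ δ hδ)
  push Not at h0 h1
  obtain ⟨R₀, h0⟩ := h0
  obtain ⟨R₁, h1⟩ := h1
  obtain ⟨M', -, hA⟩ := S.AN (η := δ / 96) (by positivity)
  set M₁ := max (max R₀ R₁) (max M M') with hM₁
  have m0 : R₀ ≤ M₁ := (le_max_left _ _).trans (le_max_left _ _)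
  have m1 : R₁ ≤ M₁ := (le_max_right _ _).trans (le_max_left _ _)
  have m2 : M ≤ M₁ := (le_max_left _ _).trans (le_max_right _ _)
  have m3 : M' ≤ M₁ := (le_max_right _ _).trans (le_max_right _ _)
  set r := δ / 4 with hr
  have hrδ : r ≤ δ := by linarith
  have hr0 : 0 < r := by linarith
  have sm : ∀ z w : ℂ, w ∉ closedBall z (δ / 2) → w ∉ closedBall z r := fun z w h h' =>
    h (closedBall_subset_closedBall (by linarith) h')
  have ax₀ : ∀ x > M₁, f ⟨x, 0⟩ ∉ closedBall z₀ r := fun x hx => sm _ _ (h0 x (m0.trans_lt hx))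
  have ax₁ : ∀ x > M₁, f ⟨x, 0⟩ ∉ closedBall z₁ r := fun x hx => sm _ _ (h1 x (m1.trans_lt hx))
  have hw : ∀ R : ℝ, ∃ x' > R, ∀ s ∈ Str, s.re = x' →
      f s ∉ closedBall z₀ r ∧ f s ∉ closedBall z₁ r := by
    intro R
    obtain ⟨x', hx', hw⟩ := hA (max R M₁ + 1) (by linarith [le_max_right R M₁])
    refine ⟨x', by linarith [hx'.1, le_max_left R M₁], fun s hs e => ?_⟩
    have b := hw s.im hs
    rw [← e, Complex.eta] at b
    have key : ∀ z, f ⟨max R M₁ + 1, 0⟩ ∉ closedBall z (δ / 2) → f s ∉ closedBall z r := by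
      intro z h h'
      apply h
      rw [mem_closedBall, dist_eq_norm] at h' ⊢
      rw [norm_sub_rev] at b
      calc _ ≤ ‖f ⟨max R M₁ + 1, 0⟩ - f s‖ + ‖f s - z‖ := norm_sub_le_norm_sub_add_norm_sub ..
        _ ≤ _ := by linarith
    exact ⟨key _ (h0 _ (by linarith [le_max_right R M₁])),
      key _ (h1 _ (by linarith [le_max_right R M₁]))⟩
  by_cases g0 : ∀ R : ℝ, ∃ a ∈ Str, R < a.re ∧ 0 ≤ a.im ∧ f a ∈ closedBall z₀ r ∧
      ∀ y ∈ Icc 0 a.im, f ⟨a.re, y⟩ ∉ closedBall z₁ r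
  · exact S.case2 hN₀ hz₀ hz₁ hN₀c hN₀K (B₀ r hrδ) (dN₀ r hrδ) (dis r hrδ) m2 ax₀ ax₁ hw g0 (c₁ r hr0)
  by_cases g1 : ∀ R : ℝ, ∃ a ∈ Str, R < a.re ∧ 0 ≤ a.im ∧ f a ∈ closedBall z₁ r ∧
      ∀ y ∈ Icc 0 a.im, f ⟨a.re, y⟩ ∉ closedBall z₀ r
  · exact S.case2 hN₁ hz₁ hz₀ hN₁c hN₁K (B₁ r hrδ) (dN₁ r hrδ) (dis r hrδ).symm m2 ax₁ ax₀
      (fun R => (hw R).imp fun x h => ⟨h.1, fun s hs e => (h.2 s hs e).symm⟩) g1 (c₀ r hr0)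
  exfalso
  rw [not_forall] at g0 g1
  obtain ⟨Q₀, g0⟩ := g0
  obtain ⟨Q₁, g1⟩ := g1
  obtain ⟨a, haS, haR, ha0, haB⟩ := c₀ r hr0 (max (max Q₀ Q₁) M)
  obtain ⟨q, qM⟩ := max_lt_iff.1 haR
  obtain ⟨q0, q1⟩ := max_lt_iff.1 q
  obtain ⟨a', hS, hre, him, h | h⟩ := S.good (B₀ := closedBall z₀ r) (B₁ := closedBall z₁ r)
    isClosed_closedBall isClosed_closedBall (dis r hrδ) ⟨qM, haS⟩ ha0 haB
  · exact g0 ⟨a', hS, by rwa [hre], him, h.1, h.2⟩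
  · exact g1 ⟨a', hS, by rwa [hre], him, h.1, h.2⟩

end Setup





def cq (ζ s : ℂ) : ℂ := ζ * ((Complex.exp s - 1) / (Complex.exp s + 1))
def cp (ζ w : ℂ) : ℂ := Complex.log ((1 + w / ζ) / (1 - w / ζ))

lemma exp_re_pos {s : ℂ} (hs : s ∈ Str) : 0 < (Complex.exp s).re := by
  rw [Complex.exp_re]
  exact mul_pos (Real.exp_pos _) (Real.cos_pos_of_mem_Ioo (abs_lt.1 hs))

lemma exp_add_ne {s : ℂ} (hs : s ∈ Str) : Complex.exp s + 1 ≠ 0 := by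
  intro h
  have h1 := congrArg Complex.re h
  have := exp_re_pos hs
  simp at h1
  linarith

lemma one_sub_ne {v : ℂ} (hv : ‖v‖ < 1) : 1 - v ≠ 0 := by
  intro h
  rw [← sub_eq_zero.1 h] at hv; simp at hv

lemma cayley_re_pos {v : ℂ} (hv : ‖v‖ < 1) : 0 < ((1 + v) / (1 - v)).re := by
  have h0 := Complex.normSq_pos.2 (one_sub_ne hv)
  have h1 : v.re * v.re + v.im * v.im < 1 := by
    rw [← Complex.normSq_apply, Complex.normSq_eq_norm_sq]
    nlinarith [norm_nonneg v]
  rw [Complex.div_re, ← add_div]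
  apply div_pos _ h0
  simp; nlinarith

lemma cayley_im {v : ℂ} (h : 0 ≤ v.im) : 0 ≤ ((1 + v) / (1 - v)).im := by
  rw [Complex.div_im, ← sub_div]
  apply div_nonneg _ (Complex.normSq_nonneg _)
  simp; nlinarith


lemma zne {ζ : ℂ} (hζ : ‖ζ‖ = 1) : ζ ≠ 0 := by rintro rfl; simp at hζ

lemma ndiv {ζ : ℂ} (hζ : ‖ζ‖ = 1) (w : ℂ) (hw : w ∈ ball (0:ℂ) 1) : ‖w / ζ‖ < 1 := by
  rw [norm_div, hζ, div_one]; simpa using hw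

lemma cq_mem {ζ : ℂ} (hζ : ‖ζ‖ = 1) {s : ℂ} (hs : s ∈ Str) : cq ζ s ∈ ball (0:ℂ) 1 := by
  have h := exp_re_pos hs
  have hn := exp_add_ne hs
  rw [mem_ball_zero_iff, cq, norm_mul, hζ, one_mul, norm_div, div_lt_one (norm_pos_iff.2 hn),
    ← sq_lt_sq₀ (norm_nonneg _) (norm_nonneg _), Complex.sq_norm, Complex.sq_norm,
    Complex.normSq_apply, Complex.normSq_apply]
  simp only [Complex.sub_re, Complex.sub_im, Complex.add_re, Complex.add_im, Complex.one_re,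
    Complex.one_im]
  nlinarith

lemma cp_mem {ζ : ℂ} (hζ : ‖ζ‖ = 1) {w : ℂ} (hw : w ∈ ball (0:ℂ) 1) : cp ζ w ∈ Str := by
  show |(cp ζ w).im| < _
  rw [cp, Complex.log_im, Complex.abs_arg_lt_pi_div_two_iff]
  exact Or.inl (cayley_re_pos (ndiv hζ w hw))

lemma cq_cp {ζ : ℂ} (hζ : ‖ζ‖ = 1) {w : ℂ} (hw : w ∈ ball (0:ℂ) 1) : cq ζ (cp ζ w) = w := by
  have hz := zne hζ
  have h1 := cayley_re_pos (ndiv hζ w hw)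
  have h2 := one_sub_ne (ndiv hζ w hw)
  have h3 : (1 + w / ζ) / (1 - w / ζ) ≠ 0 := by intro h; rw [h] at h1; simp at h1
  rw [cq, cp, Complex.exp_log h3]
  generalize hv : w / ζ = v at *
  have hw' : w = ζ * v := by rw [← hv]; field_simp
  rw [hw']
  have e1 : (1 + v) / (1 - v) - 1 = 2 * v / (1 - v) := by field_simp; ring
  have e2 : (1 + v) / (1 - v) + 1 = 2 / (1 - v) := by field_simp; ring
  rw [e1, e2]
  field_simp

lemma cp_cq {ζ : ℂ} (hζ : ‖ζ‖ = 1) {s : ℂ} (hs : s ∈ Str) : cp ζ (cq ζ s) = s := by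
  have hz := zne hζ
  have hn := exp_add_ne hs
  have hs' := abs_lt.1 (show |s.im| < Real.pi / 2 from hs)
  rw [cp, cq, mul_div_cancel_left₀ _ hz]
  have e0 := Complex.exp_ne_zero s
  have e1 : 1 + (Complex.exp s - 1) / (Complex.exp s + 1) = 2 * Complex.exp s / (Complex.exp s + 1) := by
    field_simp; ring
  have e2 : 1 - (Complex.exp s - 1) / (Complex.exp s + 1) = 2 / (Complex.exp s + 1) := by
    field_simp; ring
  have e3 : (2 * Complex.exp s / (Complex.exp s + 1)) / (2 / (Complex.exp s + 1)) = Complex.exp s := by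
    field_simp
  rw [e1, e2, e3]
  exact Complex.log_exp (by linarith [Real.pi_pos]) (by linarith [Real.pi_pos])

lemma cp_cont {ζ : ℂ} (hζ : ‖ζ‖ = 1) : ContinuousOn (cp ζ) (ball 0 1) := by
  unfold cp
  refine ContinuousOn.clog ?_ fun w hw => Or.inl (cayley_re_pos (ndiv hζ w hw))
  refine ContinuousOn.div (by fun_prop) (by fun_prop) fun w hw => one_sub_ne (ndiv hζ w hw)

lemma cq_diff {ζ : ℂ} {s : ℂ} (hs : s ∈ Str) : DifferentiableAt ℂ (cq ζ) s := by
  unfold cq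
  have h1 : DifferentiableAt ℂ (fun s => Complex.exp s - 1) s := by fun_prop
  have h2 : DifferentiableAt ℂ (fun s => Complex.exp s + 1) s := by fun_prop
  exact (h1.fun_div h2 (exp_add_ne hs)).const_mul _

lemma cp_im {ζ : ℂ} {w : ℂ} (h : 0 ≤ (w / ζ).im) : 0 ≤ (cp ζ w).im := by
  rw [cp, Complex.log_im, Complex.arg_nonneg_iff]
  exact cayley_im h

lemma cp_re {ζ : ℂ} (hζ : ‖ζ‖ = 1) (R : ℝ) : ∀ᶠ w in 𝓝 ζ, w ∈ ball (0:ℂ) 1 → R < (cp ζ w).re := by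
  have hz := zne hζ
  have h1 : Tendsto (fun w => ‖1 - w / ζ‖) (𝓝 ζ) (𝓝 0) := by
    have : Continuous fun w => ‖1 - w / ζ‖ := by fun_prop
    simpa [hz] using this.tendsto ζ
  have h2 : Tendsto (fun w => ‖1 + w / ζ‖) (𝓝 ζ) (𝓝 2) := by
    have : Continuous fun w => ‖1 + w / ζ‖ := by fun_prop
    have := this.tendsto ζ
    rw [div_self hz] at this
    norm_num at this; exact this
  filter_upwards [h1.eventually (gt_mem_nhds (Real.exp_pos (-R))),
    h2.eventually (lt_mem_nhds (show (1:ℝ) < 2 by norm_num))] with w a b hw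
  have hp := norm_pos_iff.2 (one_sub_ne (ndiv hζ w hw))
  rw [cp, Complex.log_re, norm_div, Real.lt_log_iff_exp_lt (by positivity), lt_div_iff₀ hp]
  calc Real.exp R * ‖1 - w / ζ‖ < Real.exp R * Real.exp (-R) := by gcongr
    _ = 1 := by rw [← Real.exp_add]; simp
    _ < _ := b






lemma lcd_of {U : Set (OnePoint ℂ)} (hU : IsOpen U) {z : ℂ} (hz : z ∈ KK U)
    (h : LocallyConnectedAt Uᶜ (z : OnePoint ℂ)) : LCd U z := by
  intro ε hε
  have hV : ((↑) '' ball z ε : Set (OnePoint ℂ)) ∈ 𝓝[Uᶜ] (z : OnePoint ℂ) :=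
    mem_nhdsWithin_of_mem_nhds ((OnePoint.isOpenMap_coe _ isOpen_ball).mem_nhds
      (mem_image_of_mem _ (mem_ball_self hε)))
  obtain ⟨N', hN', hsub, hc⟩ := h _ hV
  have hKc : IsClosed (KK U) := (hU.preimage OnePoint.continuous_coe).isClosed_compl
  have hr : N' ⊆ range ((↑) : ℂ → OnePoint ℂ) := fun x hx => by
    obtain ⟨y, _, rfl⟩ := (hsub hx).2; exact ⟨y, rfl⟩
  have hp := hc.isPreconnected.preimage_of_isOpenMap OnePoint.coe_injective OnePoint.isOpenMap_coe hr
  rw [OnePoint.nhdsWithin_coe, mem_map, mem_nhdsWithin_iff] at hN'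
  obtain ⟨δ, hδ, hd⟩ := hN'
  refine ⟨closure ((↑) ⁻¹' N' : Set ℂ), δ / 2, by positivity, hp.closure, isClosed_closure, ?_, ?_, ?_⟩
  · exact closure_minimal (fun x hx => (hsub hx).1) hKc
  · rintro x ⟨hx, hx2⟩
    exact subset_closure (hd ⟨closedBall_subset_ball (by linarith) hx2, hx⟩)
  · refine closure_minimal (fun x hx => ?_) isClosed_closedBall
    obtain ⟨y, hy, e⟩ := (hsub hx).2
    rw [OnePoint.coe_injective e] at hy
    exact ball_subset_closedBall hy

lemma imp_not_mem {U : Set (OnePoint ℂ)} (hU : IsOpen U) {φ : ℂ → OnePoint ℂ} {ψ : OnePoint ℂ → ℂ}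
    (hψc : ContinuousOn ψ U) (hψm : MapsTo ψ U (ball (0:ℂ) 1))
    (hψφ : ∀ z ∈ ball (0 : ℂ) 1, ψ (φ z) = z) {ζ : ℂ} (hζ : ‖ζ‖ = 1) {z : OnePoint ℂ}
    (hz : z ∈ impression φ ζ) : z ∉ U := by
  intro hzU
  obtain ⟨w, hw, hw1, hw2⟩ := hz
  have h1 := ((hψc.continuousAt (hU.mem_nhds hzU)).tendsto).comp hw2
  have h2 : Tendsto w atTop (𝓝 (ψ z)) := h1.congr fun j => hψφ _ (hw j)
  have := hψm hzU
  rw [tendsto_nhds_unique h2 hw1, mem_ball_zero_iff, hζ] at this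
  exact lt_irrefl _ this

lemma curve_through (w : ℕ → ℂ) : ∃ g : ℝ → ℂ, Continuous g ∧ (∀ n : ℕ, g n = w n) ∧
    ∀ x : ℝ, ∀ C : Set ℂ, Convex ℝ C → (∀ n : ℕ, x - 1 < n → w n ∈ C) → g x ∈ C := by
  let t : ℝ → Set ℂ := fun x => convexHull ℝ {v | ∃ k : ℤ, |x - k| < 1 ∧ v = w k.toNat}
  obtain ⟨g, hg⟩ := exists_continuous_forall_mem_convex_of_local_const (t := t)
    (fun x => convex_convexHull ℝ _) (fun x => by
      refine ⟨w ⌊x⌋.toNat, ?_⟩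
      have : Continuous fun y : ℝ => |y - ⌊x⌋| := by fun_prop
      filter_upwards [this.continuousAt.eventually (gt_mem_nhds (show |x - ⌊x⌋| < 1 by
        rw [abs_lt]; constructor <;> linarith [Int.floor_le x, Int.lt_floor_add_one x]))] with y hy
      exact subset_convexHull ℝ _ ⟨_, hy, rfl⟩)
  refine ⟨g, g.continuous, fun n => ?_, fun x C hC h => ?_⟩
  · have h1 := hg n
    have : {v | ∃ k : ℤ, |((n:ℕ):ℝ) - k| < 1 ∧ v = w k.toNat} = {w n} := by
      ext v; constructor
      · rintro ⟨k, hk, rfl⟩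
        have : |(n:ℤ) - k| < 1 := by exact_mod_cast hk
        have : k = n := by rw [Int.abs_lt_one_iff] at this; omega
        simp [this]
      · rintro rfl
        exact ⟨n, by simp, by simp⟩
    simp only [t, this, convexHull_singleton] at h1
    exact h1
  · refine convexHull_min ?_ hC (hg x)
    rintro v ⟨k, hk, rfl⟩
    apply h
    have h2 : k ≤ (k.toNat : ℤ) := Int.self_le_toNat k
    have h3 : (k:ℝ) ≤ (k.toNat : ℝ) := by exact_mod_cast h2
    linarith [(abs_lt.1 hk).2]

lemma left_seq {U : Set (OnePoint ℂ)} {φ : ℂ → OnePoint ℂ} {ψ : OnePoint ℂ → ℂ}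
    (hφc : ContinuousOn φ (ball (0:ℂ) 1)) (hφm : MapsTo φ (ball (0:ℂ) 1) U)
    (hψm : MapsTo ψ U (ball (0:ℂ) 1))
    (hψφ : ∀ z ∈ ball (0 : ℂ) 1, ψ (φ z) = z) (hφψ : ∀ w ∈ U, φ (ψ w) = w) {ζ : ℂ}
    (hsym : leftWing U ψ ζ = rightWing U ψ ζ) {z : OnePoint ℂ}
    (hz : z ∈ impression φ ζ) {O : Set (OnePoint ℂ)} (hO : O ∈ 𝓝 z) {W : Set ℂ} (hW : W ∈ 𝓝 ζ) :
    ∃ a ∈ ball (0:ℂ) 1, a ∈ W ∧ 0 ≤ (a / ζ).im ∧ φ a ∈ O := by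
  obtain ⟨w, hw, hw1, hw2⟩ := hz
  by_cases hf : ∃ᶠ j in atTop, 0 ≤ (w j / ζ).im
  · obtain ⟨j, h1, h2, h3⟩ := (hf.and_eventually ((hw1.eventually_mem hW).and (hw2.eventually_mem hO))).exists
    exact ⟨w j, hw j, h2, h1, h3⟩
  · simp only [not_frequently, not_le] at hf
    obtain ⟨g, gc, gn, gC⟩ := curve_through w
    have ev : ∀ C : Set ℂ, Convex ℝ C → (∀ᶠ n in atTop, w n ∈ C) → ∀ᶠ x in atTop, g x ∈ C := by
      intro C hC h
      obtain ⟨n0, h0⟩ := eventually_atTop.1 h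
      filter_upwards [eventually_ge_atTop ((n0:ℝ) + 1)] with x hx
      refine gC x C hC fun n hn => h0 n ?_
      have : (n0:ℝ) < n := by linarith
      exact_mod_cast this.le
    have gb : ∀ x, g x ∈ ball (0:ℂ) 1 := fun x => gC x _ (convex_ball _ _) fun n _ => hw n
    have gt : Tendsto g atTop (𝓝 ζ) := by
      rw [Metric.tendsto_nhds]
      intro ε hε
      exact ev (ball ζ ε) (convex_ball _ _) (hw1 (ball_mem_nhds _ hε))
    have hR : z ∈ rightWing U ψ ζ := by
      refine ⟨fun x => φ (g x), ⟨⟨⟨?_, ?_⟩, ?_⟩, ?_⟩, ?_⟩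
      · exact (hφc.comp_continuous gc gb).continuousOn
      · exact fun x _ => hφm (gb x)
      · exact gt.congr fun x => (hψφ _ (gb x)).symm
      · have hcx : Convex ℝ {v : ℂ | (v / ζ).im ≤ 0} := by
          have : {v : ℂ | (v / ζ).im ≤ 0} = {v : ℂ | (Complex.imLm ∘ₗ (LinearMap.mulRight ℝ ζ⁻¹)) v ≤ 0} := by
            ext v; simp [div_eq_mul_inv]
          rw [this]
          exact convex_halfSpace_le (LinearMap.isLinear _) 0
        filter_upwards [ev _ hcx (hf.mono fun n hn => hn.le)] with x hx
        rw [hψφ _ (gb x)]; exact hx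
      · exact ⟨fun n => n, tendsto_natCast_atTop_atTop, by simpa only [gn] using hw2⟩
    rw [← hsym] at hR
    obtain ⟨Γ, ⟨⟨⟨_, Γm⟩, Γt⟩, Γl⟩, t, ht, htz⟩ := hR
    obtain ⟨j, h1, h2, h3, h4⟩ := ((ht.eventually Γl).and ((ht.eventually (Γt.eventually_mem hW)).and
      ((htz.eventually_mem hO).and (ht.eventually (eventually_ge_atTop 0))))).exists
    refine ⟨ψ (Γ (t j)), hψm (Γm h4), h2, h1, ?_⟩
    rw [hφψ _ (Γm h4)]; exact h3

lemma mk_setup {U : Set (OnePoint ℂ)} (hU : IsOpen U) (hinf : ∞ ∈ U)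
    {φ : ℂ → OnePoint ℂ} {ψ : OnePoint ℂ → ℂ}
    (hφc : ContinuousOn φ (ball (0:ℂ) 1)) (hφm : MapsTo φ (ball (0:ℂ) 1) U)
    (hφhol : HolomorphicIntoSphereOn φ (ball (0 : ℂ) 1))
    (hψc : ContinuousOn ψ U)
    (hψm : MapsTo ψ U (ball (0:ℂ) 1))
    (hψφ : ∀ z ∈ ball (0 : ℂ) 1, ψ (φ z) = z) (hφψ : ∀ w ∈ U, φ (ψ w) = w) {ζ : ℂ} (hζ : ‖ζ‖ = 1) :
    ∃ (M : ℝ) (f : ℂ → ℂ), Setup U (fun s => φ (cq ζ s)) (fun z => cp ζ (ψ z)) M f := by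
  have Gc : ContinuousOn (fun z => cp ζ (ψ z)) U := (cp_cont hζ).comp hψc hψm
  have GF : ∀ s ∈ Str, cp ζ (ψ (φ (cq ζ s))) = s := fun s hs => by
    rw [hψφ _ (cq_mem hζ hs), cp_cq hζ hs]
  set M : ℝ := (cp ζ (ψ ∞)).re + 1 with hM
  have hcr : ∀ᶠ z in 𝓝 (∞ : OnePoint ℂ), (cp ζ (ψ z)).re < M :=
    (Complex.continuous_re.continuousAt.comp (Gc.continuousAt (hU.mem_nhds hinf))).eventually
      (gt_mem_nhds (by simp [hM]))
  let f : ℂ → ℂ := fun s => (φ (cq ζ s)).elim 0 id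
  have hsub : StrM M ⊆ Str := fun s hs => hs.2
  have hnot : ∀ s ∈ StrM M, ¬ (cp ζ (ψ (φ (cq ζ s)))).re < M := fun s hs => by
    rw [GF s (hsub hs)]; exact not_lt.2 hs.1.le
  have Ff : ∀ s ∈ StrM M, φ (cq ζ s) = ((f s : ℂ) : OnePoint ℂ) := by
    intro s hs
    have hne : φ (cq ζ s) ≠ ∞ := fun h => hnot s hs (by rw [h]; exact hcr.self_of_nhds)
    obtain ⟨y, hy⟩ := OnePoint.ne_infty_iff_exists.1 hne
    simp only [f, ← hy]; rfl
  have cqt : ∀ s ∈ Str, Tendsto (cq ζ) (𝓝 s) (𝓝 (cq ζ s)) := fun s hs =>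
    (cq_diff hs).continuousAt
  refine ⟨M, f, hU, hinf, ?_, ?_, Gc, ?_, GF, ?_, Ff, ?_, ?_⟩
  · exact hφc.comp (fun s hs => (cq_diff hs).continuousAt.continuousWithinAt) fun s hs => cq_mem hζ hs
  · exact fun s hs => hφm (cq_mem hζ hs)
  · exact fun z hz => cp_mem hζ (hψm hz)
  · intro z hz
    simp only [cq_cp hζ (hψm hz), hφψ z hz]
  · intro s hs
    apply DifferentiableAt.differentiableWithinAt
    have hev : ∀ᶠ x in 𝓝 s, x ∈ StrM M := (StrM_open M).mem_nhds hs
    rcases hφhol _ (cq_mem hζ (hsub hs)) with ⟨g, hg, he⟩ | ⟨g, hg, he⟩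
    · have h1 : DifferentiableAt ℂ (fun x => g (cq ζ x)) s :=
        DifferentiableAt.comp s hg.differentiableAt (cq_diff (hsub hs))
      refine h1.congr_of_eventuallyEq ?_
      filter_upwards [hev, (cqt s (hsub hs)).eventually he] with x hx hx2
      exact OnePoint.coe_injective ((Ff x hx).symm.trans hx2)
    · have h0 : ∀ x ∈ StrM M, φ (cq ζ x) = (if g (cq ζ x) = 0 then (∞ : OnePoint ℂ) else (((g (cq ζ x))⁻¹ : ℂ) : OnePoint ℂ)) →
          g (cq ζ x) ≠ 0 ∧ f x = (g (cq ζ x))⁻¹ := by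
        intro x hx h
        rw [Ff x hx] at h
        split_ifs at h with h'
        · exact absurd h (OnePoint.coe_ne_infty _)
        · exact ⟨h', OnePoint.coe_injective h⟩
      have h1 : DifferentiableAt ℂ (fun x => g (cq ζ x)) s :=
        DifferentiableAt.comp s hg.differentiableAt (cq_diff (hsub hs))
      refine (h1.fun_inv (h0 s hs he.self_of_nhds).1).congr_of_eventuallyEq ?_
      filter_upwards [hev, (cqt s (hsub hs)).eventually he] with x hx hx2
      exact (h0 x hx hx2).2
  · have h1 : ∀ᶠ y : ℂ in Bornology.cobounded ℂ, (cp ζ (ψ (y : OnePoint ℂ))).re < M := by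
      rw [Metric.cobounded_eq_cocompact, ← coclosedCompact_eq_cocompact]
      exact OnePoint.tendsto_coe_infty.eventually hcr
    have h2 : Bornology.IsBounded {y : ℂ | (cp ζ (ψ (y : OnePoint ℂ))).re < M}ᶜ := by
      rw [Bornology.isBounded_def, compl_compl]; exact h1
    refine h2.subset ?_
    rintro _ ⟨s, hs, rfl⟩
    have := hnot s hs
    rw [Ff s hs] at this
    exact this


/-- If the prime end `ζ` is symmetric, its impression contains at most one point at which
`K` is locally connected. -/
theorem stmt1
    (U : Set ℂ∞) (hUopen : IsOpen U) (hUconn : IsConnected U)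
    (hUsc : SimplyConnectedSpace U) (hinfty : ∞ ∈ U)
    (hKconn : IsConnected Uᶜ) (hKnt : Set.Nontrivial Uᶜ)
    (φ : ℂ → ℂ∞) (ψ : ℂ∞ → ℂ)
    (hφcont : ContinuousOn φ (ball (0 : ℂ) 1))
    (hφmaps : MapsTo φ (ball (0 : ℂ) 1) U)
    (hφhol : HolomorphicIntoSphereOn φ (ball (0 : ℂ) 1))
    (hψcont : ContinuousOn ψ U)
    (hψmaps : MapsTo ψ U (ball (0 : ℂ) 1))
    (hψφ : ∀ z ∈ ball (0 : ℂ) 1, ψ (φ z) = z)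
    (hφψ : ∀ w ∈ U, φ (ψ w) = w)
    (ζ : ℂ) (hζ : ζ ∈ sphere (0 : ℂ) 1)
    (hsym : leftWing U ψ ζ = rightWing U ψ ζ) :
    Set.encard {z ∈ impression φ ζ | LocallyConnectedAt Uᶜ z} ≤ 1 := by
  have hz1 : ‖ζ‖ = 1 := by simpa using hζ
  obtain ⟨M, f, S⟩ := mk_setup hUopen hinfty hφcont hφmaps hφhol hψcont hψmaps hψφ hφψ hz1
  have key : ∀ z ∈ {z ∈ impression φ ζ | LocallyConnectedAt Uᶜ z},
      ∃ y : ℂ, (y : ℂ∞) = z ∧ y ∈ KK U ∧ LCd U y ∧ Cof f y := by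
    rintro z ⟨hz, hl⟩
    have hzU := imp_not_mem hUopen hψcont hψmaps hψφ hz1 hz
    obtain ⟨y, rfl⟩ := OnePoint.ne_infty_iff_exists.1 (fun h => hzU (h ▸ hinfty) : z ≠ ∞)
    refine ⟨y, rfl, hzU, lcd_of hUopen hzU hl, ?_⟩
    intro δ hδ R
    obtain ⟨a, ha, haW, hai, haO⟩ := left_seq hφcont hφmaps hψmaps hψφ hφψ hsym hz
      ((OnePoint.isOpenMap_coe _ isOpen_ball).mem_nhds (mem_image_of_mem _ (mem_ball_self hδ)))
      (cp_re hz1 (max R M))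
    have hre : max R M < (cp ζ a).re := haW ha
    have hs := cp_mem hz1 ha
    refine ⟨cp ζ a, hs, (le_max_left _ _).trans_lt hre, cp_im hai, ?_⟩
    have hF := S.Ff (cp ζ a) ⟨(le_max_right _ _).trans_lt hre, hs⟩
    simp only [cq_cp hz1 ha] at hF
    rw [hF] at haO
    obtain ⟨v, hv, e⟩ := haO
    rw [← OnePoint.coe_injective e]
    exact ball_subset_closedBall hv
  rw [Set.encard_le_one_iff]
  intro a b ha hb
  by_contra hne
  obtain ⟨x, rfl, hx, lx, cx⟩ := key a ha
  obtain ⟨y, rfl, hy, ly, cy⟩ := key b hb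
  exact S.strip_main (fun h => hne (by rw [h])) hx hy lx ly cx cy


end
end
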